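/- Let M be a hyperfinite II₁ factor with ascending matrix subalgebras M_n ≅ M_{2^n}(ℂ) whose union is weakly dense, let N ⊆ M be a von Neumann subalgebra with M_n' ∩ M ⊀_M N for all n, and let ω be a free ultrafilter on ℕ. Then for every sequence (s_n) ⊆ ℕ tending to ∞ and every finite set F ⊆ M^ω, there exists a unitary v^ω in the ultraproduct ∏_{n→ω}(M_{s_n}' ∩ M) ⊆ M' ∩ M^ω such that E_{N^ω}(x^ω v^ω y^ω) = 0 for all x^ω, y^ω ∈ F. -/

import Mathlib

open scoped ComplexOrder
open Filter

namespace PopaQ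

variable {H : Type u} [NormedAddCommGroup H] [InnerProductSpace ℂ H] [CompleteSpace H]

/-- Bounded operators on `H`. -/
abbrev Op (H : Type u) [NormedAddCommGroup H] [InnerProductSpace ℂ H] [CompleteSpace H] :=
  H →L[ℂ] H

/-- The relative commutant `N' ∩ M` (as sets of operators). -/
def relComm (N M : Set (Op H)) : Set (Op H) :=
  {x | x ∈ M ∧ ∀ y ∈ N, y * x = x * y}

/-- The scalar operators `ℂ 1`. -/
def scalars (H : Type u) [NormedAddCommGroup H] [InnerProductSpace ℂ H] [CompleteSpace H] :
    Set (Op H) :=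
  {x | ∃ c : ℂ, x = c • (1 : Op H)}

/-- A (self-adjoint) projection. -/
def IsProjection (p : Op H) : Prop :=
  IsSelfAdjoint p ∧ IsIdempotentElem p

/-- `τ` is a faithful tracial state on `M`. -/
structure IsTracialState (M : Set (Op H)) (τ : Op H →ₗ[ℂ] ℂ) : Prop where
  map_one : τ 1 = 1
  tracial : ∀ x ∈ M, ∀ y ∈ M, τ (x * y) = τ (y * x)
  pos : ∀ x ∈ M, 0 ≤ τ (star x * x)
  faithful : ∀ x ∈ M, τ (star x * x) = 0 → x = 0

/-- A set of operators is finite dimensional as a complex vector space. -/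
def FinDim (S : Set (Op H)) : Prop :=
  ∃ s : Finset (Op H), S ⊆ (Submodule.span ℂ (s : Set (Op H)) : Set (Op H))

/-- `M` is a II₁ factor with faithful normal trace `τ`:
a factor (trivial center) carrying a faithful tracial state, which is
infinite dimensional. -/
structure IsII1Factor (M : VonNeumannAlgebra H) (τ : Op H →ₗ[ℂ] ℂ) : Prop where
  factor : relComm (M : Set (Op H)) (M : Set (Op H)) = scalars H
  trace : IsTracialState (M : Set (Op H)) τ
  infdim : ¬ FinDim (M : Set (Op H))

/-- `M` is hyperfinite: it is the (weak closure = double commutant) of an increasing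
union of finite-dimensional *-subalgebras. -/
def IsHyperfinite (M : VonNeumannAlgebra H) : Prop :=
  ∃ A : ℕ → StarSubalgebra ℂ (Op H),
    Monotone A ∧ (∀ n, (A n : Set (Op H)) ⊆ M) ∧ (∀ n, FinDim (A n : Set (Op H))) ∧
    Set.centralizer (Set.centralizer (⋃ n, (A n : Set (Op H)))) = (M : Set (Op H))

/-- A bounded sequence of operators. -/
def Bdd (x : ℕ → Op H) : Prop :=
  ∃ C : ℝ, ∀ n, ‖x n‖ ≤ C

/-- A sequence taking values in `S`. -/
def SeqIn (S : Set (Op H)) (x : ℕ → Op H) : Prop :=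
  ∀ n, x n ∈ S

/-- A free ultrafilter on ℕ. -/
def IsFreeUltrafilter (ω : Ultrafilter ℕ) : Prop :=
  ∀ s : Set ℕ, s.Finite → s ∉ ω

/-- `Mω` is the tracial ultrapower of `M` along `ω`, with trace `τ`;
`limω` assigns to each bounded sequence in `M` its class in `Mω` (the diagonal
embedding of `M` into `Mω` being the identity on `M`). -/
structure IsTracialUltrapower (ω : Ultrafilter ℕ) (M Mω : VonNeumannAlgebra H)
    (τ : Op H →ₗ[ℂ] ℂ) (limω : (ℕ → Op H) → Op H) : Prop where
  subset : (M : Set (Op H)) ⊆ (Mω : Set (Op H))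
  mem : ∀ x, SeqIn (M : Set (Op H)) x → Bdd x → limω x ∈ Mω
  diag : ∀ m ∈ M, limω (fun _ => m) = m
  map_add : ∀ x y, SeqIn (M : Set (Op H)) x → Bdd x → SeqIn (M : Set (Op H)) y → Bdd y →
    limω (fun n => x n + y n) = limω x + limω y
  map_mul : ∀ x y, SeqIn (M : Set (Op H)) x → Bdd x → SeqIn (M : Set (Op H)) y → Bdd y →
    limω (fun n => x n * y n) = limω x * limω y
  map_smul : ∀ (c : ℂ) x, SeqIn (M : Set (Op H)) x → Bdd x →
    limω (fun n => c • x n) = c • limω x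
  map_star : ∀ x, SeqIn (M : Set (Op H)) x → Bdd x →
    limω (fun n => star (x n)) = star (limω x)
  surj : ∀ z ∈ Mω, ∃ x, SeqIn (M : Set (Op H)) x ∧ Bdd x ∧ limω x = z
  tr : ∀ x, SeqIn (M : Set (Op H)) x → Bdd x →
    Tendsto (fun n => τ (x n)) (ω : Filter ℕ) (nhds (τ (limω x)))
  eq_zero : ∀ x, SeqIn (M : Set (Op H)) x → Bdd x →
    (limω x = 0 ↔ Tendsto (fun n => ‖τ (star (x n) * x n)‖) (ω : Filter ℕ) (nhds 0))
  traceState : IsTracialState (Mω : Set (Op H)) τ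

/-- The ultrapower `N^ω ⊆ M^ω` of a subalgebra `N ⊆ M`: classes of bounded
sequences with entries in `N`. -/
def ultrapowerSet (limω : (ℕ → Op H) → Op H) (N : Set (Op H)) : Set (Op H) :=
  {z | ∃ x, SeqIn N x ∧ Bdd x ∧ limω x = z}

/-- `θ` is a *-homomorphism from `S` to `T` (as sets of operators). -/
def IsStarHomOn (θ : Op H → Op H) (S T : Set (Op H)) : Prop :=
  (∀ x ∈ S, θ x ∈ T) ∧
  (∀ x ∈ S, ∀ y ∈ S, θ (x + y) = θ x + θ y) ∧
  (∀ x ∈ S, ∀ y ∈ S, θ (x * y) = θ x * θ y) ∧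
  (∀ (c : ℂ), ∀ x ∈ S, θ (c • x) = c • θ x) ∧
  (∀ x ∈ S, θ (star x) = star (θ x))

/-- The corner `p S p` of a set of operators. -/
def corner (p : Op H) (S : Set (Op H)) : Set (Op H) :=
  {x | x ∈ S ∧ p * x * p = x}

/-- Popa's intertwining relation: a corner of `P` embeds into `Q` inside `M`,
written `P ≺_M Q`: there are nonzero projections `p ∈ P`, `q ∈ Q`, a
*-homomorphism `θ : pPp → qQq` and a nonzero partial isometry `v ∈ qMp` with
`θ(x) v = v x` for all `x ∈ pPp`. -/
def CornerEmbeds (P Q M : Set (Op H)) : Prop :=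
  ∃ (p q v : Op H) (θ : Op H → Op H),
    p ∈ P ∧ IsProjection p ∧ p ≠ 0 ∧
    q ∈ Q ∧ IsProjection q ∧ q ≠ 0 ∧
    IsStarHomOn θ (corner p P) (corner q Q) ∧
    v ∈ M ∧ v ≠ 0 ∧ IsProjection (star v * v) ∧ q * v * p = v ∧
    ∀ x ∈ corner p P, θ x * v = v * x

/-- `E` is the (`τ`-preserving) conditional expectation from `M` onto `Q`. -/
structure IsCondExp (τ : Op H →ₗ[ℂ] ℂ) (M Q : Set (Op H)) (E : Op H → Op H) : Prop where
  mem : ∀ x ∈ M, E x ∈ Q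
  fix : ∀ q ∈ Q, E q = q
  map_add : ∀ x ∈ M, ∀ y ∈ M, E (x + y) = E x + E y
  map_smul : ∀ (c : ℂ), ∀ x ∈ M, E (c • x) = c • E x
  bimod : ∀ a ∈ Q, ∀ x ∈ M, ∀ b ∈ Q, E (a * x * b) = a * E x * b
  tr : ∀ x ∈ M, τ (E x) = τ x

/-- `c` is a Pimsner–Popa bound for the inclusion `Q ⊆ M` with conditional
expectation `E`: every positive `x ∈ M` satisfies `x ≤ c E(x)`. -/
def IndexBound (M : Set (Op H)) (E : Op H → Op H) (c : ℝ) : Prop :=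
  ∀ x ∈ M, x.IsPositive → (c • E x - x).IsPositive

/-- The inclusion `Q ⊆ M` (with conditional expectation `E`) has finite Jones index. -/
def HasFiniteIndex (M : Set (Op H)) (E : Op H → Op H) : Prop :=
  ∃ c : ℝ, 0 < c ∧ IndexBound M E c

/-- The Jones index `[M : Q]` of an inclusion `Q ⊆ M` with conditional expectation `E`,
via the Pimsner–Popa characterization as the optimal constant `c` with
`x ≤ c E(x)` for all positive `x ∈ M`. -/
noncomputable def jonesIndex (M : Set (Op H)) (E : Op H → Op H) : ℝ :=
  sInf {c : ℝ | 0 < c ∧ IndexBound M E c}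


section std
universe a k
variable {A : Type a} [CStarAlgebra A] [PartialOrder A] [StarOrderedRing A]
variable {K : Type k} [NormedAddCommGroup K] [InnerProductSpace ℂ K] [CompleteSpace K]

/-- A standard form: a Hilbert space completion of `A` with left and right actions. -/
structure StdForm (A : Type a) [CStarAlgebra A] [PartialOrder A] [StarOrderedRing A]
    (K : Type k) [NormedAddCommGroup K] [InnerProductSpace ℂ K] [CompleteSpace K] where
  hat : A →ₗ[ℂ] K
  L : A → (K →L[ℂ] K)
  R : A → (K →L[ℂ] K)
  dense : DenseRange hat
  L_hat : ∀ a b, L a (hat b) = hat (a * b)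
  R_hat : ∀ a b, R b (hat a) = hat (a * b)
  inner_hat : ∀ a b, inner ℂ (hat a) (hat b) = inner ℂ (hat 1) (hat (star a * b))
  tracial : ∀ a b, inner ℂ (hat a) (hat b) = inner ℂ (hat (star b)) (hat (star a))
  norm_one : ‖hat 1‖ = 1
  L_norm : ∀ a, ‖L a‖ ≤ ‖a‖
  R_norm : ∀ a, ‖R a‖ ≤ ‖a‖
  inj : ∀ a, hat a = 0 → a = 0

namespace StdForm
variable (S : StdForm A K)

/-- The trace. -/
noncomputable def tr (a : A) : ℂ := inner ℂ (S.hat 1) (S.hat a)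

theorem ext_hat {T T' : K →L[ℂ] K} (h : ∀ a, T (S.hat a) = T' (S.hat a)) : T = T' := by
  ext x
  exact congrFun (S.dense.equalizer T.continuous T'.continuous (funext h)) x

theorem ext_inner {x y : K} (h : ∀ a, inner ℂ (S.hat a) x = inner ℂ (S.hat a) y) : x = y := by
  refine ext_inner_left ℂ fun v => ?_
  have h1 : Continuous (fun v => inner ℂ v x) := by fun_prop
  have h2 : Continuous (fun v => inner ℂ v y) := by fun_prop
  exact congrFun (S.dense.equalizer h1 h2 (funext h)) v

theorem hat_inj {a b : A} (h : S.hat a = S.hat b) : a = b := by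
  have := S.inj (a - b) (by rw [map_sub, h, sub_self])
  exact sub_eq_zero.1 this

theorem L_mul (a b : A) : S.L (a * b) = S.L a * S.L b :=
  S.ext_hat fun c => by simp [S.L_hat, mul_assoc]

theorem R_mul (a b : A) : S.R (a * b) = S.R b * S.R a :=
  S.ext_hat fun c => by simp [S.R_hat, mul_assoc]

theorem L_one : S.L 1 = 1 := S.ext_hat fun c => by simp [S.L_hat]
theorem R_one : S.R 1 = 1 := S.ext_hat fun c => by simp [S.R_hat]
theorem L_add (a b : A) : S.L (a + b) = S.L a + S.L b :=
  S.ext_hat fun c => by simp [S.L_hat, add_mul]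
theorem R_add (a b : A) : S.R (a + b) = S.R a + S.R b :=
  S.ext_hat fun c => by simp [S.R_hat, mul_add]
theorem L_sub (a b : A) : S.L (a - b) = S.L a - S.L b :=
  S.ext_hat fun c => by simp [S.L_hat, sub_mul]
theorem R_sub (a b : A) : S.R (a - b) = S.R a - S.R b :=
  S.ext_hat fun c => by simp [S.R_hat, mul_sub]
theorem L_smul (z : ℂ) (b : A) : S.L (z • b) = z • S.L b :=
  S.ext_hat fun c => by simp [S.L_hat]
theorem R_smul (z : ℂ) (b : A) : S.R (z • b) = z • S.R b :=
  S.ext_hat fun c => by simp [S.R_hat]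
theorem R_zero : S.R 0 = 0 := S.ext_hat fun c => by simp [S.R_hat]
theorem L_zero : S.L 0 = 0 := S.ext_hat fun c => by simp [S.L_hat]

theorem LR (a b : A) (x : K) : S.L a (S.R b x) = S.R b (S.L a x) := by
  have : S.L a * S.R b = S.R b * S.L a := S.ext_hat fun c => by simp [S.L_hat, S.R_hat, mul_assoc]
  exact congrArg (fun T : K →L[ℂ] K => T x) this

theorem R_R (a b : A) (x : K) : S.R b (S.R a x) = S.R (a * b) x := by rw [R_mul]; rfl
theorem L_L (a b : A) (x : K) : S.L a (S.L b x) = S.L (a * b) x := by rw [L_mul]; rfl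

theorem L_inner (a : A) (x y : K) : inner ℂ (S.L a x) y = inner ℂ x (S.L (star a) y) := by
  have h : (S.L a).adjoint = S.L (star a) := by
    refine S.ext_hat fun c => S.ext_inner fun b => ?_
    rw [ContinuousLinearMap.adjoint_inner_right, S.L_hat, S.L_hat, S.inner_hat,
      S.inner_hat b]
    simp [mul_assoc]
  rw [← h, ContinuousLinearMap.adjoint_inner_right]

theorem R_inner (a : A) (x y : K) : inner ℂ (S.R a x) y = inner ℂ x (S.R (star a) y) := by
  have h : (S.R a).adjoint = S.R (star a) := by
    refine S.ext_hat fun c => S.ext_inner fun b => ?_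
    rw [ContinuousLinearMap.adjoint_inner_right, S.R_hat, S.R_hat, S.tracial,
      S.tracial b, S.inner_hat, S.inner_hat (star (c * star a))]
    simp [mul_assoc]
  rw [← h, ContinuousLinearMap.adjoint_inner_right]

theorem inner_tr (a b : A) : inner ℂ (S.hat a) (S.hat b) = S.tr (star a * b) := S.inner_hat a b

theorem tr_comm (a b : A) : S.tr (a * b) = S.tr (b * a) := by
  have h1 := S.tracial (star a) b
  rw [inner_tr, inner_tr] at h1
  simpa using h1

theorem tr_add (a b : A) : S.tr (a + b) = S.tr a + S.tr b := by simp [tr]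
theorem tr_sub (a b : A) : S.tr (a - b) = S.tr a - S.tr b := by simp [tr]
theorem tr_smul (z : ℂ) (b : A) : S.tr (z • b) = z * S.tr b := by simp [tr]
theorem tr_one : S.tr 1 = 1 := by
  rw [tr, inner_self_eq_norm_sq_to_K, S.norm_one]; simp

theorem norm_sq (a : A) : ((‖S.hat a‖ ^ 2 : ℝ) : ℂ) = S.tr (star a * a) := by
  rw [← inner_tr, inner_self_eq_norm_sq_to_K]; simp

theorem norm_sq_re (a : A) : ‖S.hat a‖ ^ 2 = (S.tr (star a * a)).re := by
  rw [← norm_sq, Complex.ofReal_re]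

theorem norm_star (a : A) : ‖S.hat (star a)‖ = ‖S.hat a‖ := by
  rw [← sq_eq_sq₀ (norm_nonneg _) (norm_nonneg _), norm_sq_re, norm_sq_re, tr_comm, star_star]

theorem norm_mul_le (a b : A) : ‖S.hat (a * b)‖ ≤ ‖a‖ * ‖S.hat b‖ := by
  rw [← S.L_hat]
  exact ((S.L a).le_opNorm _).trans (mul_le_mul_of_nonneg_right (S.L_norm a) (norm_nonneg _))

theorem norm_mul_le' (a b : A) : ‖S.hat (a * b)‖ ≤ ‖b‖ * ‖S.hat a‖ := by
  rw [← S.R_hat]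
  exact ((S.R b).le_opNorm _).trans (mul_le_mul_of_nonneg_right (S.R_norm b) (norm_nonneg _))

theorem norm_hat_le (a : A) : ‖S.hat a‖ ≤ ‖a‖ := by
  simpa [S.norm_one] using S.norm_mul_le a 1

theorem norm_R_le (a : A) (x : K) : ‖S.R a x‖ ≤ ‖a‖ * ‖x‖ :=
  ((S.R a).le_opNorm _).trans (mul_le_mul_of_nonneg_right (S.R_norm a) (norm_nonneg _))

theorem norm_L_le (a : A) (x : K) : ‖S.L a x‖ ≤ ‖a‖ * ‖x‖ :=
  ((S.L a).le_opNorm _).trans (mul_le_mul_of_nonneg_right (S.L_norm a) (norm_nonneg _))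

theorem tr_nonneg {a : A} (h : 0 ≤ a) : 0 ≤ (S.tr a).re := by
  obtain ⟨b, rfl⟩ := CStarAlgebra.nonneg_iff_eq_star_mul_self.1 h
  rw [← norm_sq_re]; positivity

theorem tr_mono {a b : A} (h : a ≤ b) : (S.tr a).re ≤ (S.tr b).re := by
  have := S.tr_nonneg (sub_nonneg.2 h)
  rw [tr_sub] at this
  simpa using this

theorem tr_star (a : A) : S.tr (star a) = starRingEnd ℂ (S.tr a) := by
  have := S.tracial 1 a
  rw [star_one] at this
  rw [tr, tr, this, inner_conj_symm]

/-- 2-norm completeness of balls. -/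
def BallComplete (N : StarSubalgebra ℂ A) : Prop :=
  ∀ (x : ℕ → A) (C : ℝ), (∀ n, x n ∈ N) → (∀ n, ‖x n‖ ≤ C) → CauchySeq (fun n => S.hat (x n)) →
    ∃ y ∈ N, ‖y‖ ≤ C ∧ Tendsto (fun n => S.hat (x n)) atTop (nhds (S.hat y))

end StdForm
end std

section cf
universe a k
variable {A : Type a} [CStarAlgebra A] [PartialOrder A] [StarOrderedRing A]

theorem cmul {f g : ℝ → ℝ} (hf : Continuous f) (hg : Continuous g) (s : A) :
    cfc f s * cfc g s = cfc (fun t => f t * g t) s :=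
  (cfc_mul f g s hf.continuousOn hg.continuousOn).symm

theorem cadd {f g : ℝ → ℝ} (hf : Continuous f) (hg : Continuous g) (s : A) :
    cfc f s + cfc g s = cfc (fun t => f t + g t) s :=
  (cfc_add s f g hf.continuousOn hg.continuousOn).symm

theorem csub {f g : ℝ → ℝ} (hf : Continuous f) (hg : Continuous g) (s : A) :
    cfc f s - cfc g s = cfc (fun t => f t - g t) s :=
  (cfc_sub f g s hf.continuousOn hg.continuousOn).symm

theorem cid_mul {f : ℝ → ℝ} (hf : Continuous f) {s : A} (hs : IsSelfAdjoint s) :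
    s * cfc f s = cfc (fun t => t * f t) s := by
  have : cfc (fun t : ℝ => t) s = s := cfc_id' ℝ s
  nth_rw 1 [← this]
  rw [cmul continuous_id' hf]

theorem cmul_id {f : ℝ → ℝ} (hf : Continuous f) {s : A} (hs : IsSelfAdjoint s) :
    cfc f s * s = cfc (fun t => f t * t) s := by
  have : cfc (fun t : ℝ => t) s = s := cfc_id' ℝ s
  nth_rw 2 [← this]
  rw [cmul hf continuous_id']

theorem cstar (f : ℝ → ℝ) (s : A) : star (cfc f s) = cfc f s :=
  cfc_predicate (R := ℝ) (p := IsSelfAdjoint) f s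

theorem cfc_pack (N : StarSubalgebra ℂ A) (hN : IsClosed (N : Set A)) {a : A} (ha : a ∈ N) {δ : ℝ}
    (hδ : 0 < δ) : ∃ k ∈ N, ∃ g ∈ N, ∃ gi ∈ N, star k = k ∧ star g = g ∧ star gi = gi ∧
      g * gi = 1 ∧ ‖a * k‖ ≤ 1 ∧ gi * gi ≤ star a * a * k + algebraMap ℝ A δ ∧
      g * (star a * a) * g = star a * a * k := by
  set s := star a * a with hs
  have hsN : s ∈ N := mul_mem (star_mem ha) ha
  have hs0 : 0 ≤ s := star_mul_self_nonneg a
  have hsa : IsSelfAdjoint s := hs0.isSelfAdjoint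
  have hpos : ∀ t : ℝ, 0 < |t| + δ ^ 2 := fun t => by positivity
  have hp1 : ∀ t : ℝ, 0 < √(|t| + δ ^ 2) := fun t => Real.sqrt_pos.2 (hpos t)
  have hp2 : ∀ t : ℝ, 0 < √√(|t| + δ ^ 2) := fun t => Real.sqrt_pos.2 (hp1 t)
  have cf1 : Continuous (fun t : ℝ => (√(|t| + δ ^ 2))⁻¹) :=
    Continuous.inv₀ (by fun_prop) fun t => (hp1 t).ne'
  have cf2 : Continuous (fun t : ℝ => (√√(|t| + δ ^ 2))⁻¹) :=
    Continuous.inv₀ (by fun_prop) fun t => (hp2 t).ne'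
  have cf3 : Continuous (fun t : ℝ => √√(|t| + δ ^ 2)) := by fun_prop
  have hid : cfc (fun t : ℝ => t) s = s := cfc_id' ℝ s
  refine ⟨cfc (fun t : ℝ => (√(|t| + δ ^ 2))⁻¹) s, cfc_mem (hs := hN) _ hsN,
    cfc (fun t : ℝ => (√√(|t| + δ ^ 2))⁻¹) s, cfc_mem (hs := hN) _ hsN,
    cfc (fun t : ℝ => √√(|t| + δ ^ 2)) s, cfc_mem (hs := hN) _ hsN,
    cfc_predicate (R := ℝ) _ s, cfc_predicate (R := ℝ) _ s, cfc_predicate (R := ℝ) _ s,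
    ?_, ?_, ?_, ?_⟩
  · rw [← cfc_mul _ _ s cf2.continuousOn cf3.continuousOn]
    rw [← cfc_one ℝ s]
    exact cfc_congr fun t _ => by simp [(hp2 t).ne']
  · set k := cfc (fun t : ℝ => (√(|t| + δ ^ 2))⁻¹) s with hk
    have hks : star k = k := cfc_predicate (R := ℝ) _ s
    have h1 : star (a * k) * (a * k) = cfc (fun t : ℝ => (√(|t| + δ ^ 2))⁻¹ * t *
        (√(|t| + δ ^ 2))⁻¹) s := by
      rw [star_mul, hks, ← cmul (by fun_prop) cf1, ← cmul_id cf1 hsa, ← hk, hs]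
      simp only [mul_assoc]
    have h2 : ‖star (a * k) * (a * k)‖ ≤ 1 := by
      rw [h1]
      refine norm_cfc_le zero_le_one fun t _ => ?_
      rw [mul_assoc, mul_comm, mul_assoc, ← mul_inv, Real.mul_self_sqrt (hpos t).le,
        Real.norm_eq_abs, ← div_eq_mul_inv, abs_div, abs_of_pos (hpos t)]
      rw [div_le_one (hpos t)]
      nlinarith
    rw [CStarRing.norm_star_mul_self] at h2
    nlinarith [norm_nonneg (a * k)]
  · rw [← cfc_mul _ _ s cf3.continuousOn cf3.continuousOn]
    rw [cid_mul cf1 hsa, ← cfc_const δ s, cadd (by fun_prop) (by fun_prop)]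
    refine cfc_mono (fun t ht => ?_) (by fun_prop) (by fun_prop)
    have ht0 : 0 ≤ t := spectrum_nonneg_of_nonneg hs0 ht
    rw [Real.mul_self_sqrt (hp1 t).le, abs_of_nonneg ht0]
    have h3 := hp1 t
    rw [abs_of_nonneg ht0] at h3
    have h4 : δ ≤ √(t + δ ^ 2) := Real.le_sqrt_of_sq_le (by linarith)
    have h5 := Real.mul_self_sqrt (show 0 ≤ t + δ ^ 2 by positivity)
    rw [← div_eq_mul_inv, ← sub_le_iff_le_add, le_div_iff₀ h3]
    nlinarith
  · rw [cmul_id cf2 hsa, cmul (by fun_prop) cf2, cid_mul cf1 hsa]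
    refine cfc_congr fun t _ => ?_
    rw [mul_comm _ t, mul_assoc, ← mul_inv, Real.mul_self_sqrt (hp1 t).le]

end cf

section rn
universe a k
variable {A : Type a} [CStarAlgebra A] [PartialOrder A] [StarOrderedRing A]
variable {K : Type k} [NormedAddCommGroup K] [InnerProductSpace ℂ K] [CompleteSpace K]
namespace StdForm
variable (S : StdForm A K)

/-- image of the subalgebra -/
noncomputable def hN (N : StarSubalgebra ℂ A) : Submodule ℂ K := (Subalgebra.toSubmodule N.toSubalgebra).map S.hat

theorem mem_hN {N : StarSubalgebra ℂ A} {x : K} : x ∈ S.hN N ↔ ∃ b ∈ N, S.hat b = x := by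
  simp [hN]

theorem riesz (N : StarSubalgebra ℂ A) (φ : A →ₗ[ℂ] ℂ) (C : ℝ)
    (h : ∀ b ∈ N, ‖φ b‖ ≤ C * ‖S.hat b‖) :
    ∃ ζ ∈ (S.hN N).topologicalClosure, ∀ b ∈ N, φ b = inner ℂ ζ (S.hat b) := by
  let E : (Subalgebra.toSubmodule N.toSubalgebra) →ₗ[ℂ] K :=
    S.hat ∘ₗ (Subalgebra.toSubmodule N.toSubalgebra).subtype
  have hE : Function.Injective E := fun x y hxy => Subtype.ext (S.hat_inj hxy)
  let e := LinearEquiv.ofInjective E hE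
  let f : LinearMap.range E →ₗ[ℂ] ℂ :=
    φ ∘ₗ (Subalgebra.toSubmodule N.toSubalgebra).subtype ∘ₗ e.symm.toLinearMap
  have hfe : ∀ x, f (e x) = φ x := fun x => by simp [f]
  have hf : ∀ x, ‖f x‖ ≤ C * ‖x‖ := by
    intro x
    obtain ⟨b, rfl⟩ := e.surjective x
    rw [hfe]
    exact h b b.2
  obtain ⟨g, hg, -⟩ := exists_extension_norm_eq (LinearMap.range E) (f.mkContinuous C hf)
  let ζ := (InnerProductSpace.toDual ℂ K).symm g
  have hζ : ∀ b ∈ N, φ b = inner ℂ ζ (S.hat b) := by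
    intro b hb
    rw [InnerProductSpace.toDual_symm_apply]
    have := hg (e ⟨b, hb⟩)
    rw [LinearMap.mkContinuous_apply, hfe] at this
    exact this.symm
  let V := (S.hN N).topologicalClosure
  haveI : CompleteSpace V := (S.hN N).isClosed_topologicalClosure.completeSpace_coe
  refine ⟨V.starProjection ζ, Submodule.starProjection_apply_mem _ _, fun b hb => ?_⟩
  rw [hζ b hb, Submodule.inner_starProjection_left_eq_right, Submodule.starProjection_eq_self_iff.2]
  exact Submodule.le_topologicalClosure _ (S.mem_hN.2 ⟨b, hb, rfl⟩)

theorem phi_bound {N : StarSubalgebra ℂ A} (hNc : IsClosed (N : Set A)) (φ : A →ₗ[ℂ] ℂ) {C : ℝ}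
    (hC : 0 ≤ C)
    (h : ∀ a ∈ N, ∀ b ∈ N, ‖φ (a * b)‖ ≤ C * ‖S.hat a‖ * ‖S.hat b‖) {a : A} (ha : a ∈ N) {δ : ℝ}
    (hδ : 0 < δ) : ∃ k ∈ N, ‖a * k‖ ≤ 1 ∧
      ‖φ a‖ ≤ C * ((inner ℂ (S.hat a) (S.hat (a * k))).re + δ) := by
  obtain ⟨k, hk, g, hg, gi, hgi, sk, sg, sgi, e1, e2, e3, e4⟩ := cfc_pack N hNc ha hδ
  refine ⟨k, hk, e2, ?_⟩
  have h1 : ‖φ a‖ ≤ C * ‖S.hat (a * g)‖ * ‖S.hat gi‖ := by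
    have := h (a * g) (mul_mem ha hg) gi hgi
    rwa [mul_assoc, e1, mul_one] at this
  have h2 : ‖S.hat (a * g)‖ ^ 2 = (inner ℂ (S.hat a) (S.hat (a * k))).re := by
    rw [S.norm_sq_re, S.inner_tr, star_mul, sg, ← mul_assoc, ← mul_assoc (star a), ← e4]
    simp only [mul_assoc]
  have h3 : ‖S.hat gi‖ ^ 2 ≤ (inner ℂ (S.hat a) (S.hat (a * k))).re + δ := by
    rw [S.norm_sq_re, S.inner_tr, sgi, ← mul_assoc]
    refine (S.tr_mono e3).trans (le_of_eq ?_)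
    rw [S.tr_add, Algebra.algebraMap_eq_smul_one, ← Complex.coe_smul, S.tr_smul, S.tr_one]
    simp
  refine h1.trans ?_
  rw [mul_assoc]
  refine mul_le_mul_of_nonneg_left ?_ hC
  nlinarith [sq_nonneg (‖S.hat (a * g)‖ - ‖S.hat gi‖)]

theorem rn {N : StarSubalgebra ℂ A} (hNc : IsClosed (N : Set A)) (hB : S.BallComplete N)
    (φ : A →ₗ[ℂ] ℂ) {C : ℝ} (hC : 0 ≤ C)
    (h : ∀ a ∈ N, ∀ b ∈ N, ‖φ (a * b)‖ ≤ C * ‖S.hat a‖ * ‖S.hat b‖) :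
    ∃ x ∈ N, ‖x‖ ≤ C ∧ ∀ b ∈ N, φ b = S.tr (x * b) := by
  obtain ⟨ζ, hζV, hζ⟩ := S.riesz N φ C (fun b hb => by
    simpa [S.norm_one] using h 1 (one_mem _) b hb)
  letI : InnerProductSpace ℝ K := InnerProductSpace.rclikeToReal ℂ K
  let B : Set K := {x | ∃ b ∈ N, ‖b‖ ≤ C ∧ S.hat b = x}
  have hBne : B.Nonempty := ⟨0, 0, zero_mem _, by simpa using hC, by simp⟩
  have hBc : IsClosed B := by
    refine isClosed_of_closure_subset fun x hx => ?_
    obtain ⟨y, hy, hyx⟩ := mem_closure_iff_seq_limit.1 hx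
    choose b hb hbC hbe using hy
    have hc : Tendsto (fun n => S.hat (b n)) atTop (nhds x) := by simpa [hbe] using hyx
    obtain ⟨z, hz, hzC, hl⟩ := hB b C hb hbC hc.cauchySeq
    exact ⟨z, hz, hzC, tendsto_nhds_unique hl hc⟩
  have hBv : Convex ℝ B := by
    rintro _ ⟨x, hx, hxC, rfl⟩ _ ⟨y, hy, hyC, rfl⟩ s t hs ht hst
    refine ⟨(s : ℂ) • x + (t : ℂ) • y, add_mem (SMulMemClass.smul_mem _ hx)
      (SMulMemClass.smul_mem _ hy), ?_, ?_⟩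
    · refine (norm_add_le _ _).trans ?_
      rw [norm_smul, norm_smul, Complex.norm_real, Complex.norm_real, Real.norm_of_nonneg hs,
        Real.norm_of_nonneg ht]
      calc s * ‖x‖ + t * ‖y‖ ≤ s * C + t * C := by gcongr
        _ = C := by rw [← add_mul, hst, one_mul]
    · simp
  obtain ⟨_, ⟨b0, hb0, hb0C, rfl⟩, hmin⟩ :=
    exists_norm_eq_iInf_of_complete_convex hBne hBc.isComplete hBv ζ
  have key := (norm_eq_iInf_iff_real_inner_le_zero hBv ⟨b0, hb0, hb0C, rfl⟩).1 hmin
  set σ := ζ - S.hat b0 with hσ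
  have key' : ∀ b ∈ N, ‖b‖ ≤ C → (inner ℂ σ (S.hat b)).re ≤ (inner ℂ σ (S.hat b0)).re := by
    intro b hb hbC
    have := key _ ⟨b, hb, hbC, rfl⟩
    rw [real_inner_eq_re_inner ℂ, inner_sub_right] at this
    simpa using this
  have hσV : σ ∈ (S.hN N).topologicalClosure :=
    sub_mem hζV (Submodule.le_topologicalClosure _ (S.mem_hN.2 ⟨b0, hb0, rfl⟩))
  have hσ0 : σ = 0 := by
    obtain ⟨y, hy, hyσ⟩ := mem_closure_iff_seq_limit.1 hσV
    choose a ha hae using fun n => S.mem_hN.1 (hy n)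
    have hl : Tendsto (fun n => S.hat (a n)) atTop (nhds σ) := by simpa [hae] using hyσ
    have hb : ∀ n, (inner ℂ ζ (S.hat (a n))).re ≤ (inner ℂ σ (S.hat b0)).re +
        C * ‖σ - S.hat (a n)‖ + C * (1 / ((n : ℝ) + 1)) := by
      intro n
      obtain ⟨k, hk, hk1, hk2⟩ := S.phi_bound hNc φ hC h (ha n) (δ := 1 / ((n : ℝ) + 1))
        (by positivity)
      have h1 : (inner ℂ ζ (S.hat (a n))).re ≤ ‖φ (a n)‖ := by
        rw [← hζ _ (ha n)]; exact Complex.re_le_norm _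
      have h2 := key' ((C : ℂ) • (a n * k)) (SMulMemClass.smul_mem _ (mul_mem (ha n) hk)) (by
        rw [norm_smul, Complex.norm_real, Real.norm_of_nonneg hC]
        nlinarith)
      rw [map_smul, inner_smul_right, Complex.re_ofReal_mul] at h2
      have h3 : (inner ℂ (S.hat (a n)) (S.hat (a n * k))).re ≤
          (inner ℂ σ (S.hat (a n * k))).re + ‖σ - S.hat (a n)‖ := by
        have h4 : (inner ℂ (S.hat (a n) - σ) (S.hat (a n * k))).re ≤ ‖σ - S.hat (a n)‖ := by
          refine (Complex.re_le_norm _).trans ((norm_inner_le_norm _ _).trans ?_)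
          rw [norm_sub_rev]
          have := (S.norm_hat_le (a n * k)).trans hk1
          nlinarith [norm_nonneg (σ - S.hat (a n))]
        rw [inner_sub_left, Complex.sub_re] at h4
        linarith
      have h5 := mul_le_mul_of_nonneg_left h3 hC
      nlinarith
    have hlim : (inner ℂ ζ σ).re ≤ (inner ℂ σ (S.hat b0)).re + C * 0 + C * 0 := by
      refine le_of_tendsto_of_tendsto' (b := atTop) ?_ ?_ hb
      · exact (Complex.continuous_re.tendsto _).comp (Tendsto.inner tendsto_const_nhds hl)
      · refine (tendsto_const_nhds.add (Tendsto.const_mul _ ?_)).add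
          (Tendsto.const_mul _ tendsto_one_div_add_atTop_nhds_zero_nat)
        have : Tendsto (fun n => ‖σ - S.hat (a n)‖) atTop (nhds ‖σ - σ‖) :=
          (tendsto_const_nhds.sub hl).norm
        simpa using this
    have h6 : ‖σ‖ ^ 2 = (inner ℂ ζ σ).re - (inner ℂ σ (S.hat b0)).re := by
      have h7 : (inner ℂ σ (S.hat b0)).re = (inner ℂ (S.hat b0) σ).re := inner_re_symm (𝕜 := ℂ) _ _
      rw [h7]
      have : ‖σ‖ ^ 2 = (inner ℂ σ σ).re := by
        rw [inner_self_eq_norm_sq_to_K]; norm_cast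
      rw [this]
      nth_rw 1 [hσ]
      rw [inner_sub_left]
      simp
    have : ‖σ‖ ^ 2 ≤ 0 := by rw [h6]; linarith
    have := pow_eq_zero_iff (two_ne_zero) |>.1 (le_antisymm this (by positivity))
    exact norm_eq_zero.1 this
  refine ⟨star b0, star_mem hb0, by rwa [_root_.norm_star], fun b hb => ?_⟩
  rw [hζ b hb, ← S.inner_tr, sub_eq_zero.1 hσ0]

end StdForm
end rn

section br
universe a k
variable {A : Type a} [CStarAlgebra A] [PartialOrder A] [StarOrderedRing A]
variable {K : Type k} [NormedAddCommGroup K] [InnerProductSpace ℂ K] [CompleteSpace K]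
namespace StdForm
variable (S : StdForm A K)

/-- closed and ball complete -/
structure Good (N : StarSubalgebra ℂ A) : Prop where
  closed : IsClosed (N : Set A)
  complete : S.BallComplete N

/-- bounded vectors -/
def Bv (N : StarSubalgebra ℂ A) (η : K) (C : ℝ) : Prop :=
  0 ≤ C ∧ ∀ b ∈ N, ‖S.R b η‖ ≤ C * ‖S.hat b‖

/-- bracket relation -/
def IsBr (N : StarSubalgebra ℂ A) (η η' : K) (h : A) : Prop :=
  h ∈ N ∧ ∀ b ∈ N, inner ℂ η (S.R b η') = S.tr (h * b)

/-- normalized vectors -/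
def Nrm (N : StarSubalgebra ℂ A) (ξ : K) (r : A) : Prop :=
  S.IsBr N ξ ξ r ∧ star r = r ∧ r * r = r

/-- commuting with the right action -/
def ComR (N : StarSubalgebra ℂ A) (T : K →L[ℂ] K) : Prop :=
  ∀ b ∈ N, ∀ x, T (S.R b x) = S.R b (T x)

variable {S}
variable {N : StarSubalgebra ℂ A}

theorem br_exists (hN : S.Good N) {η η' : K} {C C' : ℝ} (h1 : S.Bv N η C) (h2 : S.Bv N η' C') :
    ∃ h, S.IsBr N η η' h ∧ ‖h‖ ≤ C * C' := by
  let φ : A →ₗ[ℂ] ℂ :=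
    { toFun := fun b => inner ℂ η (S.R b η')
      map_add' := fun a b => by simp [S.R_add, inner_add_right]
      map_smul' := fun a b => by simp [S.R_smul, inner_smul_right] }
  obtain ⟨x, hx, hxC, h⟩ := S.rn hN.closed hN.complete φ (C := C * C') (mul_nonneg h1.1 h2.1) (by
    intro a ha b hb
    change ‖inner ℂ η (S.R (a * b) η')‖ ≤ _
    rw [← S.R_R, ← star_star b, ← S.R_inner]
    refine (norm_inner_le_norm _ _).trans ?_
    calc _ ≤ (C * ‖S.hat (star b)‖) * (C' * ‖S.hat a‖) :=
          mul_le_mul (h1.2 _ (star_mem hb)) (h2.2 _ ha) (norm_nonneg _)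
            (mul_nonneg h1.1 (norm_nonneg _))
      _ = _ := by rw [S.norm_star, star_star]; ring)
  exact ⟨x, ⟨hx, h⟩, hxC⟩

theorem br_unique {η η' : K} {h h' : A} (h1 : S.IsBr N η η' h) (h2 : S.IsBr N η η' h') :
    h = h' := by
  have h3 : ∀ b ∈ N, S.tr ((h - h') * b) = 0 := fun b hb => by
    rw [sub_mul, S.tr_sub, ← h1.2 b hb, ← h2.2 b hb, sub_self]
  have h4 := h3 (star (h - h')) (star_mem (sub_mem h1.1 h2.1))
  rw [S.tr_comm, ← S.norm_sq] at h4
  have h5 : ‖S.hat (h - h')‖ ^ 2 = 0 := by exact_mod_cast h4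
  have h6 := S.inj _ (norm_eq_zero.1 (pow_eq_zero_iff two_ne_zero |>.1 h5))
  exact sub_eq_zero.1 h6

theorem IsBr.symm {η η' : K} {h : A} (h1 : S.IsBr N η η' h) : S.IsBr N η' η (star h) := by
  refine ⟨star_mem h1.1, fun b hb => ?_⟩
  rw [← inner_conj_symm, S.R_inner, h1.2 _ (star_mem hb), ← S.tr_star, S.tr_comm]
  simp [star_mul]

theorem IsBr.mul_right {η η' : K} {h c : A} (h1 : S.IsBr N η η' h) (hc : c ∈ N) :
    S.IsBr N η (S.R c η') (h * c) :=
  ⟨mul_mem h1.1 hc, fun b hb => by rw [S.R_R, h1.2 _ (mul_mem hc hb), mul_assoc]⟩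

theorem IsBr.mul_left {η η' : K} {h c : A} (h1 : S.IsBr N η η' h) (hc : c ∈ N) :
    S.IsBr N (S.R c η) η' (star c * h) := by
  have := (h1.symm.mul_right hc).symm
  simpa using this

theorem IsBr.add {η η' ζ : K} {h h' : A} (h1 : S.IsBr N ζ η h) (h2 : S.IsBr N ζ η' h') :
    S.IsBr N ζ (η + η') (h + h') :=
  ⟨add_mem h1.1 h2.1, fun b hb => by
    rw [map_add, inner_add_right, h1.2 b hb, h2.2 b hb, add_mul, S.tr_add]⟩

theorem IsBr.sub {η η' ζ : K} {h h' : A} (h1 : S.IsBr N ζ η h) (h2 : S.IsBr N ζ η' h') :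
    S.IsBr N ζ (η - η') (h - h') :=
  ⟨sub_mem h1.1 h2.1, fun b hb => by
    rw [map_sub, inner_sub_right, h1.2 b hb, h2.2 b hb, sub_mul, S.tr_sub]⟩

theorem IsBr.smul {η ζ : K} {h : A} (h1 : S.IsBr N ζ η h) (z : ℂ) :
    S.IsBr N ζ (z • η) (z • h) :=
  ⟨SMulMemClass.smul_mem _ h1.1, fun b hb => by
    rw [map_smul, inner_smul_right, h1.2 b hb, smul_mul_assoc, S.tr_smul]⟩

theorem isBr_zero {η η' : K} (h : ∀ b ∈ N, inner ℂ η (S.R b η') = 0) : S.IsBr N η η' 0 :=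
  ⟨zero_mem _, fun b hb => by rw [h b hb, zero_mul]; simp [tr]⟩

theorem ComR.adjoint {T : K →L[ℂ] K} (hT : S.ComR N T) : S.ComR N T.adjoint := by
  intro b hb x
  refine ext_inner_right ℂ fun y => ?_
  rw [ContinuousLinearMap.adjoint_inner_left, S.R_inner, S.R_inner,
    ContinuousLinearMap.adjoint_inner_left, hT _ (star_mem hb)]

theorem ComR.br {T : K →L[ℂ] K} (hT : S.ComR N T) {η η' : K} {h : A}
    (h1 : S.IsBr N η (T η') h) : S.IsBr N (T.adjoint η) η' h :=
  ⟨h1.1, fun b hb => by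
    rw [ContinuousLinearMap.adjoint_inner_left, hT b hb, h1.2 b hb]⟩

theorem ComR.L (x : A) : S.ComR N (S.L x) := fun b _ y => S.LR x b y

theorem L_adjoint (x : A) : (S.L x).adjoint = S.L (star x) := by
  ext y
  refine ext_inner_left ℂ fun z => ?_
  rw [ContinuousLinearMap.adjoint_inner_right, S.L_inner]

theorem Bv.map {T : K →L[ℂ] K} (hT : S.ComR N T) {η : K} {C : ℝ} (h : S.Bv N η C) :
    S.Bv N (T η) (‖T‖ * C) :=
  ⟨mul_nonneg (norm_nonneg _) h.1, fun b hb => by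
    rw [← hT b hb, mul_assoc]
    exact (T.le_opNorm _).trans (mul_le_mul_of_nonneg_left (h.2 b hb) (norm_nonneg _))⟩

theorem bv_hat (x : A) : S.Bv N (S.hat x) ‖x‖ :=
  ⟨norm_nonneg _, fun b hb => by rw [S.R_hat]; exact S.norm_mul_le _ _⟩

theorem Bv.right {η : K} {C : ℝ} (h : S.Bv N η C) {c : A} (hc : c ∈ N) :
    S.Bv N (S.R c η) (C * ‖c‖) :=
  ⟨mul_nonneg h.1 (norm_nonneg _), fun b hb => by
    rw [S.R_R, mul_assoc]
    exact (h.2 _ (mul_mem hc hb)).trans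
      (mul_le_mul_of_nonneg_left (S.norm_mul_le _ _) h.1)⟩

theorem Bv.sub {η η' : K} {C C' : ℝ} (h : S.Bv N η C) (h' : S.Bv N η' C') :
    S.Bv N (η - η') (C + C') :=
  ⟨add_nonneg h.1 h'.1, fun b hb => by
    rw [map_sub, add_mul]
    exact (norm_sub_le _ _).trans (add_le_add (h.2 b hb) (h'.2 b hb))⟩

theorem IsBr.norm_R {η : K} {h : A} (h1 : S.IsBr N η η h) {b : A} (hb : b ∈ N) :
    ((‖S.R b η‖ ^ 2 : ℝ) : ℂ) = S.tr (star b * h * b) := by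
  have := ((h1.mul_left hb).mul_right hb).2 1 (one_mem _)
  rw [S.R_one, mul_one] at this
  rw [← this, ContinuousLinearMap.one_apply, inner_self_eq_norm_sq_to_K]
  simp

theorem proj_norm {r : A} (h : star r = r) (h' : r * r = r) : ‖r‖ ≤ 1 := by
  have h1 : ‖star r * r‖ = ‖r‖ * ‖r‖ := CStarRing.norm_star_mul_self
  rw [h, h'] at h1
  by_contra hc
  push Not at hc
  nlinarith

theorem tr_zero : S.tr 0 = 0 := by simp [tr]

theorem Nrm.norm_R {ξ : K} {r b : A} (h : S.Nrm N ξ r) (hb : b ∈ N) :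
    ‖S.R b ξ‖ = ‖S.hat (r * b)‖ := by
  have h1 := h.1.norm_R hb
  have h2 : star b * r * b = star (r * b) * (r * b) := by
    rw [star_mul, h.2.1]
    simp only [mul_assoc]
    rw [← mul_assoc r r b, h.2.2]
  rw [h2, ← S.norm_sq] at h1
  have : ‖S.R b ξ‖ ^ 2 = ‖S.hat (r * b)‖ ^ 2 := by exact_mod_cast h1
  exact (sq_eq_sq₀ (norm_nonneg _) (norm_nonneg _)).1 this

theorem Nrm.bv {ξ : K} {r : A} (h : S.Nrm N ξ r) : S.Bv N ξ 1 :=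
  ⟨zero_le_one, fun b hb => by
    rw [h.norm_R hb]
    exact (S.norm_mul_le _ _).trans
      (mul_le_mul_of_nonneg_right (proj_norm h.2.1 h.2.2) (norm_nonneg _))⟩

theorem Nrm.norm {ξ : K} {r : A} (h : S.Nrm N ξ r) : ‖ξ‖ = ‖S.hat r‖ := by
  have := h.norm_R (one_mem N)
  simpa [S.R_one] using this

theorem Nrm.norm_sq {ξ : K} {r : A} (h : S.Nrm N ξ r) : ‖ξ‖ ^ 2 = (S.tr r).re := by
  rw [h.norm, S.norm_sq_re, h.2.1, h.2.2]

theorem Nrm.R_r {ξ : K} {r : A} (h : S.Nrm N ξ r) : S.R r ξ = ξ := by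
  have h1 := h.norm_R (sub_mem (one_mem N) h.1.1)
  rw [mul_sub, h.2.2, mul_one, sub_self, map_zero, norm_zero, norm_eq_zero, S.R_sub, S.R_one] at h1
  exact (sub_eq_zero.1 h1).symm

theorem Nrm.br_left {ξ ζ : K} {r g : A} (h : S.Nrm N ξ r) (hg : S.IsBr N ξ ζ g) : r * g = g := by
  have := hg.mul_left h.1.1
  rw [h.R_r, h.2.1] at this
  exact br_unique this hg

theorem Nrm.norm_Rg {ξ ζ : K} {r g : A} (h : S.Nrm N ξ r) (hg : S.IsBr N ξ ζ g) :
    ‖S.R g ξ‖ = ‖S.hat g‖ := by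
  rw [h.norm_R hg.1, h.br_left hg]

theorem Nrm.br_sub {ξ ζ : K} {r g : A} (h : S.Nrm N ξ r) (hg : S.IsBr N ξ ζ g) :
    S.IsBr N ξ (ζ - S.R g ξ) 0 := by
  have := hg.sub (h.1.mul_right hg.1)
  rwa [h.br_left hg, sub_self] at this

theorem proj_comR {V : Submodule ℂ K} [V.HasOrthogonalProjection]
    (hV : ∀ b ∈ N, ∀ x ∈ V, S.R b x ∈ V) : S.ComR N V.starProjection := by
  intro b hb x
  have h1 : ∀ y ∈ Vᗮ, S.R b y ∈ Vᗮ := by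
    intro y hy
    rw [Submodule.mem_orthogonal] at hy ⊢
    intro u hu
    have := hy _ (hV _ (star_mem hb) u hu)
    rwa [S.R_inner, star_star] at this
  have h2 : x - V.starProjection x ∈ Vᗮ := V.sub_starProjection_mem_orthogonal x
  refine Submodule.eq_starProjection_of_mem_of_inner_eq_zero
    (hV b hb _ (V.starProjection_apply_mem x)) (fun w hw => ?_)
  have := h1 _ h2
  rw [map_sub, Submodule.mem_orthogonal'] at this
  exact this w hw

end StdForm
end br

section nm
universe a k
variable {A : Type a} [CStarAlgebra A] [PartialOrder A] [StarOrderedRing A]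
variable {K : Type k} [NormedAddCommGroup K] [InnerProductSpace ℂ K] [CompleteSpace K]
namespace StdForm
variable {S : StdForm A K}
variable {N : StarSubalgebra ℂ A}

theorem hat_eq_zero_of_sq {d : A} (h : (S.tr (star d * d)).re ≤ 0) : d = 0 := by
  rw [← S.norm_sq_re] at h
  exact S.inj _ (norm_eq_zero.1 (pow_eq_zero_iff two_ne_zero |>.1 (le_antisymm h (by positivity))))

theorem IsBr.nonneg (hN : S.Good N) {η : K} {h : A} (h1 : S.IsBr N η η h) : 0 ≤ h := by
  have hsa : IsSelfAdjoint h := br_unique h1.symm h1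
  set d := cfc (fun t : ℝ => max (-t) 0) h with hd
  set b := cfc (fun t : ℝ => √(max (-t) 0)) h with hb
  have hbN : b ∈ N := cfc_mem (hs := hN.closed) _ h1.1
  have e1 : b * h * b = - (d * d) := by
    rw [hb, hd, cmul_id (by fun_prop) hsa, cmul (by fun_prop) (by fun_prop),
      cmul (by fun_prop) (by fun_prop), ← cfc_neg]
    refine cfc_congr fun t _ => ?_
    have := Real.mul_self_sqrt (le_max_right (-t) 0)
    rw [mul_comm _ t, mul_assoc, this]
    rcases le_total t 0 with ht | ht
    · rw [max_eq_left (by linarith)]; ring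
    · rw [max_eq_right (by linarith)]; ring
  have e2 := h1.norm_R hbN
  rw [cstar, ← hb, e1] at e2
  have e3 : (S.tr (-(d * d))).re = ‖S.R b η‖ ^ 2 := by rw [← e2, Complex.ofReal_re]
  have e4 : S.tr (-(d * d)) = - S.tr (d * d) := by simp [tr]
  rw [e4, Complex.neg_re] at e3
  have e5 : d = 0 := hat_eq_zero_of_sq (S := S) (by
    rw [hd, cstar, ← hd]; nlinarith [sq_nonneg ‖S.R b η‖])
  have e6 : h = cfc (fun t : ℝ => max t 0) h := by
    calc h = h + d := by rw [e5, add_zero]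
      _ = cfc (fun t : ℝ => t) h + d := by rw [cfc_id' ℝ h]
      _ = _ := by
        rw [hd, cadd (by fun_prop) (by fun_prop)]
        refine cfc_congr fun t _ => ?_
        rcases le_total t 0 with ht | ht
        · simp [ht]
        · simp [ht]
  rw [e6]
  exact cfc_nonneg fun t _ => le_max_right _ _

theorem tr_const (c : ℝ) : S.tr (algebraMap ℝ A c) = c := by
  rw [Algebra.algebraMap_eq_smul_one, ← Complex.coe_smul, S.tr_smul, S.tr_one, mul_one]

theorem normalize (hN : S.Good N) {η : K} (hη : η ≠ 0) {h : A} (h1 : S.IsBr N η η h) :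
    ∃ (c : ℕ → A) (r : A) (ξ : K), (∀ n, c n ∈ N) ∧
      Tendsto (fun n => S.R (c n) η) atTop (nhds ξ) ∧ S.Nrm N ξ r ∧ ξ ≠ 0 ∧
      (∀ p, S.R p η = 0 → p ∈ N → r * p = 0) ∧ (∀ n y, Commute h y → Commute (c n) y) ∧
      (∀ n, star (c n) = c n) ∧ (∀ n, ‖c n * h * c n‖ ≤ 1) := by
  have h0 : 0 ≤ h := h1.nonneg hN
  have hsa : IsSelfAdjoint h := h0.isSelfAdjoint
  let δ : ℕ → ℝ := fun n => 1 / ((n : ℝ) + 1)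
  have hδ : ∀ n, 0 < δ n := fun n => by positivity
  have hδm : ∀ n m, n ≤ m → δ m ≤ δ n := fun n m hnm => one_div_le_one_div_of_le (by positivity)
    (by exact_mod_cast Nat.succ_le_succ hnm)
  have hδ0 : Tendsto δ atTop (nhds 0) := tendsto_one_div_add_atTop_nhds_zero_nat
  let f : ℕ → ℝ → ℝ := fun n t => (√(|t| + δ n))⁻¹
  have hpos : ∀ n t, 0 < |t| + δ n := fun n t => by have := hδ n; positivity
  have hf0 : ∀ n t, 0 < f n t := fun n t => inv_pos.2 (Real.sqrt_pos.2 (hpos n t))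
  have hfc : ∀ n, Continuous (f n) := fun n =>
    Continuous.inv₀ (by fun_prop) fun t => (Real.sqrt_pos.2 (hpos n t)).ne'
  have hff : ∀ n t, f n t * f n t = (|t| + δ n)⁻¹ := fun n t => by
    simp only [f]; rw [← mul_inv, Real.mul_self_sqrt (hpos n t).le]
  have hfm : ∀ n m t, n ≤ m → f n t ≤ f m t := fun n m t hnm => by
    refine inv_anti₀ (Real.sqrt_pos.2 (hpos m t)) (Real.sqrt_le_sqrt ?_)
    linarith [hδm n m hnm]
  let c : ℕ → A := fun n => cfc (f n) h
  have hcN : ∀ n, c n ∈ N := fun n => cfc_mem (hs := hN.closed) _ h1.1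
  have hcs : ∀ n, star (c n) = c n := fun n => cstar _ _
  let ρ : ℕ → ℝ → ℝ := fun n t => f n t * f n t * t
  have hρc : ∀ n, Continuous (ρ n) := fun n => ((hfc n).mul (hfc n)).mul continuous_id'
  let r : ℕ → A := fun n => cfc (ρ n) h
  have hrN : ∀ n, r n ∈ N := fun n => cfc_mem (hs := hN.closed) _ h1.1
  have hr1 : ∀ n, r n = c n * c n * h := fun n => by
    simp only [r, c, ρ]
    rw [cmul (hfc n) (hfc n), cmul_id (by fun_prop) hsa]
  have hr2 : ∀ n, r n = c n * h * c n := fun n => by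
    simp only [r, c, ρ]
    rw [cmul_id (hfc n) hsa, cmul (by fun_prop) (hfc n)]
    exact cfc_congr fun t _ => by ring
  have hρ01 : ∀ n t, 0 ≤ t → 0 ≤ ρ n t ∧ ρ n t ≤ 1 := fun n t ht => by
    simp only [ρ]
    rw [hff, inv_mul_eq_div, abs_of_nonneg ht]
    have := hδ n
    refine ⟨by positivity, ?_⟩
    rw [div_le_one (by positivity)]
    linarith
  have hsp : ∀ t ∈ spectrum ℝ h, 0 ≤ t := fun t ht => spectrum_nonneg_of_nonneg h0 ht
  have hrn : ∀ n, ‖r n‖ ≤ 1 := fun n => norm_cfc_le zero_le_one fun t ht => by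
    obtain ⟨h2, h3⟩ := hρ01 n t (hsp t ht)
    rwa [Real.norm_of_nonneg h2]
  have hρm : ∀ n m t, n ≤ m → 0 ≤ t → ρ n t ≤ ρ m t := fun n m t hnm ht =>
    mul_le_mul_of_nonneg_right (mul_le_mul (hfm n m t hnm) (hfm n m t hnm) (hf0 n t).le
      (hf0 m t).le) ht
  let T : ℕ → ℝ := fun n => (S.tr (r n)).re
  have hTm : Monotone T := fun n m hnm => S.tr_mono
    (cfc_mono (fun t ht => hρm n m t hnm (hsp t ht)) (hρc n).continuousOn (hρc m).continuousOn)
  have hT1 : ∀ n, T n ≤ 1 := fun n => by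
    have : r n ≤ 1 := by
      rw [← cfc_one ℝ h]
      exact cfc_mono (fun t ht => (hρ01 n t (hsp t ht)).2) (hρc n).continuousOn continuousOn_const
    have := S.tr_mono this
    rwa [S.tr_one, Complex.one_re] at this
  obtain ⟨l, hl⟩ : ∃ l, Tendsto T atTop (nhds l) :=
    ⟨_, tendsto_atTop_ciSup hTm ⟨1, by rintro _ ⟨n, rfl⟩; exact hT1 n⟩⟩
  have hTl : ∀ n, T n ≤ l := hTm.ge_of_tendsto hl
  have hsq0 : Tendsto (fun n => √(l - T n)) atTop (nhds 0) := by
    have : Tendsto (fun n => √(l - T n)) atTop (nhds (√(l - l))) :=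
      (Real.continuous_sqrt.tendsto _).comp (tendsto_const_nhds.sub hl)
    simpa using this
  have hξc : CauchySeq (fun n => S.R (c n) η) := by
    refine cauchySeq_of_le_tendsto_0' _ (fun n m hnm => ?_) hsq0
    refine Real.le_sqrt_of_sq_le ?_
    rw [dist_comm, dist_eq_norm, ← ContinuousLinearMap.sub_apply, ← S.R_sub]
    have e1 := h1.norm_R (sub_mem (hcN m) (hcN n))
    have e2 : star (c m - c n) * h * (c m - c n) ≤ r m - r n := by
      simp only [c, r]
      rw [csub (hfc m) (hfc n), cstar, cmul_id (by fun_prop) hsa,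
        cmul (by fun_prop) (by fun_prop),
        csub (hρc m) (hρc n)]
      refine cfc_mono (fun t ht => ?_)
        ((((hfc m).sub (hfc n)).mul continuous_id').mul ((hfc m).sub (hfc n))).continuousOn
        ((hρc m).sub (hρc n)).continuousOn
      have ht0 := hsp t ht
      have e3 := hfm n m t hnm
      have e4 := hf0 n t
      simp only [ρ]
      have e5 : 0 ≤ t * (f n t * (f m t - f n t)) :=
        mul_nonneg ht0 (mul_nonneg e4.le (sub_nonneg.2 e3))
      nlinarith
    have e6 := S.tr_mono e2
    rw [← e1, Complex.ofReal_re, S.tr_sub, Complex.sub_re] at e6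
    have := hTl m
    simp only [T] at this ⊢
    linarith
  obtain ⟨ξ, hξ⟩ := cauchySeq_tendsto_of_complete hξc
  have hrc : CauchySeq (fun n => S.hat (r n)) := by
    refine cauchySeq_of_le_tendsto_0' _ (fun n m hnm => ?_) hsq0
    refine Real.le_sqrt_of_sq_le ?_
    rw [dist_comm, dist_eq_norm, ← map_sub, S.norm_sq_re]
    have e2 : star (r m - r n) * (r m - r n) ≤ r m - r n := by
      simp only [r]
      rw [csub (hρc m) (hρc n), cstar, cmul (by fun_prop) (by fun_prop)]
      refine cfc_mono (fun t ht => ?_)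
        (((hρc m).sub (hρc n)).mul ((hρc m).sub (hρc n))).continuousOn
        ((hρc m).sub (hρc n)).continuousOn
      have ht0 := hsp t ht
      have e3 := hρm n m t hnm ht0
      have e4 := hρ01 n t ht0
      have e5 := hρ01 m t ht0
      nlinarith
    have e6 := S.tr_mono e2
    rw [S.tr_sub, Complex.sub_re] at e6
    have := hTl m
    simp only [T] at this ⊢
    linarith
  obtain ⟨q, hqN, hq1, hq⟩ := hN.complete r 1 hrN hrn hrc
  have hhq : h * q = h := by
    apply S.hat_inj
    have e1 : Tendsto (fun n => S.hat (h * r n)) atTop (nhds (S.hat (h * q))) := by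
      simp only [← S.L_hat]
      exact ((S.L h).continuous.tendsto _).comp hq
    refine tendsto_nhds_unique e1 ?_
    rw [tendsto_iff_norm_sub_tendsto_zero]
    refine squeeze_zero (fun _ => norm_nonneg _) (fun n => ?_) hδ0
    rw [← map_sub]
    refine (S.norm_hat_le _).trans ?_
    have e2 : h * r n - h = cfc (fun t => t * ρ n t - t) h := by
      have : cfc (fun t : ℝ => t) h = h := cfc_id' ℝ h
      rw [← csub (by fun_prop) (by fun_prop), this, ← cid_mul (hρc n) hsa]
    rw [e2]
    refine norm_cfc_le (hδ n).le fun t ht => ?_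
    have ht0 := hsp t ht
    have hd := hδ n
    simp only [ρ]
    rw [hff, abs_of_nonneg ht0, Real.norm_eq_abs, abs_le]
    have e3 : t * ((t + δ n)⁻¹ * t) - t = - (t * δ n / (t + δ n)) := by
      field_simp; ring
    rw [e3]
    have e4 : t * δ n / (t + δ n) ≤ δ n := by
      rw [div_le_iff₀ (by positivity)]; nlinarith [sq_nonneg (δ n)]
    have e5 : 0 ≤ t * δ n / (t + δ n) := by positivity
    constructor <;> linarith
  have hqs : star q = q := by
    apply S.hat_inj
    refine tendsto_nhds_unique ?_ hq
    rw [tendsto_iff_norm_sub_tendsto_zero] at hq ⊢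
    refine hq.congr fun n => ?_
    rw [← map_sub, ← map_sub, ← S.norm_star, star_sub]
    simp only [r]
    rw [cstar]
  have hrq : ∀ n, r n * q = r n := fun n => by rw [hr1, mul_assoc, hhq]
  have hqq : q * q = q := by
    apply S.hat_inj
    refine tendsto_nhds_unique ?_ hq
    have : Tendsto (fun n => S.R q (S.hat (r n))) atTop (nhds (S.R q (S.hat q))) :=
      ((S.R q).continuous.tendsto _).comp hq
    simpa only [S.R_hat, hrq] using this
  have hbr : S.IsBr N ξ ξ q := by
    refine ⟨hqN, fun b hb => ?_⟩
    have e1 : Tendsto (fun n => inner ℂ (S.R (c n) η) (S.R b (S.R (c n) η))) atTop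
        (nhds (inner ℂ ξ (S.R b ξ))) :=
      hξ.inner (((S.R b).continuous.tendsto _).comp hξ)
    refine tendsto_nhds_unique e1 ?_
    have e2 : Tendsto (fun n => inner ℂ (S.hat 1) (S.R b (S.hat (r n)))) atTop
        (nhds (inner ℂ (S.hat 1) (S.R b (S.hat q)))) :=
      tendsto_const_nhds.inner (((S.R b).continuous.tendsto _).comp hq)
    simp only [S.R_hat] at e2
    refine e2.congr fun n => ?_
    have := ((h1.mul_left (hcN n)).mul_right (hcN n)).2 b hb
    rw [this, hcs, ← hr2]; rfl
  refine ⟨c, q, ξ, hcN, hξ, ⟨hbr, hqs, hqq⟩, ?_, ?_, ?_, hcs, fun n => by rw [← hr2]; exact hrn n⟩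
  · intro h3
    have h4 := hbr.2 1 (one_mem _)
    rw [h3, inner_zero_left, mul_one] at h4
    have h5 : q = 0 := hat_eq_zero_of_sq (S := S) (by rw [hqs, hqq, ← h4]; simp)
    rw [h5, mul_zero] at hhq
    have h6 := h1.2 1 (one_mem _)
    rw [← hhq, zero_mul, tr_zero, S.R_one] at h6
    exact hη (inner_self_eq_zero.1 h6)
  · intro p hp hpN
    have h3 : h * p = 0 := by
      have := h1.mul_right hpN
      rw [hp] at this
      exact br_unique this (isBr_zero fun b _ => by simp)
    apply S.inj
    refine tendsto_nhds_unique (a := S.hat (q * p)) (f := fun n => S.R p (S.hat (r n)))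
      (l := atTop) ?_ ?_
    · rw [← S.R_hat]
      exact ((S.R p).continuous.tendsto _).comp hq
    · simp only [S.R_hat, hr1, mul_assoc, h3, mul_zero, map_zero]
      exact tendsto_const_nhds
  · intro n y hy
    exact Commute.cfc_real hy _

end StdForm
end nm

section bs
universe a k

theorem exists_max_pairwise {α : Type*} (p : α → Prop) (r : α → α → Prop) :
    ∃ s : Set α, (∀ x ∈ s, p x) ∧ s.Pairwise r ∧
      ∀ y, p y → (∀ x ∈ s, r x y ∧ r y x) → y ∈ s := by
  obtain ⟨m, hm⟩ := zorn_subset {s : Set α | (∀ x ∈ s, p x) ∧ s.Pairwise r} (by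
    intro c hc hch
    refine ⟨⋃₀ c, ⟨?_, ?_⟩, fun s hs => Set.subset_sUnion_of_mem hs⟩
    · rintro x ⟨s, hs, hx⟩
      exact (hc hs).1 x hx
    · rw [Set.pairwise_sUnion hch.directedOn]
      exact fun s hs => (hc hs).2)
  refine ⟨m, hm.prop.1, hm.prop.2, fun y hy hr => ?_⟩
  have h1 : insert y m ∈ {s : Set α | (∀ x ∈ s, p x) ∧ s.Pairwise r} := by
    refine ⟨?_, ?_⟩
    · rintro x (rfl | hx)
      · exact hy
      · exact hm.prop.1 x hx
    · exact hm.prop.2.insert fun x hx _ => ⟨(hr x hx).2, (hr x hx).1⟩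
  exact hm.le_of_ge h1 (Set.subset_insert y m) (Set.mem_insert y m)

variable {A : Type a} [CStarAlgebra A] [PartialOrder A] [StarOrderedRing A]
variable {K : Type k} [NormedAddCommGroup K] [InnerProductSpace ℂ K] [CompleteSpace K]
namespace StdForm
variable {S : StdForm A K}
variable {N : StarSubalgebra ℂ A}

variable (S N) in
/-- orthogonality over `N` -/
def Orth (x y : K) : Prop := ∀ b ∈ N, inner ℂ x (S.R b y) = 0

theorem Orth.symm {x y : K} (h : S.Orth N x y) : S.Orth N y x := fun b hb => by
  rw [← inner_conj_symm, S.R_inner, h _ (star_mem hb), map_zero]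

theorem Orth.inner2 {x y : K} (h : S.Orth N x y) {b c : A} (hb : b ∈ N) (hc : c ∈ N) :
    inner ℂ (S.R b x) (S.R c y) = 0 := by
  rw [S.R_inner, S.R_R, h _ (mul_mem hc (star_mem hb))]

/-- finite Bessel / Pythagoras -/
theorem bessel {ι : Type*} [DecidableEq ι] (F : Finset ι) (ξ : ι → K) (r g : ι → A)
    (hn : ∀ i ∈ F, S.Nrm N (ξ i) (r i)) (ho : ∀ i ∈ F, ∀ j ∈ F, i ≠ j → S.Orth N (ξ i) (ξ j)) {ζ : K}
    (hg : ∀ i ∈ F, S.IsBr N (ξ i) ζ (g i)) :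
    ‖∑ i ∈ F, S.R (g i) (ξ i)‖ ^ 2 = ∑ i ∈ F, ‖S.hat (g i)‖ ^ 2 ∧
    (∀ i ∈ F, ∀ b ∈ N, inner ℂ (S.R b (ξ i)) (ζ - ∑ i ∈ F, S.R (g i) (ξ i)) = 0) ∧
    ‖ζ‖ ^ 2 = ∑ i ∈ F, ‖S.hat (g i)‖ ^ 2 + ‖ζ - ∑ i ∈ F, S.R (g i) (ξ i)‖ ^ 2 := by
  set ζF := ∑ i ∈ F, S.R (g i) (ξ i) with hζF
  have h1 : ∀ i ∈ F, ∀ b ∈ N, inner ℂ (S.R b (ξ i)) (ζ - ζF) = 0 := by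
    intro i hi b hb
    have h2 : inner ℂ (S.R b (ξ i)) ζF = inner ℂ (S.R b (ξ i)) (S.R (g i) (ξ i)) := by
      rw [hζF, inner_sum]
      refine Finset.sum_eq_single_of_mem i hi fun j hj hji => ?_
      exact (ho i hi j hj hji.symm).inner2 hb (hg j hj).1
    rw [inner_sub_right, h2, ← inner_sub_right, S.R_inner]
    have := ((hn i hi).br_sub (hg i hi)).2 _ (star_mem hb)
    rw [this, zero_mul, tr_zero]
  have h2 : ‖ζF‖ ^ 2 = ∑ i ∈ F, ‖S.hat (g i)‖ ^ 2 := by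
    have : inner ℂ ζF ζF = ∑ i ∈ F, ((‖S.hat (g i)‖ ^ 2 : ℝ) : ℂ) := by
      rw [hζF, sum_inner]
      refine Finset.sum_congr rfl fun i hi => ?_
      rw [inner_sum, Finset.sum_eq_single_of_mem i hi fun j hj hji =>
        (ho i hi j hj hji.symm).inner2 (hg i hi).1 (hg j hj).1, inner_self_eq_norm_sq_to_K,
        (hn i hi).norm_Rg (hg i hi)]
      simp
    have h := congrArg (RCLike.re : ℂ → ℝ) this
    rw [inner_self_eq_norm_sq, ← Complex.ofReal_sum] at h
    rw [h]
    exact Complex.ofReal_re _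
  refine ⟨h2, h1, ?_⟩
  rw [← h2]
  have h3 : inner ℂ ζF (ζ - ζF) = 0 := by
    nth_rw 1 [hζF]
    rw [sum_inner]
    exact Finset.sum_eq_zero fun i hi => h1 i hi _ (hg i hi).1
  have := norm_add_sq_eq_norm_sq_add_norm_sq_of_inner_eq_zero _ _ h3
  rw [add_sub_cancel] at this
  nlinarith

variable (S N) in
/-- basis of normalized vectors -/
structure IsBasis (B : Set K) : Prop where
  nrm : ∀ m ∈ B, ∃ r, S.Nrm N m r
  orth : B.Pairwise (S.Orth N)
  total : ∀ x : K, (∀ m ∈ B, S.Orth N m x) → x = 0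

theorem exists_basis (hN : S.Good N) : ∃ B, S.IsBasis N B := by
  obtain ⟨B, hB1, hB2, hB3⟩ := exists_max_pairwise (fun m : K => m ≠ 0 ∧ ∃ r, S.Nrm N m r)
    (S.Orth N)
  refine ⟨B, fun m hm => (hB1 m hm).2, hB2, ?_⟩
  by_contra hcon
  push Not at hcon
  obtain ⟨x, hx, hx0⟩ := hcon
  let W : Submodule ℂ K :=
    { carrier := {y | ∀ m ∈ B, S.Orth N m y}
      add_mem' := fun {y z} hy hz m hm b hb => by
        rw [map_add, inner_add_right, hy m hm b hb, hz m hm b hb, add_zero]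
      zero_mem' := fun m hm b hb => by simp
      smul_mem' := fun c y hy m hm b hb => by
        rw [map_smul, inner_smul_right, hy m hm b hb, mul_zero] }
  have hWc : IsClosed (W : Set K) := by
    have : (W : Set K) = ⋂ m ∈ B, ⋂ b ∈ N, {y | inner ℂ m (S.R b y) = 0} := by
      ext y; simp [W, Orth]
    rw [this]
    refine isClosed_biInter fun m _ => isClosed_biInter fun b _ => ?_
    exact isClosed_eq (by fun_prop) continuous_const
  haveI : CompleteSpace W := hWc.completeSpace_coe
  have hWR : ∀ b ∈ N, ∀ y ∈ W, S.R b y ∈ W := fun b hb y hy m hm c hc => by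
    rw [S.R_R]; exact hy m hm _ (mul_mem hb hc)
  have hP := proj_comR hWR
  obtain ⟨w, hw⟩ : ∃ w, W.starProjection (S.hat w) ≠ 0 := by
    by_contra hcon
    push Not at hcon
    have : W.starProjection = 0 := S.ext_hat fun w => by rw [hcon]; rfl
    have h2 : W.starProjection x = x := Submodule.starProjection_eq_self_iff.2 hx
    rw [this] at h2
    exact hx0 h2.symm
  have hbv := (bv_hat (S := S) (N := N) w).map hP
  obtain ⟨h, hh, -⟩ := br_exists hN hbv hbv
  obtain ⟨c, r, ξ, hc, hξ, hnr, hξ0, -⟩ := normalize hN hw hh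
  have hξW : ξ ∈ W := hWc.mem_of_tendsto hξ (Eventually.of_forall fun n =>
    hWR _ (hc n) _ (W.starProjection_apply_mem _))
  have hξB := hB3 ξ ⟨hξ0, r, hnr⟩ fun m hm => ⟨hξW m hm, (hξW m hm).symm⟩
  have := hξW ξ hξB 1 (one_mem _)
  rw [S.R_one] at this
  exact hξ0 (inner_self_eq_zero.1 this)

theorem IsBasis.parseval {B : Set K} (hB : S.IsBasis N B) {ζ : K} (g : B → A)
    (hg : ∀ m : B, S.IsBr N m ζ (g m)) :
    ∑' m : B, ENNReal.ofReal (‖S.hat (g m)‖ ^ 2) = ENNReal.ofReal (‖ζ‖ ^ 2) := by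
  classical
  choose r hr using hB.nrm
  have hbes := fun F : Finset B => bessel F (fun m => (m : K)) (fun m => r m m.2) g
    (fun i _ => hr i i.2) (fun i _ j _ hij => hB.orth i.2 j.2 (fun h => hij (Subtype.ext h)))
    (fun i _ => hg i)
  have hsum : ∀ F : Finset B, ∑ m ∈ F, ENNReal.ofReal (‖S.hat (g m)‖ ^ 2) =
      ENNReal.ofReal (∑ m ∈ F, ‖S.hat (g m)‖ ^ 2) := fun F =>
    (ENNReal.ofReal_sum_of_nonneg fun _ _ => by positivity).symm
  refine le_antisymm ?_ ?_
  · rw [ENNReal.tsum_eq_iSup_sum]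
    refine iSup_le fun F => ?_
    rw [hsum]
    refine ENNReal.ofReal_le_ofReal ?_
    rw [(hbes F).2.2]
    exact le_add_of_nonneg_right (by positivity)
  · let W : Submodule ℂ K := Submodule.span ℂ {x | ∃ m ∈ B, ∃ b ∈ N, S.R b m = x}
    have hWd : W.topologicalClosure = ⊤ := by
      rw [Submodule.topologicalClosure_eq_top_iff, Submodule.eq_bot_iff]
      intro x hx
      refine hB.total x fun m hm b hb => ?_
      have := (Submodule.mem_orthogonal W x).1 hx (S.R (star b) m)
        (Submodule.subset_span ⟨m, hm, _, star_mem hb, rfl⟩)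
      rwa [S.R_inner, star_star] at this
    have hW : ∀ w ∈ W, ∃ F : Finset B, ∀ x, (∀ i ∈ F, ∀ b ∈ N, inner ℂ (S.R b (i : K)) x = 0) →
        inner ℂ w x = 0 := by
      intro w hw
      induction hw using Submodule.span_induction with
      | mem w hw =>
        obtain ⟨m, hm, b, hb, rfl⟩ := hw
        exact ⟨{⟨m, hm⟩}, fun x hx => hx ⟨m, hm⟩ (Finset.mem_singleton_self _) b hb⟩
      | zero => exact ⟨∅, fun x _ => inner_zero_left _⟩
      | add u v _ _ hu hv =>
        obtain ⟨F, hF⟩ := hu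
        obtain ⟨G, hG⟩ := hv
        refine ⟨F ∪ G, fun x hx => ?_⟩
        rw [inner_add_left, hF x fun i hi => hx i (Finset.mem_union_left _ hi),
          hG x fun i hi => hx i (Finset.mem_union_right _ hi), add_zero]
      | smul c u _ hu =>
        obtain ⟨F, hF⟩ := hu
        exact ⟨F, fun x hx => by rw [inner_smul_left, hF x hx, mul_zero]⟩
    refine ENNReal.le_of_forall_pos_le_add fun ε hε _ => ?_
    have hζ : ζ ∈ closure (W : Set K) := by
      have : ζ ∈ W.topologicalClosure := by rw [hWd]; trivial
      exact this
    obtain ⟨w, hw, hwd⟩ := Metric.mem_closure_iff.1 hζ (√ε) (Real.sqrt_pos.2 hε)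
    obtain ⟨F, hF⟩ := hW w hw
    obtain ⟨h1, h2, h3⟩ := hbes F
    set ζF := ∑ i ∈ F, S.R (g i) (i : K) with hζF
    have h4 := hF _ h2
    have h5 : inner ℂ ζF (ζ - ζF) = 0 := by
      nth_rw 1 [hζF]
      rw [sum_inner]
      exact Finset.sum_eq_zero fun i hi => h2 i hi _ (hg i).1
    have h6 : ‖ζ - ζF‖ * ‖ζ - ζF‖ ≤ ‖ζ - w‖ * ‖ζ - ζF‖ := by
      have h7 : inner ℂ (ζ - ζF) (ζ - ζF) = inner ℂ (ζ - w) (ζ - ζF) := by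
        rw [inner_sub_left, inner_sub_left ζ w, h4, h5]
      rw [← sq, ← Real.norm_of_nonneg (sq_nonneg ‖ζ - ζF‖), ← Complex.norm_real]
      have h8 : ((‖ζ - ζF‖ ^ 2 : ℝ) : ℂ) = inner ℂ (ζ - ζF) (ζ - ζF) := by
        rw [inner_self_eq_norm_sq_to_K]; simp
      rw [h8, h7]
      exact norm_inner_le_norm _ _
    have h9 : ‖ζ - ζF‖ ^ 2 ≤ ε := by
      rw [dist_eq_norm] at hwd
      have h10 : ‖ζ - ζF‖ ≤ √ε := by
        rcases (norm_nonneg (ζ - ζF)).eq_or_lt with h | h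
        · rw [← h]; positivity
        · exact (le_of_mul_le_mul_right h6 h).trans hwd.le
      calc _ ≤ (√ε) ^ 2 := by gcongr
        _ = ε := Real.sq_sqrt ε.2
    calc ENNReal.ofReal (‖ζ‖ ^ 2) ≤ ENNReal.ofReal (∑ i ∈ F, ‖S.hat (g i)‖ ^ 2) +
          ENNReal.ofReal (‖ζ - ζF‖ ^ 2) := by
          rw [← ENNReal.ofReal_add (Finset.sum_nonneg fun _ _ => by positivity) (by positivity), h3]
      _ ≤ _ := by
        gcongr
        · rw [← hsum]; exact ENNReal.sum_le_tsum F
        · exact ENNReal.ofReal_le_of_le_toReal h9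

/-- trace norm squared -/
noncomputable def Phi (B : Set K) (T : K →L[ℂ] K) : ENNReal :=
  ∑' m : B, ENNReal.ofReal (‖T m‖ ^ 2)

theorem IsBasis.phi_adjoint (hN : S.Good N) {B : Set K} (hB : S.IsBasis N B) {T : K →L[ℂ] K}
    (hT : S.ComR N T) : Phi B T.adjoint = Phi B T := by
  choose r hr using hB.nrm
  have h1 : ∀ m' m : B, ∃ g, S.IsBr N (m' : K) (T m) g := fun m' m => by
    obtain ⟨g, hg, -⟩ := br_exists hN (hr m' m'.2).bv ((hr m m.2).bv.map hT)
    exact ⟨g, hg⟩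
  choose G hG using h1
  have h2 : ∀ m' m : B, S.IsBr N (m : K) (T.adjoint m') (star (G m' m)) := fun m' m =>
    (hT.br (hG m' m)).symm
  unfold Phi
  have h3 : ∀ m : B, ENNReal.ofReal (‖T m‖ ^ 2) =
      ∑' m' : B, ENNReal.ofReal (‖S.hat (G m' m)‖ ^ 2) := fun m =>
    (hB.parseval (fun m' => G m' m) fun m' => hG m' m).symm
  have h4 : ∀ m' : B, ENNReal.ofReal (‖T.adjoint m'‖ ^ 2) =
      ∑' m : B, ENNReal.ofReal (‖S.hat (G m' m)‖ ^ 2) := fun m' => by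
    rw [← hB.parseval (fun m => star (G m' m)) fun m => h2 m' m]
    simp only [S.norm_star]
  simp only [h3, h4]
  exact ENNReal.tsum_comm

theorem norm_L_unitary {u : A} (hu : star u * u = 1) (x : K) : ‖S.L u x‖ = ‖x‖ := by
  have : inner ℂ (S.L u x) (S.L u x) = inner ℂ x x := by
    rw [S.L_inner, S.L_L, hu, S.L_one]; rfl
  rw [inner_self_eq_norm_sq_to_K, inner_self_eq_norm_sq_to_K] at this
  have h2 : ‖S.L u x‖ ^ 2 = ‖x‖ ^ 2 := by exact_mod_cast this
  exact (sq_eq_sq₀ (norm_nonneg _) (norm_nonneg _)).1 h2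

theorem phi_L (B : Set K) {u : A} (hu : star u * u = 1) (T : K →L[ℂ] K) :
    Phi B (S.L u * T) = Phi B T := by
  unfold Phi
  simp only [ContinuousLinearMap.mul_apply, norm_L_unitary hu]

theorem ComR.mul {T T' : K →L[ℂ] K} (h : S.ComR N T) (h' : S.ComR N T') : S.ComR N (T * T') :=
  fun b hb x => by simp only [ContinuousLinearMap.mul_apply]; rw [h' b hb, h b hb]

theorem IsBasis.phi_conj (hN : S.Good N) {B : Set K} (hB : S.IsBasis N B) {T : K →L[ℂ] K}
    (hT : S.ComR N T) {u : A} (hu : star u * u = 1) (hu' : u * star u = 1) :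
    Phi B (S.L (star u) * T * S.L u) = Phi B T := by
  rw [mul_assoc, phi_L B (by rwa [star_star]), ← hB.phi_adjoint hN (hT.mul (ComR.L u))]
  have : (T * S.L u).adjoint = S.L (star u) * T.adjoint := by
    rw [← L_adjoint]
    exact ContinuousLinearMap.adjoint_comp _ _
  rw [this, phi_L B (by rwa [star_star]), hB.phi_adjoint hN hT]

theorem phi_para (B : Set K) (T T' : K →L[ℂ] K) :
    Phi B (T - T') + 4 * Phi B ((1 / 2 : ℝ) • (T + T')) = 2 * Phi B T + 2 * Phi B T' := by
  unfold Phi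
  rw [← ENNReal.tsum_mul_left, ← ENNReal.tsum_mul_left, ← ENNReal.tsum_mul_left,
    ← ENNReal.tsum_add, ← ENNReal.tsum_add]
  refine tsum_congr fun m => ?_
  have h4 : (4 : ENNReal) = ENNReal.ofReal 4 := by simp
  have h2 : (2 : ENNReal) = ENNReal.ofReal 2 := by simp
  rw [h4, h2, ← ENNReal.ofReal_mul (by norm_num), ← ENNReal.ofReal_mul (by norm_num),
    ← ENNReal.ofReal_mul (by norm_num), ← ENNReal.ofReal_add (by positivity) (by positivity),
    ← ENNReal.ofReal_add (by positivity) (by positivity)]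
  congr 1
  have := parallelogram_law_with_norm ℂ (T m) (T' m)
  simp only [ContinuousLinearMap.sub_apply, ContinuousLinearMap.smul_apply,
    ContinuousLinearMap.add_apply, norm_smul]
  norm_num
  nlinarith

end StdForm
end bs

section fx
universe a k
variable {A : Type a} [CStarAlgebra A] [PartialOrder A] [StarOrderedRing A]
variable {K : Type k} [NormedAddCommGroup K] [InnerProductSpace ℂ K] [CompleteSpace K]
namespace StdForm
variable {S : StdForm A K}
variable {N : StarSubalgebra ℂ A}

theorem IsBasis.dense {B : Set K} (hB : S.IsBasis N B) (V : Submodule ℂ K)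
    (hc : IsClosed (V : Set K)) (h : ∀ m ∈ B, ∀ b ∈ N, S.R b m ∈ V) (x : K) : x ∈ V := by
  haveI : CompleteSpace V := hc.completeSpace_coe
  have : Vᗮ = ⊥ := by
    rw [Submodule.eq_bot_iff]
    intro x hx
    refine hB.total x fun m hm b hb => ?_
    have := (Submodule.mem_orthogonal V x).1 hx _ (h m hm _ (star_mem hb))
    rwa [S.R_inner, star_star] at this
  rw [Submodule.orthogonal_eq_bot_iff] at this
  rw [this]; trivial

theorem IsBasis.ext {B : Set K} (hB : S.IsBasis N B) {T T' : K →L[ℂ] K} (h : S.ComR N T)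
    (h' : S.ComR N T') (hh : ∀ m ∈ B, T m = T' m) : T = T' := by
  ext x
  refine hB.dense (LinearMap.eqLocus (T : K →ₗ[ℂ] K) (T' : K →ₗ[ℂ] K))
    (isClosed_eq T.continuous T'.continuous) (fun m hm b hb => ?_) x
  change T (S.R b m) = T' (S.R b m)
  rw [h b hb, h' b hb, hh m hm]

theorem ComR.limit {T : ℕ → K →L[ℂ] K} {d : K →L[ℂ] K} (h : ∀ n, S.ComR N (T n))
    (hd : ∀ x, Tendsto (fun n => T n x) atTop (nhds (d x))) : S.ComR N d := by
  intro b hb x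
  refine tendsto_nhds_unique (hd _) ?_
  simp only [fun n => h n b hb x]
  exact ((S.R b).continuous.tendsto _).comp (hd x)

variable (S) in
/-- convex hull of the unitary orbit -/
def Orb (P : StarSubalgebra ℂ A) (D : K →L[ℂ] K) : Set (K →L[ℂ] K) :=
  convexHull ℝ {T | ∃ u ∈ P, star u * u = 1 ∧ u * star u = 1 ∧ T = S.L (star u) * D * S.L u}

theorem Orb.conj {P : StarSubalgebra ℂ A} {D T : K →L[ℂ] K} (hT : T ∈ S.Orb P D) {u : A}
    (hu : u ∈ P) (h1 : star u * u = 1) (h2 : u * star u = 1) :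
    S.L (star u) * T * S.L u ∈ S.Orb P D := by
  let f : (K →L[ℂ] K) →ₗ[ℝ] (K →L[ℂ] K) :=
    { toFun := fun T => S.L (star u) * T * S.L u
      map_add' := fun a b => by simp [mul_add, add_mul]
      map_smul' := fun a b => by simp }
  have : S.Orb P D ⊆ f ⁻¹' S.Orb P D := by
    refine convexHull_min ?_ ((convex_convexHull ℝ _).linear_preimage f)
    rintro _ ⟨v, hv, hv1, hv2, rfl⟩
    refine subset_convexHull ℝ _ ⟨v * u, mul_mem hv hu, ?_, ?_, ?_⟩
    · rw [star_mul, mul_assoc, ← mul_assoc (star v), hv1, one_mul, h1]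
    · rw [star_mul, mul_assoc, ← mul_assoc u, h2, one_mul, hv2]
    · change S.L (star u) * (S.L (star v) * D * S.L v) * S.L u = _
      rw [star_mul, S.L_mul, S.L_mul]
      simp only [mul_assoc]
  exact this hT

theorem ComR.orb {P : StarSubalgebra ℂ A} {D T : K →L[ℂ] K} (hD : S.ComR N D)
    (hT : T ∈ S.Orb P D) : S.ComR N T := by
  have : S.Orb P D ⊆ {T | S.ComR N T} := by
    refine convexHull_min ?_ ?_
    · rintro _ ⟨v, hv, hv1, hv2, rfl⟩
      exact ((ComR.L _).mul hD).mul (ComR.L _)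
    · intro T hT T' hT' a b _ _ _ c hc x
      simp only [ContinuousLinearMap.add_apply, ContinuousLinearMap.smul_apply, hT c hc, hT' c hc,
        map_add]
      congr 1
      · exact ((S.R c).restrictScalars ℝ).map_smul a _ |>.symm
      · exact ((S.R c).restrictScalars ℝ).map_smul b _ |>.symm
  exact this hT

theorem fixed (hN : S.Good N) {B : Set K} (hB : S.IsBasis N B) (P : StarSubalgebra ℂ A)
    {D : K →L[ℂ] K} (hD : S.ComR N D) (hfin : Phi B D ≠ ⊤) :
    ∃ (T : ℕ → K →L[ℂ] K) (d : K →L[ℂ] K), (∀ n, T n ∈ S.Orb P D) ∧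
      (∀ x, Tendsto (fun n => T n x) atTop (nhds (d x))) ∧
      ∀ u ∈ P, star u * u = 1 → u * star u = 1 → ∀ x, d (S.L u x) = S.L u (d x) := by
  have hDO : D ∈ S.Orb P D := subset_convexHull ℝ _ ⟨1, one_mem _, by simp, by simp, by
    simp [S.L_one]⟩
  have hCom : ∀ T ∈ S.Orb P D, S.ComR N T := fun T hT => hD.orb hT
  have hbd : ∃ C, ∀ T ∈ S.Orb P D, ‖T‖ ≤ C := by
    refine ⟨‖D‖, fun T hT => ?_⟩
    have : S.Orb P D ⊆ Metric.closedBall 0 ‖D‖ := by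
      refine convexHull_min ?_ (convex_closedBall _ _)
      rintro _ ⟨v, hv, hv1, hv2, rfl⟩
      rw [mem_closedBall_zero_iff]
      refine ContinuousLinearMap.opNorm_le_bound _ (norm_nonneg _) fun x => ?_
      simp only [ContinuousLinearMap.mul_apply]
      rw [norm_L_unitary (by rwa [star_star])]
      exact (D.le_opNorm _).trans (by rw [norm_L_unitary hv1])
    exact mem_closedBall_zero_iff.1 (this hT)
  obtain ⟨C, hC⟩ := hbd
  set I : ENNReal := ⨅ T ∈ S.Orb P D, Phi B T with hI
  have hIle : ∀ T ∈ S.Orb P D, I ≤ Phi B T := fun T hT => iInf₂_le T hT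
  have hIfin : I ≠ ⊤ := ne_top_of_le_ne_top hfin (hIle D hDO)
  have hpos : ∀ n : ℕ, (0 : ℝ) < 1 / ((n : ℝ) + 1) := fun n => Nat.one_div_pos_of_nat
  have hex : ∀ n : ℕ, ∃ T ∈ S.Orb P D, Phi B T < I + ENNReal.ofReal (1 / ((n : ℝ) + 1)) := by
    intro n
    have : I < I + ENNReal.ofReal (1 / ((n : ℝ) + 1)) :=
      ENNReal.lt_add_right hIfin (by simp only [ne_eq, ENNReal.ofReal_eq_zero, not_le]; exact hpos n)
    nth_rw 1 [hI] at this
    simpa only [iInf_lt_iff, exists_prop] using this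
  choose T hT hTI using hex
  have hkey : ∀ T' ∈ S.Orb P D, ∀ T'' ∈ S.Orb P D, ∀ n m : ℕ,
      Phi B T' ≤ I + ENNReal.ofReal (1 / ((n : ℝ) + 1)) →
      Phi B T'' ≤ I + ENNReal.ofReal (1 / ((m : ℝ) + 1)) → ∀ b ∈ B,
      ‖T' b - T'' b‖ ^ 2 ≤ 2 * (1 / ((n : ℝ) + 1)) + 2 * (1 / ((m : ℝ) + 1)) := by
    intro T' hT' T'' hT'' n m h1 h2 b hb
    have hmid : (1 / 2 : ℝ) • (T' + T'') ∈ S.Orb P D := by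
      rw [smul_add]
      exact convex_convexHull ℝ _ hT' hT'' (by norm_num) (by norm_num) (by norm_num)
    have h3 : Phi B (T' - T'') + 4 * I ≤
        ENNReal.ofReal (2 * (1 / ((n : ℝ) + 1)) + 2 * (1 / ((m : ℝ) + 1))) + 4 * I := by
      calc _ ≤ Phi B (T' - T'') + 4 * Phi B ((1 / 2 : ℝ) • (T' + T'')) := by
            gcongr; exact hIle _ hmid
        _ = 2 * Phi B T' + 2 * Phi B T'' := phi_para B T' T''
        _ ≤ 2 * (I + ENNReal.ofReal (1 / ((n : ℝ) + 1))) +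
            2 * (I + ENNReal.ofReal (1 / ((m : ℝ) + 1))) := by gcongr
        _ = _ := by
          have h2 : (2 : ENNReal) = ENNReal.ofReal 2 := by simp
          rw [ENNReal.ofReal_add (mul_nonneg two_pos.le (hpos n).le)
            (mul_nonneg two_pos.le (hpos m).le), ENNReal.ofReal_mul (by norm_num),
            ENNReal.ofReal_mul (by norm_num), ← h2]
          ring
    have h4 := (ENNReal.add_le_add_iff_right (ENNReal.mul_ne_top (by simp) hIfin)).1 h3
    have h5 : ENNReal.ofReal (‖T' b - T'' b‖ ^ 2) ≤ Phi B (T' - T'') :=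
      ENNReal.le_tsum (f := fun m : B => ENNReal.ofReal (‖(T' - T'') m‖ ^ 2)) ⟨b, hb⟩
    exact (ENNReal.ofReal_le_ofReal_iff (add_nonneg (mul_nonneg two_pos.le (hpos n).le)
            (mul_nonneg two_pos.le (hpos m).le))).1 (h5.trans h4)
  have hlim : Tendsto (fun n : ℕ => 1 / ((n : ℝ) + 1)) atTop (nhds 0) :=
    tendsto_one_div_add_atTop_nhds_zero_nat
  have hcauB : ∀ b ∈ B, CauchySeq fun n => T n b := by
    intro b hb
    rw [Metric.cauchySeq_iff]
    intro ε hε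
    have h1 : ∀ᶠ n : ℕ in atTop, 1 / ((n : ℝ) + 1) < ε ^ 2 / 4 := by
      filter_upwards [hlim.eventually_lt_const (show (0 : ℝ) < ε ^ 2 / 4 by positivity)] with n hn
        using hn
    obtain ⟨n0, hn0⟩ := eventually_atTop.1 h1
    refine ⟨n0, fun m hm n hn => ?_⟩
    rw [dist_eq_norm]
    have := hkey _ (hT m) _ (hT n) m n (hTI m).le (hTI n).le b hb
    have h2 := hn0 m hm
    have h3 := hn0 n hn
    exact lt_of_pow_lt_pow_left₀ 2 hε.le (by linarith)
  let V : Submodule ℂ K :=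
    { carrier := {x | CauchySeq fun n => T n x}
      add_mem' := fun {x y} hx hy => by
        simp only [Set.mem_setOf_eq, map_add] at *; exact hx.add hy
      zero_mem' := by simp only [Set.mem_setOf_eq, map_zero]; exact cauchySeq_const _
      smul_mem' := fun c x hx => by
        simp only [Set.mem_setOf_eq, map_smul] at *
        exact (uniformContinuous_const_smul c).comp_cauchySeq hx }
  have hVc : IsClosed (V : Set K) := by
    rw [← closure_subset_iff_isClosed]
    intro x hx
    change CauchySeq fun n => T n x
    rw [Metric.cauchySeq_iff]
    intro ε hε
    have hC0 : 0 ≤ C := (norm_nonneg _).trans (hC D hDO)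
    obtain ⟨y, hy, hxy⟩ := Metric.mem_closure_iff.1 hx (ε / (4 * (C + 1))) (by positivity)
    obtain ⟨n0, hn0⟩ := Metric.cauchySeq_iff.1 (show CauchySeq fun n => T n y from hy) (ε / 2)
      (by positivity)
    refine ⟨n0, fun m hm n hn => ?_⟩
    have h1 : ∀ n, dist (T n x) (T n y) ≤ ε / 4 := fun n => by
      rw [dist_eq_norm, ← map_sub]
      refine ((T n).le_opNorm _).trans ?_
      calc ‖T n‖ * ‖x - y‖ ≤ (C + 1) * (ε / (4 * (C + 1))) := by
            rw [dist_eq_norm] at hxy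
            gcongr
            exact (hC _ (hT n)).trans (by linarith)
        _ = ε / 4 := by field_simp
    have h2 := hn0 m hm n hn
    have h3 := dist_triangle4 (T m x) (T m y) (T n y) (T n x)
    have h4 := h1 n
    rw [dist_comm] at h4
    linarith [h1 m]
  have hall : ∀ x, CauchySeq fun n => T n x := hB.dense V hVc fun m hm b hb => by
    change CauchySeq fun n => T n (S.R b m)
    simp only [fun n => hCom _ (hT n) b hb m]
    exact (S.R b).uniformContinuous.comp_cauchySeq (hcauB m hm)
  choose d0 hd0 using fun x => cauchySeq_tendsto_of_complete (hall x)
  let d : K →L[ℂ] K := continuousLinearMapOfTendsto T (f := d0) (tendsto_pi_nhds.2 hd0)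
  have hd : ∀ x, Tendsto (fun n => T n x) atTop (nhds (d x)) := hd0
  refine ⟨T, d, hT, hd, ?_⟩
  have hdR : S.ComR N d := ComR.limit (fun n => hCom _ (hT n)) hd
  intro u hu h1 h2
  have hconj : S.L (star u) * d * S.L u = d := by
    refine hB.ext (((ComR.L _).mul hdR).mul (ComR.L _)) hdR fun m hm => ?_
    have h3 : Tendsto (fun n => (S.L (star u) * T n * S.L u) m - T n m) atTop
        (nhds ((S.L (star u) * d * S.L u) m - d m)) :=
      (((S.L (star u)).continuous.tendsto _).comp (hd (S.L u m))).sub (hd m)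
    have h4 : Tendsto (fun n => (S.L (star u) * T n * S.L u) m - T n m) atTop (nhds 0) := by
      rw [tendsto_zero_iff_norm_tendsto_zero]
      have h5 : Tendsto (fun n : ℕ => √(4 * (1 / ((n : ℝ) + 1)))) atTop (nhds 0) := by
        have := (hlim.const_mul 4).sqrt
        simpa using this
      refine squeeze_zero (fun _ => norm_nonneg _) (fun n => ?_) h5
      refine Real.le_sqrt_of_sq_le ?_
      have := hkey _ (Orb.conj (hT n) hu h1 h2) _ (hT n) n n
        (by rw [hB.phi_conj hN (hCom _ (hT n)) h1 h2]; exact (hTI n).le) (hTI n).le m hm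
      linarith
    exact sub_eq_zero.1 (tendsto_nhds_unique h3 h4)
  intro x
  nth_rw 2 [← hconj]
  simp only [ContinuousLinearMap.mul_apply]
  rw [S.L_L, h2, S.L_one]
  rfl

end StdForm
end fx

section dd
universe a k
variable {A : Type a} [CStarAlgebra A] [PartialOrder A] [StarOrderedRing A]
variable {K : Type k} [NormedAddCommGroup K] [InnerProductSpace ℂ K] [CompleteSpace K]
namespace StdForm
variable {S : StdForm A K}
variable {N : StarSubalgebra ℂ A}

variable (S N) in
/-- Jones projection -/
noncomputable def eN : K →L[ℂ] K := (S.hN N).topologicalClosure.starProjection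

theorem hat_mem_cl {b : A} (hb : b ∈ N) : S.hat b ∈ (S.hN N).topologicalClosure :=
  Submodule.le_topologicalClosure _ (S.mem_hN.2 ⟨b, hb, rfl⟩)

theorem eN_comR : S.ComR N (S.eN N) := by
  refine proj_comR fun b hb y hy => ?_
  have hy' : y ∈ closure (S.hN N : Set K) := hy
  have : Set.MapsTo (S.R b) (S.hN N : Set K) (S.hN N : Set K) := by
    intro z hz
    obtain ⟨c, hc, rfl⟩ := S.mem_hN.1 hz
    rw [S.R_hat]
    exact S.mem_hN.2 ⟨_, mul_mem hc hb, rfl⟩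
  exact this.closure (S.R b).continuous hy'

theorem eN_L {ξ : K} {x g : A} (hg : S.IsBr N ξ (S.hat (star x)) g) :
    S.eN N (S.L x ξ) = S.hat (star g) := by
  refine Submodule.eq_starProjection_of_mem_of_inner_eq_zero (hat_mem_cl (star_mem hg.1)) ?_
  intro w hw
  have hw' : w ∈ closure (S.hN N : Set K) := hw
  have hcl : IsClosed {w : K | inner ℂ (S.L x ξ - S.hat (star g)) w = 0} :=
    isClosed_eq (by fun_prop) continuous_const
  refine closure_minimal ?_ hcl hw'
  intro z hz
  obtain ⟨b, hb, rfl⟩ := S.mem_hN.1 hz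
  change inner ℂ (S.L x ξ - S.hat (star g)) (S.hat b) = 0
  rw [inner_sub_left, S.L_inner, S.L_hat, ← S.R_hat, hg.2 b hb, S.inner_tr, star_star, sub_self]

theorem eN_inner (x y : K) : inner ℂ (S.eN N x) y = inner ℂ x (S.eN N y) :=
  Submodule.inner_starProjection_left_eq_right _ _ _

theorem inner_L (a : A) (x y : K) : inner ℂ x (S.L a y) = inner ℂ (S.L (star a) x) y := by
  rw [S.L_inner, star_star]

theorem inner_e (x : A) (ξ : K) :
    (inner ℂ ((S.L (star x) * S.eN N * S.L x) ξ) ξ).re = ‖S.eN N (S.L x ξ)‖ ^ 2 := by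
  simp only [ContinuousLinearMap.mul_apply]
  rw [S.L_inner, star_star]
  have h1 : S.eN N (S.eN N (S.L x ξ)) = S.eN N (S.L x ξ) :=
    Submodule.starProjection_eq_self_iff.2 (Submodule.starProjection_apply_mem _ _)
  rw [← h1, eN_inner]
  have := inner_self_eq_norm_sq (𝕜 := ℂ) (S.eN N (S.L x ξ))
  rw [h1]
  exact this

theorem phi_add (B : Set K) (T T' : K →L[ℂ] K) : Phi B (T + T') ≤ 2 * Phi B T + 2 * Phi B T' := by
  have h := phi_para B T (-T')
  have h2 : Phi B (-T') = Phi B T' := by simp [Phi]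
  rw [sub_neg_eq_add, h2] at h
  rw [← h]
  exact le_self_add

variable (S N) in
/-- the averaged operator -/
noncomputable def DF (F : Finset A) : K →L[ℂ] K := ∑ x ∈ F, S.L (star x) * S.eN N * S.L x

theorem phi_DF (hN : S.Good N) {B : Set K} (hB : S.IsBasis N B) (F : Finset A) :
    Phi B (S.DF N F) ≠ ⊤ := by
  classical
  have h1 : ∀ x : A, Phi B (S.L (star x) * S.eN N * S.L x) ≠ ⊤ := by
    intro x
    choose r hr using hB.nrm
    have h2 : ∀ m : B, ∃ g, S.IsBr N (m : K) (S.hat (star x)) g := fun m => by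
      obtain ⟨g, hg, -⟩ := br_exists hN (hr m m.2).bv (bv_hat (star x))
      exact ⟨g, hg⟩
    choose g hg using h2
    have h3 : Phi B (S.L (star x) * S.eN N * S.L x) ≤
        ENNReal.ofReal (‖star x‖ ^ 2) * ENNReal.ofReal (‖S.hat (star x)‖ ^ 2) := by
      rw [← hB.parseval g hg, Phi, ← ENNReal.tsum_mul_left]
      refine ENNReal.tsum_le_tsum fun m => ?_
      rw [← ENNReal.ofReal_mul (by positivity), ← mul_pow]
      refine ENNReal.ofReal_le_ofReal ?_
      gcongr
      simp only [ContinuousLinearMap.mul_apply]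
      rw [eN_L (hg m), ← S.norm_star (g m)]
      exact S.norm_L_le _ _
    exact ne_top_of_le_ne_top (ENNReal.mul_ne_top (by simp) (by simp)) h3
  unfold DF
  induction F using Finset.induction_on with
  | empty => simp [Phi]
  | insert x F hx ih =>
    rw [Finset.sum_insert hx]
    refine ne_top_of_le_ne_top ?_ (phi_add B _ _)
    exact ENNReal.add_ne_top.2 ⟨ENNReal.mul_ne_top (by simp) (h1 x),
      ENNReal.mul_ne_top (by simp) ih⟩

theorem exists_d (hN : S.Good N) (P : StarSubalgebra ℂ A) (F : Finset A) {ε : ℝ}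
    (hε : ∀ u ∈ P, star u * u = 1 → u * star u = 1 →
      ε ≤ ∑ y ∈ F, ∑ x ∈ F, ‖S.eN N (S.hat (x * u * y))‖ ^ 2) :
    ∃ (d : K →L[ℂ] K) (C : ℝ), S.ComR N d ∧
      (∀ u ∈ P, star u * u = 1 → u * star u = 1 → ∀ x, d (S.L u x) = S.L u (d x)) ∧
      (∀ x y, inner ℂ (d x) y = inner ℂ x (d y)) ∧
      ε ≤ ∑ y ∈ F, (inner ℂ (d (S.hat y)) (S.hat y)).re ∧
      ∀ (n : ℕ) (ξ : Fin n → K) (r : Fin n → A), (∀ i, S.Nrm N (ξ i) (r i)) →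
        (∀ i j, i ≠ j → S.Orth N (ξ i) (ξ j)) →
        ∑ i, (inner ℂ (d (ξ i)) (ξ i)).re ≤ C := by
  classical
  obtain ⟨B, hB⟩ := exists_basis hN
  have hDR : S.ComR N (S.DF N F) := by
    intro b hb x
    simp only [DF, ContinuousLinearMap.sum_apply, map_sum]
    refine Finset.sum_congr rfl fun y _ => ?_
    exact (((ComR.L _).mul eN_comR).mul (ComR.L _)) b hb x
  obtain ⟨T, d, hT, hd, hcomm⟩ := fixed hN hB P hDR (phi_DF hN hB F)
  have hdR : S.ComR N d := ComR.limit (fun n => hDR.orb (hT n)) hd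
  have hconj : ∀ (u : A) (ξ : K), (inner ℂ ((S.L (star u) * S.DF N F * S.L u) ξ) ξ).re =
      ∑ x ∈ F, ‖S.eN N (S.L (x * u) ξ)‖ ^ 2 := by
    intro u ξ
    simp only [DF, Finset.mul_sum, Finset.sum_mul, ContinuousLinearMap.sum_apply, sum_inner,
      Complex.re_sum]
    refine Finset.sum_congr rfl fun x _ => ?_
    rw [← inner_e, star_mul, S.L_mul, S.L_mul]
    simp only [mul_assoc]
  have hlin : ∀ (x y : K) (T T' : K →L[ℂ] K) (a b : ℝ), (inner ℂ ((a • T + b • T') x) y).re =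
      a * (inner ℂ (T x) y).re + b * (inner ℂ (T' x) y).re := by
    intro x y T T' a b
    simp only [ContinuousLinearMap.add_apply, ContinuousLinearMap.smul_apply, inner_add_left,
      inner_smul_left_eq_smul, Complex.add_re, Complex.real_smul, Complex.re_ofReal_mul]
  have hten : ∀ x y, Tendsto (fun n => inner ℂ (T n x) y) atTop (nhds (inner ℂ (d x) y)) :=
    fun x y => (hd x).inner tendsto_const_nhds
  have htenre : ∀ x y, Tendsto (fun n => (inner ℂ (T n x) y).re) atTop
      (nhds (inner ℂ (d x) y).re) :=
    fun x y => (Complex.continuous_re.tendsto _).comp (hten x y)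
  refine ⟨d, ∑ x ∈ F, ‖S.hat (star x)‖ ^ 2, hdR, hcomm, ?_, ?_, ?_⟩
  · have h1 : S.Orb P (S.DF N F) ⊆ {T | ∀ x y, inner ℂ (T x) y = inner ℂ x (T y)} := by
      refine convexHull_min ?_ ?_
      · rintro _ ⟨v, hv, hv1, hv2, rfl⟩ x y
        simp only [DF, ContinuousLinearMap.mul_apply, ContinuousLinearMap.sum_apply]
        rw [S.L_inner, inner_L (star v) x, star_star, sum_inner, inner_sum]
        refine Finset.sum_congr rfl fun z _ => ?_
        rw [S.L_inner, inner_L (star z) (S.L v x), star_star, eN_inner]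
      · intro T hT T' hT' a b _ _ _ x y
        simp only [ContinuousLinearMap.add_apply, ContinuousLinearMap.smul_apply, inner_add_left,
          inner_add_right, inner_smul_left_eq_smul, inner_smul_right_eq_smul, hT x y, hT' x y]
    intro x y
    refine tendsto_nhds_unique (hten x y) ?_
    simp only [fun n => h1 (hT n) x y]
    exact tendsto_const_nhds.inner (hd y)
  · have h1 : S.Orb P (S.DF N F) ⊆ {T | ε ≤ ∑ y ∈ F, (inner ℂ (T (S.hat y)) (S.hat y)).re} := by
      refine convexHull_min ?_ ?_
      · rintro _ ⟨v, hv, hv1, hv2, rfl⟩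
        simp only [Set.mem_setOf_eq, hconj, S.L_hat]
        exact hε v hv hv1 hv2
      · intro T hT T' hT' a b ha hb hab
        simp only [Set.mem_setOf_eq, hlin, Finset.sum_add_distrib, ← Finset.mul_sum] at *
        calc ε = a * ε + b * ε := by rw [← add_mul, hab, one_mul]
          _ ≤ _ := by gcongr
    exact ge_of_tendsto' (tendsto_finsetSum _ fun y _ => htenre _ _) fun n => h1 (hT n)
  · intro n ξ r hr ho
    have h1 : S.Orb P (S.DF N F) ⊆ {T | ∑ i, (inner ℂ (T (ξ i)) (ξ i)).re ≤
        ∑ x ∈ F, ‖S.hat (star x)‖ ^ 2} := by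
      refine convexHull_min ?_ ?_
      · rintro _ ⟨v, hv, hv1, hv2, rfl⟩
        simp only [Set.mem_setOf_eq, hconj]
        rw [Finset.sum_comm]
        refine Finset.sum_le_sum fun x _ => ?_
        have h2 : ∀ i, ∃ g, S.IsBr N (ξ i) (S.hat (star (x * v))) g := fun i => by
          obtain ⟨g, hg, -⟩ := br_exists hN (hr i).bv (bv_hat (star (x * v)))
          exact ⟨g, hg⟩
        choose g hg using h2
        have h3 := (bessel Finset.univ ξ r g (fun i _ => hr i) (fun i _ j _ h => ho i j h)
          (fun i _ => hg i)).2.2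
        have h4 : ‖S.hat (star (x * v))‖ = ‖S.hat (star x)‖ := by
          rw [star_mul, ← S.L_hat, norm_L_unitary (by rwa [star_star])]
        rw [h4] at h3
        rw [h3]
        simp only [eN_L (hg _), S.norm_star]
        exact le_add_of_nonneg_right (by positivity)
      · intro T hT T' hT' a b ha hb hab
        simp only [Set.mem_setOf_eq, hlin, Finset.sum_add_distrib, ← Finset.mul_sum] at *
        calc _ ≤ a * (∑ x ∈ F, ‖S.hat (star x)‖ ^ 2) + b * (∑ x ∈ F, ‖S.hat (star x)‖ ^ 2) := by
              gcongr
          _ = _ := by rw [← add_mul, hab, one_mul]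
    exact le_of_tendsto' (tendsto_finsetSum _ fun y _ => htenre _ _) fun n => h1 (hT n)

end StdForm
end dd

section sp
universe a k
variable {A : Type a} [CStarAlgebra A] [PartialOrder A] [StarOrderedRing A]
variable {K : Type k} [NormedAddCommGroup K] [InnerProductSpace ℂ K] [CompleteSpace K]

theorem pos_part_space (d : K →L[ℂ] K) (hd : ∀ x y, inner ℂ (d x) y = inner ℂ x (d y)) (c : ℝ)
    (hne : ∃ y, c * ‖y‖ ^ 2 < (inner ℂ (d y) y).re) :
    ∃ V : Submodule ℂ K, IsClosed (V : Set K) ∧ V ≠ ⊥ ∧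
      (∀ T : K →L[ℂ] K, (∀ x, T (d x) = d (T x)) → ∀ x ∈ V, T x ∈ V) ∧
      ∀ x ∈ V, c * ‖x‖ ^ 2 ≤ (inner ℂ (d x) x).re := by
  have hsa : IsSelfAdjoint d := by
    rw [ContinuousLinearMap.isSelfAdjoint_iff_isSymmetric]
    exact fun x y => hd x y
  have hnn : ∀ (f : ℝ → ℝ), (∀ t, 0 ≤ f t) → ∀ x, 0 ≤ (inner ℂ (cfc f d x) x).re := by
    intro f hf x
    have h1 : 0 ≤ cfc f d := cfc_nonneg fun t _ => hf t
    exact ((ContinuousLinearMap.nonneg_iff_isPositive _).1 h1).re_inner_nonneg_left x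
  have hdc : d - (c : ℂ) • 1 = cfc (fun t : ℝ => t - c) d := by
    rw [cfc_sub (fun t => t) (fun _ => c) d, cfc_id' ℝ d, cfc_const c d]
    congr 1
  have hin : ∀ x, (inner ℂ ((d - (c : ℂ) • (1 : K →L[ℂ] K)) x) x).re =
      (inner ℂ (d x) x).re - c * ‖x‖ ^ 2 := by
    intro x
    have h2 : inner ℂ x x = ((‖x‖ ^ 2 : ℝ) : ℂ) := by
      rw [inner_self_eq_norm_sq_to_K]; simp
    simp only [ContinuousLinearMap.sub_apply, ContinuousLinearMap.smul_apply,
      ContinuousLinearMap.one_apply, inner_sub_left, inner_smul_left, h2, Complex.sub_re,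
      Complex.conj_ofReal, Complex.re_ofReal_mul, Complex.ofReal_re]
  set T : K →L[ℂ] K := cfc (fun t : ℝ => max (t - c) 0) d with hT
  have hTsa : IsSelfAdjoint T := cfc_predicate _ _
  have hTs : ∀ x y, inner ℂ (T x) y = inner ℂ x (T y) :=
    (ContinuousLinearMap.isSelfAdjoint_iff_isSymmetric.1 hTsa)
  refine ⟨(LinearMap.range (T : K →ₗ[ℂ] K)).topologicalClosure,
    Submodule.isClosed_topologicalClosure _, ?_, ?_, ?_⟩
  · intro h0
    obtain ⟨y, hy⟩ := hne
    have hT0 : T = 0 := by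
      ext x
      have : T x ∈ (LinearMap.range (T : K →ₗ[ℂ] K)).topologicalClosure :=
        Submodule.le_topologicalClosure _ ⟨x, rfl⟩
      rw [h0] at this
      simpa using this
    have h1 : d - (c : ℂ) • 1 = T - cfc (fun t : ℝ => max (c - t) 0) d := by
      rw [hdc, hT, ← cfc_sub (fun t : ℝ => max (t - c) 0) (fun t : ℝ => max (c - t) 0) d]
      congr 1
      ext t
      rcases le_total t c with h | h
      · rw [max_eq_right (by linarith), max_eq_left (by linarith)]; ring
      · rw [max_eq_left (by linarith), max_eq_right (by linarith)]; ring
    have h2 := hin y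
    rw [h1, hT0, zero_sub, ContinuousLinearMap.neg_apply, inner_neg_left, Complex.neg_re] at h2
    have h3 := hnn (fun t : ℝ => max (c - t) 0) (fun t => le_max_right _ _) y
    linarith
  · intro S hS x hx
    have h1 : Commute d S := by
      ext x; exact (hS x).symm
    have h2 : Commute T S := hsa.commute_cfc h1 _
    have hx' : x ∈ closure (LinearMap.range (T : K →ₗ[ℂ] K) : Set K) := hx
    have : Set.MapsTo S (LinearMap.range (T : K →ₗ[ℂ] K) : Set K)
        (LinearMap.range (T : K →ₗ[ℂ] K) : Set K) := by
      rintro _ ⟨y, rfl⟩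
      exact ⟨S y, by
        have := congrArg (fun f : K →L[ℂ] K => f y) h2.eq
        exact this⟩
    exact this.closure S.continuous hx'
  · intro x hx
    have hx' : x ∈ closure (LinearMap.range (T : K →ₗ[ℂ] K) : Set K) := hx
    have hcl : IsClosed {x : K | c * ‖x‖ ^ 2 ≤ (inner ℂ (d x) x).re} :=
      isClosed_le (by fun_prop) (Complex.continuous_re.comp (by fun_prop))
    refine closure_minimal ?_ hcl hx'
    rintro _ ⟨y, rfl⟩
    change c * ‖T y‖ ^ 2 ≤ (inner ℂ (d (T y)) (T y)).re
    have h1 := hin (T y)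
    have h2 : inner ℂ ((d - (c : ℂ) • (1 : K →L[ℂ] K)) (T y)) (T y) =
        inner ℂ (cfc (fun t : ℝ => max (t - c) 0 * ((t - c) * max (t - c) 0)) d y) y := by
      rw [← hTs]
      congr 1
      rw [hdc, cfc_mul (fun t : ℝ => max (t - c) 0) (fun t => (t - c) * max (t - c) 0) d,
        cfc_mul (fun t : ℝ => (t - c)) (fun t => max (t - c) 0) d]
      rfl
    have h3 := hnn (fun t : ℝ => max (t - c) 0 * ((t - c) * max (t - c) 0)) (fun t => by
      rcases le_total t c with h | h
      · rw [max_eq_right (by linarith)]; simp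
      · rw [max_eq_left (by linarith)]
        have : 0 ≤ t - c := by linarith
        positivity) y
    rw [h2] at h1
    linarith

namespace StdForm
variable {S : StdForm A K}
variable {N : StarSubalgebra ℂ A}

theorem exists_V (hN : S.Good N) (P : StarSubalgebra ℂ A) (F : Finset A) {ε : ℝ} (hε0 : 0 < ε)
    (hε : ∀ u ∈ P, star u * u = 1 → u * star u = 1 →
      ε ≤ ∑ y ∈ F, ∑ x ∈ F, ‖S.eN N (S.hat (x * u * y))‖ ^ 2) :
    ∃ (V : Submodule ℂ K) (C : ℝ), IsClosed (V : Set K) ∧ V ≠ ⊥ ∧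
      (∀ b ∈ N, ∀ x ∈ V, S.R b x ∈ V) ∧
      (∀ u ∈ P, star u * u = 1 → u * star u = 1 → ∀ x ∈ V, S.L u x ∈ V) ∧
      ∀ (n : ℕ) (ξ : Fin n → K) (r : Fin n → A), (∀ i, ξ i ∈ V) → (∀ i, S.Nrm N (ξ i) (r i)) →
        (∀ i j, i ≠ j → S.Orth N (ξ i) (ξ j)) → ∑ i, ‖ξ i‖ ^ 2 ≤ C := by
  obtain ⟨d, C, hdR, hdL, hsa, hge, hle⟩ := exists_d hN P F hε
  set Q : ℝ := ∑ y ∈ F, ‖S.hat y‖ ^ 2 with hQ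
  have hQ0 : 0 ≤ Q := Finset.sum_nonneg fun _ _ => by positivity
  set c := ε / (Q + 1) with hc
  have hc0 : 0 < c := by positivity
  have hcQ : c * Q < ε := by
    rw [hc, div_mul_eq_mul_div, div_lt_iff₀ (by positivity)]
    nlinarith
  obtain ⟨V, hVc, hV0, hVi, hV⟩ := pos_part_space d hsa c (by
    by_contra hcon
    push Not at hcon
    have : ∑ y ∈ F, (inner ℂ (d (S.hat y)) (S.hat y)).re ≤ c * Q := by
      rw [hQ, Finset.mul_sum]
      exact Finset.sum_le_sum fun y _ => hcon _
    linarith)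
  refine ⟨V, C / c, hVc, hV0, fun b hb => hVi _ fun x => (hdR b hb x).symm,
    fun u hu h1 h2 => hVi _ fun x => (hdL u hu h1 h2 x).symm, ?_⟩
  intro n ξ r hξ hr ho
  rw [le_div_iff₀ hc0, mul_comm, Finset.mul_sum]
  exact (Finset.sum_le_sum fun i _ => hV _ (hξ i)).trans (hle n ξ r hr ho)

end StdForm
end sp

section mx
universe a k
variable {A : Type a} [CStarAlgebra A] [PartialOrder A] [StarOrderedRing A]
variable {K : Type k} [NormedAddCommGroup K] [InnerProductSpace ℂ K] [CompleteSpace K]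

theorem cl_min {s : Set K} {V : Submodule ℂ K} (hV : IsClosed (V : Set K)) (T : K →L[ℂ] K)
    (h : ∀ x ∈ s, T x ∈ V) : ∀ x ∈ (Submodule.span ℂ s).topologicalClosure, T x ∈ V := by
  have h1 : (Submodule.span ℂ s).topologicalClosure ≤ V.comap (T : K →ₗ[ℂ] K) :=
    Submodule.topologicalClosure_minimal _ (Submodule.span_le.2 h) (hV.preimage T.continuous)
  exact h1

namespace StdForm
variable {S : StdForm A K}
variable {N : StarSubalgebra ℂ A}

theorem Orth.add {x y z : K} (h : S.Orth N x z) (h' : S.Orth N y z) : S.Orth N (x + y) z :=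
  fun b hb => by rw [inner_add_left, h b hb, h' b hb, add_zero]

theorem orth_zero {z : K} : S.Orth N 0 z := fun b hb => by simp

theorem nrm_zero : S.Nrm N 0 0 := by
  refine ⟨⟨zero_mem _, fun b hb => ?_⟩, by simp, by simp⟩
  simp [tr_zero]

theorem Nrm.add {x y : K} {r r' : A} (h : S.Nrm N x r) (h' : S.Nrm N y r') (ho : S.Orth N x y)
    (hr : r * r' = 0) : S.Nrm N (x + y) (r + r') := by
  have hr' : r' * r = 0 := by
    have := congrArg star hr
    rwa [star_mul, h.2.1, h'.2.1, star_zero] at this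
  refine ⟨⟨add_mem h.1.1 h'.1.1, fun b hb => ?_⟩, ?_, ?_⟩
  · rw [map_add, inner_add_left, inner_add_right, inner_add_right, ho b hb, ho.symm b hb, add_mul,
      S.tr_add, h.1.2 b hb, h'.1.2 b hb]
    ring
  · rw [star_add, h.2.1, h'.2.1]
  · rw [mul_add, add_mul, add_mul, hr, hr', h.2.2, h'.2.2]; simp

theorem sum_nrm (hN : S.Good N) {ι : Type*} (δ : ι → K) (r : ι → A) (hn : ∀ i, S.Nrm N (δ i) (r i))
    (ho : ∀ i j, i ≠ j → S.Orth N (δ i) (δ j)) (hr : ∀ i j, i ≠ j → r i * r j = 0) :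
    ∃ ξ r', HasSum δ ξ ∧ S.Nrm N ξ r' ∧ (∀ i, r i * r' = r i) ∧ ∀ i, S.R (r i) ξ = δ i := by
  classical
  have hfin : ∀ F : Finset ι, S.Nrm N (∑ i ∈ F, δ i) (∑ i ∈ F, r i) := by
    intro F
    induction F using Finset.induction_on with
    | empty => simpa using nrm_zero
    | insert i F hi ih =>
      rw [Finset.sum_insert hi, Finset.sum_insert hi]
      refine (hn i).add ih ?_ ?_
      · intro b hb
        rw [map_sum, inner_sum]
        exact Finset.sum_eq_zero fun j hj => ho i j (fun h => hi (h ▸ hj)) b hb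
      · rw [Finset.mul_sum]
        exact Finset.sum_eq_zero fun j hj => hr i j (fun h => hi (h ▸ hj))
  have hin : ∀ i j, i ≠ j → inner ℂ (δ i) (δ j) = 0 := fun i j h => by
    have := ho i j h 1 (one_mem _)
    rwa [S.R_one] at this
  have hof : OrthogonalFamily ℂ (fun i => (ℂ ∙ δ i : Submodule ℂ K))
      fun i => (ℂ ∙ δ i : Submodule ℂ K).subtypeₗᵢ := by
    refine OrthogonalFamily.of_pairwise fun i j h => ?_
    rw [Function.onFun, Submodule.isOrtho_span]
    rintro _ rfl _ rfl
    exact hin i j h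
  have hsum : Summable δ := by
    have := (hof.summable_iff_norm_sq_summable fun i => ⟨δ i, Submodule.mem_span_singleton_self _⟩).2
      (by
        refine summable_of_sum_le (c := 1) (fun _ => by positivity) fun F => ?_
        change ∑ i ∈ F, ‖δ i‖ ^ 2 ≤ 1
        have h1 : ∑ i ∈ F, ‖δ i‖ ^ 2 = ‖S.hat (∑ i ∈ F, r i)‖ ^ 2 := by
          rw [← (hfin F).norm, (hfin F).norm_sq, tr, map_sum, inner_sum, Complex.re_sum]
          exact Finset.sum_congr rfl fun i _ => (hn i).norm_sq
        rw [h1]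
        have h2 : ‖S.hat (∑ i ∈ F, r i)‖ ≤ 1 :=
          (S.norm_hat_le _).trans (proj_norm (hfin F).2.1 (hfin F).2.2)
        exact pow_le_one₀ (norm_nonneg _) h2)
    exact this
  obtain ⟨ξ, hξ⟩ := hsum
  have hbv : S.Bv N ξ 1 := by
    refine ⟨zero_le_one, fun b hb => ?_⟩
    have h1 : Tendsto (fun F : Finset ι => ‖S.R b (∑ i ∈ F, δ i)‖) atTop (nhds ‖S.R b ξ‖) :=
      (((S.R b).continuous.tendsto _).comp hξ).norm
    exact le_of_tendsto' h1 fun F => (hfin F).bv.2 b hb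
  obtain ⟨h, hh, -⟩ := br_exists hN hbv hbv
  have hsa : star h = h := br_unique hh.symm hh
  have hδξ : ∀ i, S.IsBr N (δ i) ξ (r i) := by
    intro i
    refine ⟨(hn i).1.1, fun b hb => ?_⟩
    rw [← (hn i).1.2 b hb]
    have h1 : HasSum (fun j => inner ℂ (δ i) (S.R b (δ j))) (inner ℂ (δ i) (S.R b ξ)) :=
      (innerSL ℂ (δ i)).hasSum ((S.R b).hasSum hξ)
    exact h1.unique (hasSum_single i fun j hj => ho i j hj.symm b hb)
  have hR : ∀ i, S.R (r i) ξ = δ i := by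
    intro i
    refine ((S.R (r i)).hasSum hξ).unique ?_
    have := hasSum_single (f := fun j => S.R (r i) (δ j)) i fun j hj => by
      rw [← (hn j).R_r, S.R_R, hr j i hj, S.R_zero]; rfl
    rwa [(hn i).R_r] at this
  have hrh : ∀ i, r i * h = r i := by
    intro i
    have h1 := hh.mul_left (hn i).1.1
    rw [hR, (hn i).2.1] at h1
    exact br_unique h1 (hδξ i)
  refine ⟨ξ, h, hξ, ⟨hh, hsa, ?_⟩, hrh, hR⟩
  have h1 : S.IsBr N ξ (ξ - S.R h ξ) 0 := by
    refine isBr_zero fun b hb => ?_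
    have h2 : HasSum (fun j => inner ℂ (S.R b (ξ - S.R h ξ)) (δ j)) (inner ℂ (S.R b (ξ - S.R h ξ)) ξ) :=
      (innerSL ℂ (S.R b (ξ - S.R h ξ))).hasSum hξ
    have h3 : ∀ j, inner ℂ (S.R b (ξ - S.R h ξ)) (δ j) = 0 := fun j => by
      rw [← inner_conj_symm, ((hδξ j).sub ((hδξ j).mul_right hh.1)).2 b hb, hrh, sub_self, zero_mul,
        tr_zero, map_zero]
    simp only [h3] at h2
    rw [← inner_conj_symm, h2.unique hasSum_zero, map_zero]
  have h2 := br_unique h1 (hh.sub (hh.mul_right hh.1))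
  exact (sub_eq_zero.1 h2.symm).symm

theorem exists_hat_ne (T : K →L[ℂ] K) (h : T ≠ 0) : ∃ a, T (S.hat a) ≠ 0 := by
  by_contra hcon
  push Not at hcon
  exact h (S.ext_hat fun w => by rw [hcon]; rfl)

theorem exists_xi (hN : S.Good N) (X : Submodule ℂ K) (hX : IsClosed (X : Set K))
    (hXR : ∀ b ∈ N, ∀ x ∈ X, S.R b x ∈ X) :
    ∃ ξ ∈ X, ∃ r, S.Nrm N ξ r ∧ ∀ κ ∈ X, S.Orth N ξ κ → S.R (1 - r) κ = 0 := by
  obtain ⟨D, hD1, hD2, hD3⟩ := exists_max_pairwise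
    (fun z : K × A => z.1 ∈ X ∧ S.Nrm N z.1 z.2) (fun z w => S.Orth N z.1 w.1 ∧ z.2 * w.2 = 0)
  obtain ⟨ξ, r, hξ, hn, hrr, hR⟩ := sum_nrm hN (fun z : D => (z : K × A).1)
    (fun z : D => (z : K × A).2) (fun z => (hD1 z z.2).2)
    (fun i j hij => (hD2 i.2 j.2 fun h => hij (Subtype.ext h)).1)
    (fun i j hij => (hD2 i.2 j.2 fun h => hij (Subtype.ext h)).2)
  have hξX : ξ ∈ X := hX.mem_of_tendsto hξ (Eventually.of_forall fun F =>
    sum_mem fun i _ => (hD1 i i.2).1)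
  refine ⟨ξ, hξX, r, hn, ?_⟩
  intro κ hκ hκo
  by_contra hne
  let X1 : Submodule ℂ K :=
    { carrier := {y | y ∈ X ∧ S.Orth N ξ y}
      add_mem' := fun {y z} hy hz => ⟨add_mem hy.1 hz.1, fun b hb => by
        rw [map_add, inner_add_right, hy.2 b hb, hz.2 b hb, add_zero]⟩
      zero_mem' := ⟨zero_mem _, fun b hb => by simp⟩
      smul_mem' := fun c y hy => ⟨X.smul_mem c hy.1, fun b hb => by
        rw [map_smul, inner_smul_right, hy.2 b hb, mul_zero]⟩ }
  have hX1c : IsClosed (X1 : Set K) := by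
    have : (X1 : Set K) = (X : Set K) ∩ ⋂ b ∈ N, {y | inner ℂ ξ (S.R b y) = 0} := by
      ext y; simp [X1, Orth]
    rw [this]
    refine hX.inter (isClosed_biInter fun b _ => ?_)
    exact isClosed_eq (by fun_prop) continuous_const
  haveI : CompleteSpace X1 := hX1c.completeSpace_coe
  have hX1R : ∀ b ∈ N, ∀ y ∈ X1, S.R b y ∈ X1 := fun b hb y hy =>
    ⟨hXR b hb y hy.1, fun c hc => by rw [S.R_R]; exact hy.2 _ (mul_mem hb hc)⟩
  have hr1 : 1 - r ∈ N := sub_mem (one_mem _) hn.1.1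
  have hP := proj_comR hX1R
  obtain ⟨a, ha⟩ := exists_hat_ne (S := S) (S.R (1 - r) * X1.starProjection) (by
    intro h0
    apply hne
    have := congrArg (fun T : K →L[ℂ] K => T κ) h0
    simp only [ContinuousLinearMap.mul_apply] at this
    rwa [Submodule.starProjection_eq_self_iff.2 (show κ ∈ X1 from ⟨hκ, hκo⟩)] at this)
  simp only [ContinuousLinearMap.mul_apply] at ha
  have hbv := ((bv_hat (S := S) (N := N) a).map hP).right hr1
  obtain ⟨h, hh, -⟩ := br_exists hN hbv hbv
  obtain ⟨c, r'', ξ'', hc, hξ'', hnr, hξ0, hkill, -⟩ := normalize hN ha hh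
  have hξX1 : ξ'' ∈ X1 := hX1c.mem_of_tendsto hξ'' (Eventually.of_forall fun n =>
    hX1R _ (hc n) _ (hX1R _ hr1 _ (X1.starProjection_apply_mem _)))
  have hk : r'' * r = 0 := hkill r (by
    rw [S.R_R, sub_mul, one_mul, hn.2.2, sub_self, S.R_zero]; rfl) hn.1.1
  have hk' : r * r'' = 0 := by
    have := congrArg star hk
    rwa [star_mul, hn.2.1, hnr.2.1, star_zero] at this
  have hor : ∀ z (hz : z ∈ D), S.Orth N z.1 ξ'' := fun z hz b hb => by
    have := hR ⟨z, hz⟩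
    simp only at this
    rw [← this]
    exact hξX1.2.inner2 (hD1 z hz).2.1.1 hb
  have hmem : (ξ'', r'') ∈ D := by
    refine hD3 (ξ'', r'') ⟨hξX1.1, hnr⟩ fun z hz => ?_
    have h1 : z.2 * r'' = 0 := by
      have := hrr ⟨z, hz⟩
      simp only at this
      rw [← this, mul_assoc, hk', mul_zero]
    refine ⟨⟨hor z hz, h1⟩, (hor z hz).symm, ?_⟩
    have := congrArg star h1
    rwa [star_mul, hnr.2.1, (hD1 z hz).2.2.1, star_zero] at this
  have := hor _ hmem 1 (one_mem _)
  rw [S.R_one] at this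
  exact hξ0 (inner_self_eq_zero.1 this)

end StdForm
end mx

section bm
universe a k
variable {A : Type a} [CStarAlgebra A] [PartialOrder A] [StarOrderedRing A]
variable {K : Type k} [NormedAddCommGroup K] [InnerProductSpace ℂ K] [CompleteSpace K]

/-- many matrix units in `P` -/
def ManyUnits (P : StarSubalgebra ℂ A) : Prop :=
  ∀ n : ℕ, ∃ m : ℕ, n ≤ m ∧ ∃ (w : Fin m → A) (p : A), (∀ i, w i ∈ P) ∧ p ∈ P ∧ star p = p ∧
    p * p = p ∧ (∀ i, star (w i) * w i = p) ∧ (∀ i j, i ≠ j → star (w i) * w j = 0) ∧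
    (∀ i, w i * p = w i) ∧ ∑ i, w i * star (w i) = 1

namespace StdForm
variable {S : StdForm A K}
variable {N : StarSubalgebra ℂ A}

variable (S N) in
/-- cyclic subspace -/
noncomputable def cyc (ξ : K) : Submodule ℂ K :=
  (Submodule.span ℂ {y | ∃ b ∈ N, S.R b ξ = y}).topologicalClosure

theorem cyc_closed (ξ : K) : IsClosed (S.cyc N ξ : Set K) := Submodule.isClosed_topologicalClosure _

theorem mem_cyc (ξ : K) {b : A} (hb : b ∈ N) : S.R b ξ ∈ S.cyc N ξ :=
  Submodule.le_topologicalClosure _ (Submodule.subset_span ⟨b, hb, rfl⟩)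

theorem cyc_R (ξ : K) {b : A} (hb : b ∈ N) : ∀ x ∈ S.cyc N ξ, S.R b x ∈ S.cyc N ξ := by
  refine cl_min (cyc_closed ξ) _ ?_
  rintro _ ⟨c, hc, rfl⟩
  rw [S.R_R]
  exact mem_cyc ξ (mul_mem hc hb)

theorem cyc_le {ξ : K} {V : Submodule ℂ K} (hV : IsClosed (V : Set K)) (T : K →L[ℂ] K)
    (hT : S.ComR N T) (hR : ∀ b ∈ N, ∀ x ∈ V, S.R b x ∈ V) (h : T ξ ∈ V) :
    ∀ x ∈ S.cyc N ξ, T x ∈ V := by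
  refine cl_min hV _ ?_
  rintro _ ⟨c, hc, rfl⟩
  rw [hT c hc]
  exact hR c hc _ h

theorem cyc_orth {ξ κ : K} (ho : S.Orth N ξ κ) (hκ : κ ∈ S.cyc N ξ) : κ = 0 := by
  have h1 : ∀ x ∈ S.cyc N ξ, inner ℂ κ x = 0 := by
    have hc : (Submodule.span ℂ {y | ∃ b ∈ N, S.R b ξ = y}).topologicalClosure ≤
        (innerSL ℂ κ : K →L[ℂ] ℂ).ker := by
      refine Submodule.topologicalClosure_minimal _ (Submodule.span_le.2 ?_)
        (ContinuousLinearMap.isClosed_ker _)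
      rintro _ ⟨c, hc, rfl⟩
      exact ho.symm c hc
    exact fun x hx => hc hx
  exact inner_self_eq_zero.1 (h1 κ hκ)

theorem cyc_eq {ξ κ : K} {r g : A} (hn : S.Nrm N ξ r) (hκ : κ ∈ S.cyc N ξ) (hg : S.IsBr N ξ κ g) :
    κ = S.R g ξ := by
  refine sub_eq_zero.1 (cyc_orth (ξ := ξ) ?_ (sub_mem hκ (mem_cyc ξ hg.1)))
  intro b hb
  rw [(hn.br_sub hg).2 b hb, zero_mul, tr_zero]

theorem bimod (hN : S.Good N) {P : StarSubalgebra ℂ A} (hmu : ManyUnits P)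
    {V : Submodule ℂ K} {C : ℝ} (hVc : IsClosed (V : Set K)) (hV0 : V ≠ ⊥)
    (hVR : ∀ b ∈ N, ∀ x ∈ V, S.R b x ∈ V) (hVL : ∀ u ∈ P, ∀ x ∈ V, S.L u x ∈ V)
    (hC : ∀ (n : ℕ) (ξ : Fin n → K) (r : Fin n → A), (∀ i, ξ i ∈ V) →
      (∀ i, S.Nrm N (ξ i) (r i)) → (∀ i j, i ≠ j → S.Orth N (ξ i) (ξ j)) →
      ∑ i, ‖ξ i‖ ^ 2 ≤ C) :
    ∃ p ∈ P, star p = p ∧ p * p = p ∧ ∃ (q : A) (ξ : K) (θ : A → A), ξ ≠ 0 ∧ S.Nrm N ξ q ∧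
      S.L p ξ = ξ ∧ ∀ x ∈ P, p * x * p = x → θ x ∈ N ∧ q * θ x = θ x ∧ θ x * q = θ x ∧
        S.L x ξ = S.R (θ x) ξ := by
  haveI : CompleteSpace V := hVc.completeSpace_coe
  -- a vector in V
  obtain ⟨a, ha⟩ := exists_hat_ne (S := S) V.starProjection (by
    intro h0
    apply hV0
    rw [Submodule.eq_bot_iff]
    intro x hx
    rw [← Submodule.starProjection_eq_self_iff.2 hx, h0]; rfl)
  set η := V.starProjection (S.hat a) with hη
  have hηV : η ∈ V := V.starProjection_apply_mem _
  obtain ⟨C1, hC1, hbv⟩ : ∃ C1, 0 ≤ C1 ∧ ∀ b ∈ N, ‖S.R b η‖ ≤ C1 * ‖S.hat b‖ :=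
    ⟨_, (bv_hat (S := S) (N := N) a).map (proj_comR hVR)⟩
  have hη0 : 0 < ‖η‖ ^ 2 := by have := norm_pos_iff.2 ha; positivity
  obtain ⟨n, hnb⟩ := exists_nat_gt (C1 ^ 2 * C / ‖η‖ ^ 2)
  rw [div_lt_iff₀ hη0] at hnb
  obtain ⟨m, hnm, w, p, hw, hp, hps, hpp, hww, hwo, hwp, hw1⟩ := hmu n
  have hnb : C1 ^ 2 * C < m * ‖η‖ ^ 2 := hnb.trans_le (by gcongr)
  let X : Submodule ℂ K :=
    { carrier := {y | y ∈ V ∧ S.L p y = y}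
      add_mem' := fun {y z} hy hz => ⟨add_mem hy.1 hz.1, by rw [map_add, hy.2, hz.2]⟩
      zero_mem' := ⟨zero_mem _, map_zero _⟩
      smul_mem' := fun c y hy => ⟨V.smul_mem c hy.1, by rw [map_smul, hy.2]⟩ }
  have hXc : IsClosed (X : Set K) := hVc.inter (isClosed_eq (S.L p).continuous continuous_id)
  have hXR : ∀ b ∈ N, ∀ x ∈ X, S.R b x ∈ X := fun b hb x hx =>
    ⟨hVR b hb x hx.1, by rw [S.LR, hx.2]⟩
  have hXL : ∀ x ∈ P, p * x = x → ∀ y ∈ V, S.L x y ∈ X := fun x hx h y hy =>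
    ⟨hVL x hx y hy, by rw [S.L_L, h]⟩
  obtain ⟨ξ, hξX, r, hn, hmax⟩ := exists_xi hN X hXc hXR
  have hr1 : 1 - r ∈ N := sub_mem (one_mem _) hn.1.1
  by_cases hcase : ∀ κ ∈ X, S.R (1 - r) κ = 0
  · exfalso
    have hVr : ∀ y ∈ V, S.R (1 - r) y = 0 := by
      intro y hy
      have h1 : y = ∑ i, S.L (w i) (S.L (star (w i)) y) := by
        simp only [S.L_L]
        have : S.L (∑ i, w i * star (w i)) y = y := by rw [hw1, S.L_one]; rfl
        nth_rw 1 [← this]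
        have h2 : S.L (∑ i, w i * star (w i)) = ∑ i, S.L (w i * star (w i)) :=
          map_sum (⟨⟨S.L, S.L_zero⟩, S.L_add⟩ : A →+ (K →L[ℂ] K)) _ _
        rw [h2, ContinuousLinearMap.sum_apply]
      rw [h1, map_sum]
      refine Finset.sum_eq_zero fun i _ => ?_
      rw [← S.LR, hcase _ (hXL _ (star_mem (hw i)) ?_ y hy), map_zero]
      have := congrArg star (hwp i)
      rwa [star_mul, hps] at this
    have h1 : S.R r η = η := by
      have := hVr η hηV
      rw [S.R_sub, S.R_one] at this
      exact (sub_eq_zero.1 this).symm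
    have h2 : ‖η‖ ^ 2 ≤ C1 ^ 2 * ‖ξ‖ ^ 2 := by
      rw [← mul_pow, hn.norm]
      gcongr
      rw [← h1]
      exact hbv r hn.1.1
    have hbr : ∀ i j, ∀ b, inner ℂ (S.L (w i) ξ) (S.R b (S.L (w j) ξ)) =
        inner ℂ ξ (S.R b (S.L (star (w i) * w j) ξ)) := fun i j b => by
      rw [S.L_inner, S.LR, S.L_L]
    have h3 := hC m (fun i => S.L (w i) ξ) (fun _ => r) (fun i => hVL _ (hw i) _ hξX.1)
      (fun i => ⟨⟨hn.1.1, fun b hb => by rw [hbr, hww, hξX.2, hn.1.2 b hb]⟩, hn.2⟩)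
      (fun i j hij b hb => by rw [hbr, hwo i j hij, S.L_zero]; simp)
    have h4 : ∀ i, ‖S.L (w i) ξ‖ ^ 2 = ‖ξ‖ ^ 2 := fun i => by
      have : inner ℂ (S.L (w i) ξ) (S.L (w i) ξ) = inner ℂ ξ ξ := by
        rw [S.L_inner, S.L_L, hww, hξX.2]
      have h := congrArg (RCLike.re : ℂ → ℝ) this
      rwa [inner_self_eq_norm_sq, inner_self_eq_norm_sq] at h
    simp only [h4, Finset.sum_const, Finset.card_univ, Fintype.card_fin, nsmul_eq_mul] at h3
    have h5 : (m : ℝ) * ‖η‖ ^ 2 ≤ C1 ^ 2 * C := by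
      calc _ ≤ (m : ℝ) * (C1 ^ 2 * ‖ξ‖ ^ 2) := by gcongr
        _ = C1 ^ 2 * (m * ‖ξ‖ ^ 2) := by ring
        _ ≤ _ := by gcongr
    linarith
  push Not at hcase
  obtain ⟨κ0, hκ0, hκne⟩ := hcase
  let Y : Submodule ℂ K :=
    (Submodule.span ℂ {y | ∃ b ∈ N, ∃ κ ∈ X, S.R b (S.R (1 - r) κ) = y}).topologicalClosure
  have hYc : IsClosed (Y : Set K) := Submodule.isClosed_topologicalClosure _
  haveI : CompleteSpace Y := hYc.completeSpace_coe
  have hYm : ∀ b ∈ N, ∀ κ ∈ X, S.R b (S.R (1 - r) κ) ∈ Y := fun b hb κ hκ =>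
    Submodule.le_topologicalClosure _ (Submodule.subset_span ⟨b, hb, κ, hκ, rfl⟩)
  have hYR : ∀ b ∈ N, ∀ x ∈ Y, S.R b x ∈ Y := by
    intro b hb
    refine cl_min hYc _ ?_
    rintro _ ⟨c, hc, κ, hκ, rfl⟩
    rw [S.R_R]
    exact hYm _ (mul_mem hc hb) _ hκ
  have hYL : ∀ x ∈ P, p * x * p = x → ∀ y ∈ Y, S.L x y ∈ Y := by
    intro x hx hpx
    refine cl_min hYc _ ?_
    rintro _ ⟨c, hc, κ, hκ, rfl⟩
    rw [S.LR, S.LR]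
    exact hYm _ hc _ (hXL x hx (by rw [← hpx]; simp only [← mul_assoc, hpp]) _ hκ.1)
  have hYp : ∀ y ∈ Y, S.L p y = y := by
    intro y hy
    have := cl_min (V := ⊥) (by simp) (S.L p - 1) (s := {y | ∃ b ∈ N, ∃ κ ∈ X, S.R b (S.R (1 - r) κ) = y}) (by
      rintro _ ⟨c, hc, κ, hκ, rfl⟩
      simp only [ContinuousLinearMap.sub_apply, ContinuousLinearMap.one_apply, Submodule.mem_bot]
      rw [S.LR, S.LR, hκ.2, sub_self]) y hy
    exact sub_eq_zero.1 this
  haveI : CompleteSpace (S.cyc N ξ) := (cyc_closed ξ).completeSpace_coe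
  have hcycX : ∀ x ∈ S.cyc N ξ, x ∈ X := by
    have := cyc_le (S := S) (N := N) hXc (1 : K →L[ℂ] K) (fun b _ x => rfl) hXR hξX
    exact this
  have hYcyc : ∀ y ∈ Y, y ∈ S.cyc N ξ := by
    refine cl_min (cyc_closed ξ) (1 : K →L[ℂ] K) ?_
    rintro _ ⟨c, hc, κ, hκ, rfl⟩
    refine cyc_R ξ hc _ ?_
    have h1 : κ - (S.cyc N ξ).starProjection κ ∈ X :=
      sub_mem hκ (hcycX _ (Submodule.starProjection_apply_mem _ _))
    have h2 : S.Orth N ξ (κ - (S.cyc N ξ).starProjection κ) := by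
      intro b hb
      have h3 : κ - (S.cyc N ξ).starProjection κ ∈ (S.cyc N ξ)ᗮ :=
        Submodule.sub_starProjection_mem_orthogonal _
      have := (Submodule.mem_orthogonal _ _).1 h3 _ (mem_cyc ξ (star_mem hb))
      rwa [S.R_inner, star_star] at this
    have h3 := hmax _ h1 h2
    rw [map_sub, sub_eq_zero] at h3
    rw [h3]
    exact cyc_R ξ hr1 _ (Submodule.starProjection_apply_mem _ _)
  have hPY := proj_comR hYR
  set ξ' := Y.starProjection ξ with hξ'
  have hξ'Y : ξ' ∈ Y := Y.starProjection_apply_mem _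
  have hYcyc' : ∀ y ∈ Y, y ∈ S.cyc N ξ' := by
    intro y hy
    have := cyc_le (S := S) (N := N) (cyc_closed ξ') Y.starProjection hPY (fun b hb => cyc_R ξ' hb)
      (by have := mem_cyc (S := S) (N := N) ξ' (one_mem N); rwa [S.R_one] at this) y (hYcyc y hy)
    rwa [Submodule.starProjection_eq_self_iff.2 hy] at this
  have hξ'0 : ξ' ≠ 0 := by
    intro h0
    have h1 := hYcyc' _ (hYm 1 (one_mem _) _ hκ0)
    rw [S.R_one] at h1
    have h2 : S.Orth N ξ' (S.R (1 - r) κ0) := by rw [h0]; exact orth_zero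
    exact hκne (cyc_orth h2 h1)
  have hbv' : S.Bv N ξ' _ := hn.bv.map hPY
  obtain ⟨q, hq, -⟩ := br_exists hN hn.bv hbv'
  have hqq : S.IsBr N ξ' ξ' q := by
    refine ⟨hq.1, fun b hb => ?_⟩
    rw [← hq.2 b hb, hξ', Submodule.inner_starProjection_left_eq_right, hPY b hb,
      ← hξ', Submodule.starProjection_eq_self_iff.2 hξ'Y]
  have hqs : star q = q := br_unique hqq.symm hqq
  have hrq : r * q = q := hn.br_left hq
  have hξq : ξ' = S.R q ξ := cyc_eq hn (hYcyc _ hξ'Y) hq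
  have hqp : q * q = q := by
    have h1 := (hn.1.mul_right hq.1).mul_left hq.1
    rw [← hξq, hrq, hqs] at h1
    exact br_unique h1 hqq
  have hn' : S.Nrm N ξ' q := ⟨hqq, hqs, hqp⟩
  have hθ : ∀ x, ∃ t, x ∈ P → p * x * p = x → t ∈ N ∧ q * t = t ∧ t * q = t ∧
      S.L x ξ' = S.R t ξ' := by
    intro x
    obtain ⟨t, ht, -⟩ := br_exists hN hn'.bv (hn'.bv.map (ComR.L x))
    refine ⟨t, fun hx hpx => ⟨ht.1, hn'.br_left ht, ?_, ?_⟩⟩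
    · have h1 := ht.mul_right hq.1
      rw [← S.LR, hn'.R_r] at h1
      exact br_unique h1 ht
    · exact cyc_eq hn' (hYcyc' _ (hYL x hx hpx _ hξ'Y)) ht
  choose θ hθ using hθ
  exact ⟨p, hp, hps, hpp, q, ξ', θ, hξ'0, hn', hYp _ hξ'Y, fun x hx hpx => hθ x hx hpx⟩

end StdForm
end bm

section iw
universe a k
variable {A : Type a} [CStarAlgebra A] [PartialOrder A] [StarOrderedRing A]
variable {K : Type k} [NormedAddCommGroup K] [InnerProductSpace ℂ K] [CompleteSpace K]

theorem span_unitary_sub (Q : StarSubalgebra ℂ A) (hQ : IsClosed (Q : Set A)) {x : A} (hx : x ∈ Q) :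
    x ∈ Submodule.span ℂ {u : A | u ∈ Q ∧ star u * u = 1 ∧ u * star u = 1} := by
  haveI : IsClosed (Q : Set A) := hQ
  have h1 : (⟨x, hx⟩ : Q) ∈ Submodule.span ℂ (unitary Q : Set Q) := by
    rw [CStarAlgebra.span_unitary]; trivial
  let f : Q →ₗ[ℂ] A :=
    { toFun := fun x => x.1, map_add' := fun _ _ => rfl, map_smul' := fun _ _ => rfl }
  have h2 := Submodule.mem_map_of_mem (f := f) h1
  rw [Submodule.map_span] at h2
  refine Submodule.span_mono ?_ h2
  rintro _ ⟨u, hu, rfl⟩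
  have hu' := Unitary.mem_iff.1 (show (u : Q) ∈ unitary Q from hu)
  exact ⟨u.2, congrArg Subtype.val hu'.1, congrArg Subtype.val hu'.2⟩

/-- abstract intertwining -/
def ACorner (P N : StarSubalgebra ℂ A) : Prop :=
  ∃ (p q v : A) (θ : A → A), p ∈ P ∧ star p = p ∧ p * p = p ∧ p ≠ 0 ∧
    q ∈ N ∧ star q = q ∧ q * q = q ∧ q ≠ 0 ∧
    (∀ x ∈ P, p * x * p = x → θ x ∈ N ∧ q * θ x * q = θ x) ∧
    (∀ x ∈ P, p * x * p = x → ∀ y ∈ P, p * y * p = y → θ (x + y) = θ x + θ y ∧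
      θ (x * y) = θ x * θ y) ∧
    (∀ x ∈ P, p * x * p = x → (∀ c : ℂ, θ (c • x) = c • θ x) ∧ θ (star x) = star (θ x)) ∧
    v ≠ 0 ∧ star (star v * v) = star v * v ∧ (star v * v) * (star v * v) = star v * v ∧
    q * v * p = v ∧ ∀ x ∈ P, p * x * p = x → θ x * v = v * x

namespace StdForm
variable {S : StdForm A K}
variable {N : StarSubalgebra ℂ A}

/-- minimal 2-norm element -/
theorem min_elt (hT : S.Good ⊤) (Cv : Set A) (hconv : Convex ℝ Cv) (hne : Cv.Nonempty) {C : ℝ}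
    (hC : ∀ x ∈ Cv, ‖x‖ ≤ C) : ∃ (x : ℕ → A) (w : A), (∀ n, x n ∈ Cv) ∧
      Tendsto (fun n => S.hat (x n)) atTop (nhds (S.hat w)) ∧
      ∀ T : K →L[ℂ] K, (∀ x, ‖T x‖ ≤ ‖x‖) →
        (∀ x ∈ Cv, ∃ y ∈ Cv, T (S.hat x) = S.hat y) → T (S.hat w) = S.hat w := by
  set I : ℝ := sInf ((fun x => ‖S.hat x‖ ^ 2) '' Cv) with hI
  have hbdd : BddBelow ((fun x => ‖S.hat x‖ ^ 2) '' Cv) := ⟨0, by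
    rintro _ ⟨x, -, rfl⟩; positivity⟩
  have hIle : ∀ x ∈ Cv, I ≤ ‖S.hat x‖ ^ 2 := fun x hx => csInf_le hbdd ⟨x, hx, rfl⟩
  have hpos : ∀ n : ℕ, (0 : ℝ) < 1 / ((n : ℝ) + 1) := fun n => Nat.one_div_pos_of_nat
  have hex : ∀ n : ℕ, ∃ x ∈ Cv, ‖S.hat x‖ ^ 2 < I + 1 / ((n : ℝ) + 1) := by
    intro n
    obtain ⟨_, ⟨x, hx, rfl⟩, h⟩ := exists_lt_of_csInf_lt (hne.image _)
      (show I < I + 1 / ((n : ℝ) + 1) by linarith [hpos n])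
    exact ⟨x, hx, h⟩
  choose x hx hxI using hex
  have hkey : ∀ y ∈ Cv, ∀ z ∈ Cv, ∀ n m : ℕ, ‖S.hat y‖ ^ 2 ≤ I + 1 / ((n : ℝ) + 1) →
      ‖S.hat z‖ ^ 2 ≤ I + 1 / ((m : ℝ) + 1) →
      ‖S.hat y - S.hat z‖ ^ 2 ≤ 2 * (1 / ((n : ℝ) + 1)) + 2 * (1 / ((m : ℝ) + 1)) := by
    intro y hy z hz n m h1 h2
    have hmid : (1 / 2 : ℝ) • y + (1 / 2 : ℝ) • z ∈ Cv :=
      hconv hy hz (by norm_num) (by norm_num) (by norm_num)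
    have h3 := hIle _ hmid
    have h4 : S.hat ((1 / 2 : ℝ) • y + (1 / 2 : ℝ) • z) = (1 / 2 : ℂ) • (S.hat y + S.hat z) := by
      rw [← smul_add]
      have : (1 / 2 : ℝ) • (y + z) = (1 / 2 : ℂ) • (y + z) := by
        rw [← Complex.coe_smul]; norm_num
      rw [this, map_smul, map_add]
    rw [h4, norm_smul] at h3
    have h5 := parallelogram_law_with_norm ℂ (S.hat y) (S.hat z)
    norm_num at h3
    nlinarith
  have hlim : Tendsto (fun n : ℕ => 1 / ((n : ℝ) + 1)) atTop (nhds 0) :=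
    tendsto_one_div_add_atTop_nhds_zero_nat
  have hcau : CauchySeq fun n => S.hat (x n) := by
    rw [Metric.cauchySeq_iff]
    intro ε hε
    have h1 : ∀ᶠ n : ℕ in atTop, 1 / ((n : ℝ) + 1) < ε ^ 2 / 4 := by
      filter_upwards [hlim.eventually_lt_const (show (0 : ℝ) < ε ^ 2 / 4 by positivity)] with n hn
        using hn
    obtain ⟨n0, hn0⟩ := eventually_atTop.1 h1
    refine ⟨n0, fun m hm n hn => ?_⟩
    rw [dist_eq_norm]
    have := hkey _ (hx m) _ (hx n) m n (hxI m).le (hxI n).le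
    have h2 := hn0 m hm
    have h3 := hn0 n hn
    exact lt_of_pow_lt_pow_left₀ 2 hε.le (by linarith)
  obtain ⟨w, -, -, hw⟩ := hT.complete x C (fun _ => trivial) (fun n => hC _ (hx n)) hcau
  refine ⟨x, w, hx, hw, fun T hT1 hT2 => ?_⟩
  have h3 : Tendsto (fun n => T (S.hat (x n)) - S.hat (x n)) atTop
      (nhds (T (S.hat w) - S.hat w)) := ((T.continuous.tendsto _).comp hw).sub hw
  have h4 : Tendsto (fun n => T (S.hat (x n)) - S.hat (x n)) atTop (nhds 0) := by
    rw [tendsto_zero_iff_norm_tendsto_zero]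
    have h5 : Tendsto (fun n : ℕ => √(4 * (1 / ((n : ℝ) + 1)))) atTop (nhds 0) := by
      have := (hlim.const_mul 4).sqrt
      simpa using this
    refine squeeze_zero (fun _ => norm_nonneg _) (fun n => ?_) h5
    refine Real.le_sqrt_of_sq_le ?_
    obtain ⟨y, hy, hTy⟩ := hT2 _ (hx n)
    rw [hTy]
    have h6 : ‖S.hat y‖ ^ 2 ≤ ‖S.hat (x n)‖ ^ 2 := by
      rw [← hTy]; gcongr; exact hT1 _
    have := hkey _ hy _ (hx n) n n (h6.trans (hxI n).le) (hxI n).le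
    linarith
  exact sub_eq_zero.1 (tendsto_nhds_unique h3 h4)

/-- polar decomposition part -/
theorem polar (hT : S.Good ⊤) {w : A} (hw : w ≠ 0) : ∃ v : A, v ≠ 0 ∧
    (v * star v) * (v * star v) = v * star v ∧ (∀ x, x * w = w → x * v = v) ∧
    ∀ x t, x * w = w * t → star x * w = w * star t → x * v = v * t := by
  have hbr : ∀ w : A, S.IsBr ⊤ (S.hat w) (S.hat w) (star w * w) := fun w =>
    ⟨trivial, fun b _ => by rw [S.R_hat, S.inner_tr, mul_assoc]⟩
  have hw0 : S.hat w ≠ 0 := fun h => hw (S.inj _ h)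
  obtain ⟨c, r, ξ, hc, hξ, hnr, hξ0, -, hcom, hcs, hcn⟩ := normalize hT hw0 (hbr w)
  simp only [S.R_hat] at hξ
  obtain ⟨v, -, -, hv⟩ := hT.complete (fun n => w * c n) 1 (fun _ => trivial) (fun n => by
    have h1 : ‖w * c n‖ * ‖w * c n‖ ≤ 1 := by
      rw [← CStarRing.norm_star_mul_self, star_mul, hcs]
      have : c n * star w * (w * c n) = c n * (star w * w) * c n := by simp only [mul_assoc]
      rw [this]; exact hcn n
    nlinarith [norm_nonneg (w * c n)]) hξ.cauchySeq
  have hvξ : S.hat v = ξ := tendsto_nhds_unique hv hξ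
  rw [← hvξ] at hnr hξ0
  have hvr : star v * v = r := br_unique (hbr v) hnr.1
  have hvr' : v * r = v := by
    have h1 : star (v * r - v) * (v * r - v) = 0 := by
      have hr := hnr.2.2
      have hs := hnr.2.1
      rw [star_sub, star_mul, hs, sub_mul, mul_sub, mul_sub]
      have e1 : r * star v * (v * r) = r := by
        rw [mul_assoc, ← mul_assoc (star v), hvr, ← mul_assoc, hr, hr]
      have e2 : r * star v * v = r := by rw [mul_assoc, hvr, hr]
      have e3 : star v * (v * r) = r := by rw [← mul_assoc, hvr, hr]
      rw [e1, e2, e3, hvr]; simp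
    exact sub_eq_zero.1 (CStarRing.star_mul_self_eq_zero_iff _ |>.1 h1)
  refine ⟨v, fun h => hξ0 (by rw [h, map_zero]), ?_, ?_, ?_⟩
  · have : v * star v * (v * star v) = v * (star v * v) * star v := by simp only [mul_assoc]
    rw [this, hvr, hvr']
  · intro x hx
    refine S.hat_inj (tendsto_nhds_unique ?_ hv)
    have h1 : Tendsto (fun n => S.L x (S.hat (w * c n))) atTop (nhds (S.L x (S.hat v))) :=
      ((S.L x).continuous.tendsto _).comp hv
    simpa only [S.L_hat, ← mul_assoc, hx] using h1
  · intro x t hx hx'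
    have hct : Commute (star w * w) t := by
      have e1 : star w * w * t = star w * x * w := by rw [mul_assoc, ← hx, mul_assoc]
      have e2 : star w * x = t * star w := by
        have := congrArg star hx'
        simpa using this
      change star w * w * t = t * (star w * w)
      rw [e1, e2, mul_assoc]
    have h1 : Tendsto (fun n => S.L x (S.hat (w * c n))) atTop (nhds (S.L x (S.hat v))) :=
      ((S.L x).continuous.tendsto _).comp hv
    have h2 : Tendsto (fun n => S.R t (S.hat (w * c n))) atTop (nhds (S.R t (S.hat v))) :=
      ((S.R t).continuous.tendsto _).comp hv
    have h3 : ∀ n, S.L x (S.hat (w * c n)) = S.R t (S.hat (w * c n)) := fun n => by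
      rw [S.L_hat, S.R_hat, ← mul_assoc, hx, mul_assoc, mul_assoc, ((hcom n t hct).eq)]
    simp only [h3] at h1
    have := tendsto_nhds_unique h1 h2
    rw [S.L_hat, S.R_hat] at this
    exact S.hat_inj this

theorem intertwine (hN : S.Good N) (hT : S.Good ⊤) {P : StarSubalgebra ℂ A}
    (hPc : IsClosed (P : Set A)) {p q : A} (hp : p ∈ P) (hps : star p = p) (hpp : p * p = p)
    {ξ : K} {θ : A → A} (hξ0 : ξ ≠ 0) (hn : S.Nrm N ξ q) (hpξ : S.L p ξ = ξ)
    (hθ : ∀ x ∈ P, p * x * p = x → θ x ∈ N ∧ q * θ x = θ x ∧ θ x * q = θ x ∧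
        S.L x ξ = S.R (θ x) ξ) : ACorner P N := by
  have huniq : ∀ t ∈ N, q * t = t → ∀ t' ∈ N, q * t' = t' → S.R t ξ = S.R t' ξ → t = t' := by
    intro t ht hqt t' ht' hqt' h
    have h1 := hn.1.mul_right ht
    rw [hqt, h] at h1
    have h2 := hn.1.mul_right ht'
    rw [hqt'] at h2
    exact br_unique h1 h2
  have hqN := hn.1.1
  have hθp : θ p = q := by
    obtain ⟨h1, h2, -, h4⟩ := hθ p hp (by rw [hpp, hpp])
    refine huniq _ h1 h2 _ hqN hn.2.2 ?_
    rw [← h4, hpξ, hn.R_r]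
  have hadd : ∀ x ∈ P, p * x * p = x → ∀ y ∈ P, p * y * p = y → θ (x + y) = θ x + θ y := by
    intro x hx hpx y hy hpy
    obtain ⟨h1, h2, -, h4⟩ := hθ x hx hpx
    obtain ⟨k1, k2, -, k4⟩ := hθ y hy hpy
    obtain ⟨l1, l2, -, l4⟩ := hθ (x + y) (add_mem hx hy) (by rw [mul_add, add_mul, hpx, hpy])
    refine huniq _ l1 l2 _ (add_mem h1 k1) (by rw [mul_add, h2, k2]) ?_
    rw [← l4, S.L_add, S.R_add, ContinuousLinearMap.add_apply, ContinuousLinearMap.add_apply, h4, k4]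
  have hcm : ∀ x, p * x * p = x → p * x = x ∧ x * p = x := by
    intro x hx
    constructor
    · nth_rw 1 [← hx]; simp only [← mul_assoc, hpp]; exact hx
    · nth_rw 1 [← hx]; simp only [mul_assoc, hpp]; rw [← mul_assoc]; exact hx
  have hmulc : ∀ x y, p * x * p = x → p * y * p = y → p * (x * y) * p = x * y := by
    intro x y hx hy
    rw [← mul_assoc, (hcm x hx).1, mul_assoc, (hcm y hy).2]
  have hmul : ∀ x ∈ P, p * x * p = x → ∀ y ∈ P, p * y * p = y → θ (x * y) = θ x * θ y := by
    intro x hx hpx y hy hpy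
    obtain ⟨h1, h2, -, h4⟩ := hθ x hx hpx
    obtain ⟨k1, k2, -, k4⟩ := hθ y hy hpy
    obtain ⟨l1, l2, -, l4⟩ := hθ (x * y) (mul_mem hx hy) (hmulc x y hpx hpy)
    refine huniq _ l1 l2 _ (mul_mem h1 k1) (by rw [← mul_assoc, h2]) ?_
    rw [← l4, ← S.L_L, k4, S.LR, h4, S.R_R]
  have hsmul : ∀ x ∈ P, p * x * p = x → ∀ c : ℂ, θ (c • x) = c • θ x := by
    intro x hx hpx c
    obtain ⟨h1, h2, -, h4⟩ := hθ x hx hpx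
    obtain ⟨l1, l2, -, l4⟩ := hθ (c • x) (SMulMemClass.smul_mem c hx)
      (by rw [mul_smul_comm, smul_mul_assoc, hpx])
    refine huniq _ l1 l2 _ (SMulMemClass.smul_mem c h1) (by rw [mul_smul_comm, h2]) ?_
    rw [← l4, S.L_smul, S.R_smul, ContinuousLinearMap.smul_apply, ContinuousLinearMap.smul_apply, h4]
  have hstarc : ∀ x, p * x * p = x → p * star x * p = star x := by
    intro x hx
    have := congrArg star hx
    rwa [star_mul, star_mul, hps, ← mul_assoc] at this
  have hbrθ : ∀ x ∈ P, p * x * p = x → S.IsBr N ξ (S.L x ξ) (θ x) := by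
    intro x hx hpx
    obtain ⟨h1, h2, -, h4⟩ := hθ x hx hpx
    have := hn.1.mul_right h1
    rwa [h2, ← h4] at this
  have hstar : ∀ x ∈ P, p * x * p = x → θ (star x) = star (θ x) := by
    intro x hx hpx
    have h1 := ((ComR.L x).br (hbrθ x hx hpx)).symm
    rw [L_adjoint] at h1
    exact br_unique (hbrθ _ (star_mem hx) (hstarc x hpx)) h1
  -- averaging
  obtain ⟨a, ha⟩ : ∃ a, inner ℂ (S.hat a) ξ ≠ 0 := by
    by_contra hcon
    push Not at hcon
    exact hξ0 (S.ext_inner fun a => by rw [hcon, inner_zero_right])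
  let UD : Set A := {U | (U ∈ P ∧ p * U = U * p) ∧ star U * U = 1 ∧ U * star U = 1}
  have hUp : ∀ U ∈ P, p * U = U * p → (U * p) ∈ P ∧ p * (U * p) * p = U * p := by
    intro U hU hc
    refine ⟨mul_mem hU hp, ?_⟩
    rw [← mul_assoc, hc, mul_assoc, mul_assoc, hpp, hpp]
  let z : A → A := fun U => star (U * p) * a * θ (U * p)
  have hθn : ∀ U ∈ UD, ‖θ (U * p)‖ ≤ 1 ∧ ‖U * p‖ ≤ 1 := by
    rintro U ⟨⟨hU, hc⟩, h1, h2⟩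
    obtain ⟨k1, k2⟩ := hUp U hU hc
    have e : star (U * p) * (U * p) = p := by
      rw [star_mul, hps, mul_assoc, ← mul_assoc (star U), h1, one_mul, hpp]
    constructor
    · have h3 : star (θ (U * p)) * θ (U * p) = q := by
        rw [← hstar _ k1 k2, ← hmul _ (star_mem k1) (hstarc _ k2) _ k1 k2, e, hθp]
      have h4 := CStarRing.norm_star_mul_self (x := θ (U * p))
      rw [h3] at h4
      nlinarith [norm_nonneg (θ (U * p)), proj_norm hn.2.1 hn.2.2]
    · have h4 := CStarRing.norm_star_mul_self (x := U * p)
      rw [e] at h4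
      nlinarith [norm_nonneg (U * p), proj_norm hps hpp]
  obtain ⟨x, w, hx, hxw, hfix⟩ := min_elt hT (convexHull ℝ (z '' UD)) (convex_convexHull _ _)
    (⟨z 1, subset_convexHull _ _ ⟨1, ⟨⟨one_mem _, by simp⟩, by simp, by simp⟩, rfl⟩⟩) (C := ‖a‖) (by
      have : convexHull ℝ (z '' UD) ⊆ Metric.closedBall 0 ‖a‖ := by
        refine convexHull_min ?_ (convex_closedBall _ _)
        rintro _ ⟨U, hU, rfl⟩
        rw [mem_closedBall_zero_iff]
        obtain ⟨h1, h2⟩ := hθn U hU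
        calc ‖star (U * p) * a * θ (U * p)‖ ≤ ‖star (U * p)‖ * ‖a‖ * ‖θ (U * p)‖ :=
              (_root_.norm_mul_le _ _).trans (by gcongr; exact _root_.norm_mul_le _ _)
          _ ≤ 1 * ‖a‖ * 1 := by gcongr; rwa [_root_.norm_star]
          _ = ‖a‖ := by ring
      exact fun x hx => mem_closedBall_zero_iff.1 (this hx))
  have hwU : ∀ U ∈ UD, star (U * p) * w * θ (U * p) = w := by
    intro U hU
    obtain ⟨h1, h2⟩ := hθn U hU
    have := hfix (S.L (star (U * p)) * S.R (θ (U * p))) (fun y => by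
      simp only [ContinuousLinearMap.mul_apply]
      refine (S.norm_L_le _ _).trans ?_
      calc ‖star (U * p)‖ * ‖S.R (θ (U * p)) y‖ ≤ 1 * (1 * ‖y‖) := by
            gcongr
            · rwa [_root_.norm_star]
            · exact (S.norm_R_le _ _).trans (by gcongr)
        _ = ‖y‖ := by ring) (by
      have hsub : convexHull ℝ (z '' UD) ⊆
          {y | star (U * p) * y * θ (U * p) ∈ convexHull ℝ (z '' UD)} := by
        let f : A →ₗ[ℝ] A :=
          { toFun := fun y => star (U * p) * y * θ (U * p)
            map_add' := fun a b => by rw [mul_add, add_mul]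
            map_smul' := fun c b => by
              rw [mul_smul_comm, smul_mul_assoc]; rfl }
        refine convexHull_min ?_ ((convex_convexHull ℝ (z '' UD)).linear_preimage f)
        rintro _ ⟨U', hU', rfl⟩
        refine subset_convexHull _ _ ⟨U' * U, ⟨⟨mul_mem hU'.1.1 hU.1.1, ?_⟩, ?_, ?_⟩, ?_⟩
        · rw [← mul_assoc, hU'.1.2, mul_assoc, hU.1.2, mul_assoc]
        · rw [star_mul, mul_assoc, ← mul_assoc (star U'), hU'.2.1, one_mul, hU.2.1]
        · rw [star_mul, mul_assoc, ← mul_assoc U, hU.2.2, one_mul, hU'.2.2]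
        · obtain ⟨k1, k2⟩ := hUp U hU.1.1 hU.1.2
          obtain ⟨k1', k2'⟩ := hUp U' hU'.1.1 hU'.1.2
          have e : U' * U * p = (U' * p) * (U * p) := by
            rw [mul_assoc U' p, ← mul_assoc p, hU.1.2, mul_assoc U, hpp, mul_assoc]
          change star (U' * U * p) * a * θ (U' * U * p) =
            star (U * p) * (star (U' * p) * a * θ (U' * p)) * θ (U * p)
          rw [e, hmul _ k1' k2' _ k1 k2, star_mul (U' * p)]
          simp only [mul_assoc]
      intro y hy
      refine ⟨_, hsub hy, ?_⟩
      simp only [ContinuousLinearMap.mul_apply]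
      rw [S.R_hat, S.L_hat, mul_assoc])
    simp only [ContinuousLinearMap.mul_apply] at this
    rw [S.R_hat, S.L_hat] at this
    rw [mul_assoc]
    exact S.hat_inj this
  have hw0 : w ≠ 0 := by
    intro h0
    have hsub : convexHull ℝ (z '' UD) ⊆ {y | inner ℂ (S.hat y) ξ = inner ℂ (S.hat a) ξ} := by
      refine convexHull_min ?_ ?_
      · rintro _ ⟨U, hU, rfl⟩
        obtain ⟨k1, k2⟩ := hUp U hU.1.1 hU.1.2
        have e : (U * p) * star (U * p) = p := by
          rw [star_mul, hps, mul_assoc, ← mul_assoc p, hpp, ← mul_assoc, ← hU.1.2, mul_assoc,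
            hU.2.2, mul_one]
        change inner ℂ (S.hat (star (U * p) * a * θ (U * p))) ξ = inner ℂ (S.hat a) ξ
        rw [← S.R_hat, ← S.L_hat, S.R_inner, S.L_inner, star_star, ← hstar _ k1 k2,
          ← (hθ _ (star_mem k1) (hstarc _ k2)).2.2.2, S.L_L, e, hpξ]
      · intro y hy y' hy' α β _ _ hαβ
        simp only [Set.mem_setOf_eq] at *
        have e : S.hat (α • y + β • y') = (α : ℂ) • S.hat y + (β : ℂ) • S.hat y' := by
          rw [← Complex.coe_smul α y, ← Complex.coe_smul β y', map_add, map_smul, map_smul]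
        rw [e, inner_add_left, inner_smul_left, inner_smul_left, hy, hy', ← add_mul,
          Complex.conj_ofReal, Complex.conj_ofReal, ← Complex.ofReal_add, hαβ]
        simp
    have h1 : Tendsto (fun n => inner ℂ (S.hat (x n)) ξ) atTop (nhds (inner ℂ (S.hat w) ξ)) :=
      hxw.inner tendsto_const_nhds
    have h2 : ∀ n, inner ℂ (S.hat (x n)) ξ = inner ℂ (S.hat a) ξ := fun n => hsub (hx n)
    simp only [h2] at h1
    have h3 := tendsto_nhds_unique h1 tendsto_const_nhds
    rw [h0, map_zero, inner_zero_left] at h3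
    exact ha h3.symm
  have h1D : (1 : A) ∈ UD := ⟨⟨one_mem _, by simp⟩, by simp, by simp⟩
  have hpwq : p * w * q = w := by
    have := hwU 1 h1D
    rwa [one_mul, hps, hθp] at this
  have hpw : p * w = w := by rw [← hpwq, ← mul_assoc, ← mul_assoc, hpp]
  have hwUD : ∀ U ∈ UD, (U * p) * w = w * θ (U * p) := by
    intro U hU
    have e : (U * p) * star (U * p) = p := by
      rw [star_mul, hps, mul_assoc, ← mul_assoc p, hpp, ← mul_assoc, ← hU.1.2, mul_assoc,
        hU.2.2, mul_one]
    nth_rw 1 [← hwU U hU]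
    rw [← mul_assoc, ← mul_assoc, e, hpw]
  let Q : StarSubalgebra ℂ A := P ⊓ StarSubalgebra.centralizer ℂ {p}
  have hQm : ∀ x, x ∈ Q ↔ x ∈ P ∧ p * x = x * p := by
    intro x
    simp only [Q, StarSubalgebra.mem_inf, StarSubalgebra.mem_centralizer_iff, Set.mem_singleton_iff,
      forall_eq, hps, and_self]
  have hQc : IsClosed (Q : Set A) := by
    have : (Q : Set A) = (P : Set A) ∩ {x | p * x = x * p} := by
      ext x; exact hQm x
    rw [this]
    exact hPc.inter (isClosed_eq (by fun_prop) (by fun_prop))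
  have hall' : ∀ x ∈ Submodule.span ℂ {u : A | u ∈ Q ∧ star u * u = 1 ∧ u * star u = 1},
      x ∈ Q ∧ (x * p) * w = w * θ (x * p) := by
    intro x hx
    induction hx using Submodule.span_induction with
    | mem u hu => exact ⟨hu.1, hwUD u ⟨(hQm u).1 hu.1, hu.2⟩⟩
    | zero =>
      refine ⟨zero_mem _, ?_⟩
      have := hsmul 0 (zero_mem _) (by simp) 0
      rw [zero_smul, zero_smul] at this
      rw [zero_mul, this]; simp
    | add u u' _ _ h h' =>
      obtain ⟨k1, k2⟩ := hUp u ((hQm u).1 h.1).1 ((hQm u).1 h.1).2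
      obtain ⟨l1, l2⟩ := hUp u' ((hQm u').1 h'.1).1 ((hQm u').1 h'.1).2
      refine ⟨add_mem h.1 h'.1, ?_⟩
      rw [add_mul, add_mul, hadd _ k1 k2 _ l1 l2, h.2, h'.2, mul_add]
    | smul c u _ h =>
      obtain ⟨k1, k2⟩ := hUp u ((hQm u).1 h.1).1 ((hQm u).1 h.1).2
      refine ⟨SMulMemClass.smul_mem c h.1, ?_⟩
      rw [smul_mul_assoc, smul_mul_assoc, hsmul _ k1 k2, h.2, mul_smul_comm]
  have hall : ∀ x ∈ P, p * x * p = x → x * w = w * θ x := by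
    intro x hx hpx
    have h1 : x ∈ Q := (hQm x).2 ⟨hx, by rw [(hcm x hpx).1, (hcm x hpx).2]⟩
    have := (hall' x (span_unitary_sub Q hQc h1)).2
    rwa [(hcm x hpx).2] at this
  obtain ⟨v, hv0, hvv, hv1, hv2⟩ := polar hT hw0
  have hv : ∀ x ∈ P, p * x * p = x → x * v = v * θ x := fun x hx hpx =>
    hv2 x (θ x) (hall x hx hpx) (by rw [hall _ (star_mem hx) (hstarc x hpx), hstar x hx hpx])
  have hpv : p * v = v := hv1 p hpw
  have hvq : v * q = v := by
    rw [← hθp, ← hv p hp (by rw [hpp, hpp]), hpv]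
  refine ⟨p, q, star v, θ, hp, hps, hpp, ?_, hqN, hn.2.1, hn.2.2, ?_, ?_, ?_, ?_, ?_, ?_, ?_, ?_, ?_⟩
  · rintro rfl
    exact hv0 (by rw [← hpv, zero_mul])
  · rintro rfl
    exact hv0 (by rw [← hvq, mul_zero])
  · intro x hx hpx
    obtain ⟨h1, h2, h3, -⟩ := hθ x hx hpx
    exact ⟨h1, by rw [h2, h3]⟩
  · exact fun x hx hpx y hy hpy => ⟨hadd x hx hpx y hy hpy, hmul x hx hpx y hy hpy⟩
  · exact fun x hx hpx => ⟨hsmul x hx hpx, hstar x hx hpx⟩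
  · exact star_ne_zero.2 hv0
  · simp
  · rw [star_star]; exact hvv
  · have h1 := congrArg star hvq
    have h2 := congrArg star hpv
    rw [star_mul, hn.2.1] at h1
    rw [star_mul, hps] at h2
    rw [h1, h2]
  · intro x hx hpx
    have := congrArg star (hv _ (star_mem hx) (hstarc x hpx))
    rw [star_mul, star_mul, star_star, hstar x hx hpx, star_star] at this
    exact this.symm

/-- Popa's dichotomy -/
theorem dichotomy (hN : S.Good N) (hT : S.Good ⊤) {P : StarSubalgebra ℂ A}
    (hPc : IsClosed (P : Set A)) (hmu : ManyUnits P) (hno : ¬ ACorner P N) (F : Finset A) {ε : ℝ}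
    (hε : 0 < ε) : ∃ u ∈ P, star u * u = 1 ∧ u * star u = 1 ∧
      ∀ x ∈ F, ∀ y ∈ F, ∀ b ∈ N, ‖S.tr (star b * (x * u * y))‖ ≤ ε * ‖S.hat b‖ := by
  by_contra hcon
  apply hno
  obtain ⟨V, C, hVc, hV0, hVR, hVL, hC⟩ := exists_V (S := S) hN P F (ε := ε ^ 2) (by positivity) (by
    intro u hu h1 h2
    by_contra hlt
    push Not at hlt
    apply hcon
    refine ⟨u, hu, h1, h2, fun x hx y hy b hb => ?_⟩
    have h3 : ‖S.eN N (S.hat (x * u * y))‖ ^ 2 ≤ ε ^ 2 := by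
      refine le_trans ?_ hlt.le
      refine le_trans ?_ (Finset.single_le_sum (f := fun y => ∑ x ∈ F, ‖S.eN N (S.hat (x * u * y))‖ ^ 2)
        (fun _ _ => Finset.sum_nonneg fun _ _ => by positivity) hy)
      exact Finset.single_le_sum (f := fun x => ‖S.eN N (S.hat (x * u * y))‖ ^ 2)
        (fun _ _ => by positivity) hx
    have h4 : ‖S.eN N (S.hat (x * u * y))‖ ≤ ε := le_of_sq_le_sq h3 hε.le
    have h5 : S.eN N (S.hat b) = S.hat b := Submodule.starProjection_eq_self_iff.2 (hat_mem_cl hb)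
    rw [← S.inner_tr, ← h5, eN_inner]
    refine (norm_inner_le_norm _ _).trans ?_
    rw [h5, mul_comm]
    gcongr)
  obtain ⟨p, hp, hps, hpp, q, ξ, θ, hξ0, hn, hpξ, hθ⟩ := bimod hN hmu hVc hV0 hVR (fun x hx => by
    have h1 := span_unitary_sub P hPc hx
    clear hx
    induction h1 using Submodule.span_induction with
    | mem u hu => exact hVL u hu.1 hu.2.1 hu.2.2
    | zero => intro y hy; rw [S.L_zero]; exact zero_mem _
    | add u u' _ _ h h' => intro y hy; rw [S.L_add]; exact add_mem (h y hy) (h' y hy)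
    | smul c u _ h => intro y hy; rw [S.L_smul]; exact Submodule.smul_mem _ c (h y hy)) hC
  exact intertwine hN hT hPc hp hps hpp hξ0 hn hpξ hθ

end StdForm
end iw

section vn
universe k
variable {H : Type k} [NormedAddCommGroup H] [InnerProductSpace ℂ H] [CompleteSpace H]

theorem op_nonneg (T : Op H) : 0 ≤ T ↔ ∀ x, 0 ≤ inner ℂ (T x) x := by
  rw [ContinuousLinearMap.nonneg_iff_isPositive]
  refine ⟨fun h x => h.inner_nonneg_left x, fun h => ?_⟩
  rw [ContinuousLinearMap.isPositive_iff_complex]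
  intro x
  have := Complex.nonneg_iff.1 (h x)
  exact ⟨Complex.ext (by simp) (by simpa using this.2), this.1⟩

theorem op_le (S T : Op H) : S ≤ T ↔ ∀ x, inner ℂ (S x) x ≤ inner ℂ (T x) x := by
  rw [← sub_nonneg, op_nonneg]
  simp [inner_sub_left]

theorem op_le_one_sq {d : Op H} (h0 : 0 ≤ d) (h1 : d ≤ 1) (ξ : H) :
    ‖d ξ‖ ^ 2 ≤ (inner ℂ (d ξ) ξ).re := by
  have h2 := CStarAlgebra.pow_antitone h0 h1 (show 1 ≤ 2 by norm_num)
  simp only [pow_one, pow_two] at h2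
  have h3 := (op_le _ _).1 h2 ξ
  have hsa : star d = d := (IsSelfAdjoint.of_nonneg h0).star_eq
  have h4 : inner ℂ ((d * d) ξ) ξ = ((‖d ξ‖ ^ 2 : ℝ) : ℂ) := by
    rw [ContinuousLinearMap.mul_apply]
    conv_lhs => rw [← hsa, ContinuousLinearMap.star_eq_adjoint,
      ContinuousLinearMap.adjoint_inner_left, ← ContinuousLinearMap.star_eq_adjoint, hsa]
    rw [inner_self_eq_norm_sq_to_K]; simp
  rw [h4] at h3
  exact (Complex.le_def.1 h3).1

theorem mono_strong (c : ℕ → Op H) (hanti : Antitone c) (h0 : ∀ n, 0 ≤ c n) (h1 : ∀ n, c n ≤ 1) :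
    ∃ e : Op H, ∀ ξ, Tendsto (fun n => c n ξ) atTop (nhds (e ξ)) := by
  have hex : ∀ ξ, ∃ y, Tendsto (fun n => c n ξ) atTop (nhds y) := by
    intro ξ
    refine cauchySeq_tendsto_of_complete ?_
    have hg : Antitone fun n => (inner ℂ (c n ξ) ξ).re := fun n m h =>
      (Complex.le_def.1 ((op_le _ _).1 (hanti h) ξ)).1
    have hg0 : BddBelow (Set.range fun n => (inner ℂ (c n ξ) ξ).re) :=
      ⟨0, by rintro _ ⟨n, rfl⟩; exact (Complex.nonneg_iff.1 ((op_nonneg _).1 (h0 n) ξ)).1⟩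
    have hc := (tendsto_atTop_ciInf hg hg0).cauchySeq
    rw [Metric.cauchySeq_iff'] at hc ⊢
    intro ε hε
    obtain ⟨N, hN⟩ := hc (ε ^ 2) (by positivity)
    refine ⟨N, fun n hn => ?_⟩
    have h2 := hN n hn
    have h3 := op_le_one_sq (d := c N - c n) (sub_nonneg.2 (hanti hn))
      ((sub_le_self _ (h0 n)).trans (h1 N)) ξ
    rw [ContinuousLinearMap.sub_apply, inner_sub_left, Complex.sub_re] at h3
    rw [Real.dist_eq, abs_sub_comm] at h2
    rw [dist_comm, dist_eq_norm]
    have := lt_of_abs_lt h2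
    exact lt_of_pow_lt_pow_left₀ 2 hε.le (by linarith)
  choose f hf using hex
  exact ⟨continuousLinearMapOfTendsto c (tendsto_pi_nhds.2 hf), hf⟩

theorem le_strong {c : ℕ → Op H} {e a : Op H} (he : ∀ ξ, Tendsto (fun n => c n ξ) atTop (nhds (e ξ)))
    (h : ∀ n, a ≤ c n) : a ≤ e := by
  rw [op_le]
  intro x
  exact ge_of_tendsto' ((he x).inner tendsto_const_nhds) fun n => (op_le _ _).1 (h n) x

theorem strong_le {c : ℕ → Op H} {e a : Op H} (he : ∀ ξ, Tendsto (fun n => c n ξ) atTop (nhds (e ξ)))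
    (h : ∀ n, c n ≤ a) : e ≤ a := by
  rw [op_le]
  intro x
  exact le_of_tendsto' ((he x).inner tendsto_const_nhds) fun n => (op_le _ _).1 (h n) x

theorem vn_mem (S : VonNeumannAlgebra H) (x : Op H) (h : ∀ T ∈ S.commutant, T * x = x * T) : x ∈ S := by
  rw [← S.commutant_commutant, VonNeumannAlgebra.mem_commutant_iff]
  exact h

theorem vn_comm {S : VonNeumannAlgebra H} {T x : Op H} (hT : T ∈ S.commutant) (hx : x ∈ S) :
    T * x = x * T := (VonNeumannAlgebra.mem_commutant_iff.1 hT x hx).symm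

theorem vn_smul {S : VonNeumannAlgebra H} {x : Op H} (c : ℂ) (hx : x ∈ S) : c • x ∈ S :=
  (S.toStarSubalgebra.smul_mem hx c : _)

theorem strong_mem (S : VonNeumannAlgebra H) {c : ℕ → Op H} {e : Op H}
    (he : ∀ ξ, Tendsto (fun n => c n ξ) atTop (nhds (e ξ))) (h : ∀ n, c n ∈ S) : e ∈ S := by
  refine vn_mem S e fun T hT => ?_
  ext ξ
  have h1 : Tendsto (fun n => T (c n ξ)) atTop (nhds (T (e ξ))) :=
    (T.continuous.tendsto _).comp (he ξ)
  have h2 : ∀ n, T (c n ξ) = c n (T ξ) := fun n => by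
    have := congrArg (fun f : Op H => f ξ) (vn_comm hT (h n)); simpa using this
  simp only [h2] at h1
  exact tendsto_nhds_unique h1 (he _)

theorem vn_closed (S : VonNeumannAlgebra H) : IsClosed (S : Set (Op H)) := by
  rw [← S.centralizer_centralizer]
  exact Set.isClosed_centralizer _

theorem vn_sqrt {S : VonNeumannAlgebra H} {a : Op H} (ha : a ∈ S) (h0 : 0 ≤ a) :
    ∃ b ∈ S, star b = b ∧ b * b = a := by
  have hs : star (CFC.sqrt a) = CFC.sqrt a := (IsSelfAdjoint.of_nonneg (CFC.sqrt_nonneg a)).star_eq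
  refine ⟨CFC.sqrt a, vn_mem S _ fun T hT => ?_, hs, CFC.sqrt_mul_sqrt_self a h0⟩
  have h1 : Commute a T := (vn_comm hT ha).symm
  exact (h1.cfcₙ_nnreal NNReal.sqrt).symm.eq

end vn

section ul
universe k
variable {H : Type k} [NormedAddCommGroup H] [InnerProductSpace ℂ H] [CompleteSpace H]
variable {ω : Ultrafilter ℕ} {M Mω : VonNeumannAlgebra H} {τ : Op H →ₗ[ℂ] ℂ}
  {limω : (ℕ → Op H) → Op H}

theorem Bdd.smul {x : ℕ → Op H} (h : Bdd x) (c : ℂ) : Bdd (fun n => c • x n) := by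
  obtain ⟨C, hC⟩ := h
  exact ⟨‖c‖ * C, fun n => by rw [norm_smul]; gcongr; exact hC n⟩

theorem Bdd.add {x y : ℕ → Op H} (h : Bdd x) (h' : Bdd y) : Bdd (fun n => x n + y n) := by
  obtain ⟨C, hC⟩ := h
  obtain ⟨C', hC'⟩ := h'
  exact ⟨C + C', fun n => (norm_add_le _ _).trans (add_le_add (hC n) (hC' n))⟩

theorem Bdd.mul {x y : ℕ → Op H} (h : Bdd x) (h' : Bdd y) : Bdd (fun n => x n * y n) := by
  obtain ⟨C, hC⟩ := h
  obtain ⟨C', hC'⟩ := h'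
  exact ⟨C * C', fun n => (norm_mul_le _ _).trans
    (mul_le_mul (hC n) (hC' n) (norm_nonneg _) ((norm_nonneg _).trans (hC n)))⟩

theorem Bdd.star {x : ℕ → Op H} (h : Bdd x) : Bdd (fun n => star (x n)) := by
  obtain ⟨C, hC⟩ := h
  exact ⟨C, fun n => by rw [norm_star]; exact hC n⟩

theorem Bdd.sub {x y : ℕ → Op H} (h : Bdd x) (h' : Bdd y) : Bdd (fun n => x n - y n) := by
  obtain ⟨C, hC⟩ := h
  obtain ⟨C', hC'⟩ := h'
  exact ⟨C + C', fun n => (norm_sub_le _ _).trans (add_le_add (hC n) (hC' n))⟩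

theorem Bdd.const (a : Op H) : Bdd (fun _ => a) := ⟨‖a‖, fun _ => le_rfl⟩

theorem lim_sub (hU : IsTracialUltrapower ω M Mω τ limω) {x y : ℕ → Op H}
    (hx : SeqIn (M : Set (Op H)) x) (bx : Bdd x) (hy : SeqIn (M : Set (Op H)) y) (b_y : Bdd y) :
    limω (fun n => x n - y n) = limω x - limω y := by
  have h1 := hU.map_add x (fun n => (-1 : ℂ) • y n) hx bx (fun n => vn_smul _ (hy n)) (b_y.smul _)
  rw [hU.map_smul _ _ hy b_y] at h1
  simpa [sub_eq_add_neg] using h1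

theorem lim_congr (hU : IsTracialUltrapower ω M Mω τ limω) {x y : ℕ → Op H}
    (hx : SeqIn (M : Set (Op H)) x) (bx : Bdd x) (hy : SeqIn (M : Set (Op H)) y) (b_y : Bdd y)
    (h : ∀ᶠ n in (ω : Filter ℕ), x n = y n) : limω x = limω y := by
  rw [← sub_eq_zero, ← lim_sub hU hx bx hy b_y, hU.eq_zero _ (fun n => sub_mem (hx n) (hy n)) ?_]
  · refine tendsto_const_nhds.congr' ?_
    filter_upwards [h] with n hn
    simp [hn]
  · exact bx.sub b_y

theorem lim_nonneg (hU : IsTracialUltrapower ω M Mω τ limω) {x : ℕ → Op H}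
    (hx : SeqIn (M : Set (Op H)) x) (bx : Bdd x) (h : ∀ᶠ n in (ω : Filter ℕ), 0 ≤ x n) :
    0 ≤ limω x := by
  classical
  let x' : ℕ → Op H := fun n => if 0 ≤ x n then x n else 0
  have hx' : SeqIn (M : Set (Op H)) x' := fun n => by
    simp only [x']; split_ifs; exacts [hx n, zero_mem M]
  have bx' : Bdd x' := by
    obtain ⟨C, hC⟩ := bx
    refine ⟨C, fun n => ?_⟩
    simp only [x']; split_ifs
    · exact hC n
    · rw [norm_zero]; exact (norm_nonneg _).trans (hC n)
  have h0 : ∀ n, 0 ≤ x' n := fun n => by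
    simp only [x']; split_ifs with h; exacts [h, le_rfl]
  rw [lim_congr hU hx bx hx' bx' (by filter_upwards [h] with n hn; simp [x', hn])]
  choose b hb hbs hbb using fun n => vn_sqrt (hx' n) (h0 n)
  have bb : Bdd b := by
    obtain ⟨C, hC⟩ := bx'
    refine ⟨C + 1, fun n => ?_⟩
    have h1 := CStarRing.norm_star_mul_self (x := b n)
    rw [hbs, hbb] at h1
    nlinarith [norm_nonneg (b n), hC n]
  have e : x' = fun n => star (b n) * b n := funext fun n => by rw [hbs, hbb]
  rw [e, hU.map_mul _ _ (fun n => star_mem (hb n)) bb.star hb bb, hU.map_star _ hb bb]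
  exact star_mul_self_nonneg _

theorem lim_norm (hU : IsTracialUltrapower ω M Mω τ limω) {x : ℕ → Op H}
    (hx : SeqIn (M : Set (Op H)) x) {C : ℝ} (hC : ∀ n, ‖x n‖ ≤ C) : ‖limω x‖ ≤ C := by
  have bx : Bdd x := ⟨C, hC⟩
  have hC0 : 0 ≤ C := (norm_nonneg _).trans (hC 0)
  have e1 : (algebraMap ℝ (Op H) (C ^ 2)) = ((C ^ 2 : ℝ) : ℂ) • (1 : Op H) := by
    rw [Algebra.algebraMap_eq_smul_one, Complex.coe_smul]
  have hm : algebraMap ℝ (Op H) (C ^ 2) ∈ M := by rw [e1]; exact vn_smul _ (one_mem _)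
  have h1 := lim_nonneg hU (x := fun n => algebraMap ℝ (Op H) (C ^ 2) - star (x n) * x n)
    (fun n => sub_mem hm (mul_mem (star_mem (hx n)) (hx n)))
    ((Bdd.const _).sub (bx.star.mul bx))
    (Eventually.of_forall fun n => by
      rw [sub_nonneg, ← CStarAlgebra.norm_le_iff_le_algebraMap _ (by positivity) (star_mul_self_nonneg _),
        CStarRing.norm_star_mul_self, ← pow_two]
      have := hC n
      gcongr)
  rw [lim_sub hU (fun _ => hm) (Bdd.const _) (fun n => mul_mem (star_mem (hx n)) (hx n)) (bx.star.mul bx),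
    hU.diag _ hm, hU.map_mul _ _ (fun n => star_mem (hx n)) bx.star hx bx, hU.map_star _ hx bx, sub_nonneg,
    ← CStarAlgebra.norm_le_iff_le_algebraMap _ (by positivity) (star_mul_self_nonneg _),
        CStarRing.norm_star_mul_self, ← pow_two] at h1
  exact le_of_sq_le_sq h1 hC0

theorem tau_nonneg (hU : IsTracialUltrapower ω M Mω τ limω) {a : Op H} (ha : a ∈ Mω) (h0 : 0 ≤ a) :
    0 ≤ τ a := by
  obtain ⟨b, hb, hs, hbb⟩ := vn_sqrt ha h0
  have := hU.traceState.pos b hb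
  rwa [hs, hbb] at this

theorem tau_mono (hU : IsTracialUltrapower ω M Mω τ limω) {a b : Op H} (ha : a ∈ Mω) (hb : b ∈ Mω)
    (h0 : a ≤ b) : (τ a).re ≤ (τ b).re := by
  have := tau_nonneg hU (sub_mem hb ha) (sub_nonneg.2 h0)
  rw [map_sub, sub_nonneg] at this
  exact (Complex.le_def.1 this).1

theorem tau_zero (hU : IsTracialUltrapower ω M Mω τ limω) {a : Op H} (ha : a ∈ Mω) (h0 : 0 ≤ a)
    (h : (τ a).re ≤ 0) : a = 0 := by
  have h1 := Complex.nonneg_iff.1 (tau_nonneg hU ha h0)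
  have h2 : τ a = 0 := Complex.ext (le_antisymm h h1.1) h1.2.symm
  obtain ⟨b, hb, hs, hbb⟩ := vn_sqrt ha h0
  have := hU.traceState.faithful b hb (by rw [hs, hbb, h2])
  rw [← hbb, this, mul_zero]

theorem free_atTop (hω : IsFreeUltrafilter ω) : (ω : Filter ℕ) ≤ atTop := by
  rw [← Nat.cofinite_eq_atTop, le_cofinite_iff_compl_singleton_mem]
  intro x
  exact (Ultrafilter.compl_mem_iff_notMem).2 (hω {x} (Set.finite_singleton x))

/-- `limω` of a bounded antitone sequence is its strong limit. -/
theorem lim_antitone (hω : IsFreeUltrafilter ω) (hU : IsTracialUltrapower ω M Mω τ limω)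
    {c : ℕ → Op H} (hc : ∀ n, c n ∈ M) (hanti : Antitone c) (h0 : ∀ n, 0 ≤ c n)
    (h1 : ∀ n, c n ≤ 1) : ∃ e : Op H, (∀ ξ, Tendsto (fun n => c n ξ) atTop (nhds (e ξ))) ∧
      limω c = e ∧ Tendsto (fun n => τ (c n)) (ω : Filter ℕ) (nhds (τ e)) := by
  obtain ⟨e, he⟩ := mono_strong c hanti h0 h1
  have heM := strong_mem M he hc
  have bc : Bdd c := ⟨1, fun n => (CStarAlgebra.norm_le_one_iff_of_nonneg _ (h0 n)).2 (h1 n)⟩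
  have hle : ∀ n, e ≤ c n := fun n => by
    rw [op_le]; intro ξ
    refine le_of_tendsto ((he ξ).inner tendsto_const_nhds) ?_
    filter_upwards [eventually_ge_atTop n] with m hm
    exact (op_le _ _).1 (hanti hm) ξ
  have k1 : e ≤ limω c := by
    have := lim_nonneg hU (x := fun n => c n - e) (fun n => sub_mem (hc n) heM) (bc.sub (Bdd.const e))
      (Eventually.of_forall fun n => sub_nonneg.2 (hle n))
    rwa [lim_sub hU hc bc (fun _ => heM) (Bdd.const e), hU.diag _ heM, sub_nonneg] at this
  have k2 : limω c ≤ e := by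
    refine le_strong he fun m => ?_
    have := lim_nonneg hU (x := fun n => c m - c n) (fun n => sub_mem (hc m) (hc n))
      ((Bdd.const _).sub bc) (by
        filter_upwards [free_atTop hω (eventually_ge_atTop m)] with n hn
        exact sub_nonneg.2 (hanti hn))
    rwa [lim_sub hU (fun _ => hc m) (Bdd.const _) hc bc, hU.diag _ (hc m), sub_nonneg] at this
  have k3 : limω c = e := le_antisymm k2 k1
  exact ⟨e, he, k3, by rw [← k3]; exact hU.tr c hc bc⟩

end ul

section co
universe k
variable {H : Type k} [NormedAddCommGroup H] [InnerProductSpace ℂ H] [CompleteSpace H]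
variable {ω : Ultrafilter ℕ} {M Mω : VonNeumannAlgebra H} {τ : Op H →ₗ[ℂ] ℂ}
  {limω : (ℕ → Op H) → Op H}

theorem inv_facts {D : Op H} (hD : 1 ≤ D) : Ring.inverse D * D = 1 ∧ D * Ring.inverse D = 1 ∧
    0 ≤ Ring.inverse D ∧ Ring.inverse D ≤ 1 ∧ 1 - Ring.inverse D ≤ D - 1 := by
  have hu : IsUnit D := CStarAlgebra.isUnit_of_le 1 hD
  have h1 := Ring.inverse_mul_cancel D hu
  have h2 := Ring.mul_inverse_cancel D hu
  have h0 : 0 ≤ D := zero_le_one.trans hD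
  have hDs : star D = D := (IsSelfAdjoint.of_nonneg h0).star_eq
  have hcs : star (Ring.inverse D) = Ring.inverse D := by
    have := congrArg star h1
    rw [star_mul, hDs, star_one] at this
    calc star (Ring.inverse D) = (Ring.inverse D * D) * star (Ring.inverse D) := by rw [h1, one_mul]
      _ = _ := by rw [mul_assoc, this, mul_one]
  have h3 : 0 ≤ Ring.inverse D := by
    have := star_left_conjugate_nonneg h0 (Ring.inverse D)
    rwa [hcs, h1, one_mul] at this
  refine ⟨h1, h2, h3, ?_, ?_⟩
  · have := CStarAlgebra.ringInverse_le_ringInverse hD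
    simpa using this
  · have := star_left_conjugate_nonneg h3 (D - 1)
    rw [star_sub, hDs, star_one] at this
    have e : (D - 1) * Ring.inverse D * (D - 1) = (D - 1) - (1 - Ring.inverse D) := by
      rw [sub_mul, h2, one_mul, mul_sub, sub_mul, sub_mul, h1, mul_one, mul_one, one_mul]
    rw [e] at this
    exact sub_nonneg.1 this

theorem inv_mem {S : VonNeumannAlgebra H} {D : Op H} (hD : 1 ≤ D) (h : D ∈ S) : Ring.inverse D ∈ S := by
  obtain ⟨h1, h2, -⟩ := inv_facts hD
  refine vn_mem S _ fun T hT => ?_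
  have h3 := vn_comm hT h
  calc T * Ring.inverse D = Ring.inverse D * (D * T) * Ring.inverse D := by
        rw [← mul_assoc (Ring.inverse D), h1, one_mul]
    _ = Ring.inverse D * T := by rw [← h3, mul_assoc, mul_assoc, h2, mul_one]

theorem inv_bound {D d : Op H} (hD : 1 ≤ D) {r : ℝ} (hr : 0 < r) (h : (r : ℂ) • (star d * d) ≤ D) (ξ : H) :
    r * ‖d (Ring.inverse D ξ)‖ ^ 2 ≤ ‖ξ‖ ^ 2 := by
  obtain ⟨h1, h2, h3, h4, -⟩ := inv_facts hD
  set η := Ring.inverse D ξ with hη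
  have k1 := (Complex.le_def.1 ((op_le _ _).1 h η)).1
  have k2 : inner ℂ (((r : ℂ) • (star d * d)) η) η = ((r * ‖d η‖ ^ 2 : ℝ) : ℂ) := by
    rw [ContinuousLinearMap.smul_apply, inner_smul_left, ContinuousLinearMap.mul_apply,
      ContinuousLinearMap.star_eq_adjoint, ContinuousLinearMap.adjoint_inner_left,
      inner_self_eq_norm_sq_to_K]
    simp
  have k3 : D η = ξ := by
    have := congrArg (fun f : Op H => f ξ) h2
    simpa using this
  have k4 : ‖η‖ ≤ ‖ξ‖ := by
    have := (Ring.inverse D).le_opNorm ξ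
    have h5 := (CStarAlgebra.norm_le_one_iff_of_nonneg _ h3).2 h4
    nlinarith [norm_nonneg ξ]
  rw [k2, k3, Complex.ofReal_re] at k1
  calc _ ≤ _ := k1
    _ ≤ ‖inner ℂ ξ η‖ := Complex.re_le_norm _
    _ ≤ ‖ξ‖ * ‖η‖ := norm_inner_le_norm _ _
    _ ≤ ‖ξ‖ ^ 2 := by nlinarith [norm_nonneg ξ]

theorem core (hω : IsFreeUltrafilter ω) (hU : IsTracialUltrapower ω M Mω τ limω)
    {S : VonNeumannAlgebra H} (hSM : (S : Set (Op H)) ⊆ (M : Set (Op H)))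
    {x : ℕ → Op H} (hx : ∀ k, x k ∈ S) {C : ℝ} (hC : ∀ k, ‖x k‖ ≤ C)
    (hc : ∀ k l, k ≤ l → (τ (star (x l - x k) * (x l - x k))).re ≤ (1 / 16) ^ k) :
    ∃ y ∈ S, ‖y‖ ≤ C ∧ ∀ k, (τ (star (y - x k) * (y - x k))).re ≤ (1 / 16) ^ k := by
  have hxM : SeqIn (M : Set (Op H)) x := fun k => hSM (hx k)
  have bx : Bdd x := ⟨C, hC⟩
  have sMω : ∀ {a}, a ∈ S → a ∈ Mω := fun h => hU.subset (hSM h)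
  refine ⟨limω x, ?_, lim_norm hU hxM hC, fun k => ?_⟩
  swap
  · have bk : Bdd (fun n => x n - x k) := bx.sub (Bdd.const _)
    have mk : SeqIn (M : Set (Op H)) (fun n => x n - x k) := fun n => sub_mem (hxM n) (hxM k)
    have h1 := hU.tr (fun n => star (x n - x k) * (x n - x k))
      (fun n => mul_mem (star_mem (mk n)) (mk n)) (bk.star.mul bk)
    rw [hU.map_mul _ _ (fun n => star_mem (mk n)) bk.star mk bk, hU.map_star _ mk bk,
      lim_sub hU hxM bx (fun _ => hxM k) (Bdd.const _), hU.diag _ (hxM k)] at h1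
    refine le_of_tendsto ((Complex.continuous_re.tendsto _).comp h1) ?_
    filter_upwards [free_atTop hω (eventually_ge_atTop k)] with n hn
    exact hc k n hn
  let d : ℕ → Op H := fun k => x (k + 1) - x k
  have hd : ∀ k, d k ∈ S := fun k => sub_mem (hx _) (hx _)
  let h : ℕ → Op H := fun k => ((4 ^ k : ℝ) : ℂ) • (star (d k) * d k)
  have hh : ∀ k, h k ∈ S := fun k => vn_smul _ (mul_mem (star_mem (hd k)) (hd k))
  have hh0 : ∀ k, 0 ≤ h k := fun k => by
    simp only [h]; rw [Complex.coe_smul]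
    exact smul_nonneg (by positivity) (star_mul_self_nonneg _)
  let D : ℕ → ℕ → Op H := fun m n => 1 + ∑ k ∈ Finset.Ico m n, h k
  have hD1 : ∀ m n, 1 ≤ D m n := fun m n => le_add_of_nonneg_right (Finset.sum_nonneg fun k _ => hh0 k)
  have hDm : ∀ m n, D m n ∈ S := fun m n => add_mem (one_mem _) (sum_mem fun k _ => hh k)
  have hDle : ∀ {m n m' n'}, m' ≤ m → n ≤ n' → D m n ≤ D m' n' := fun {m n m' n'} h1 h2 => by
    refine add_le_add_right (Finset.sum_le_sum_of_subset_of_nonneg (Finset.Ico_subset_Ico h1 h2)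
      fun k _ _ => hh0 k) _
  let c : ℕ → ℕ → Op H := fun m n => Ring.inverse (D m n)
  have hcm : ∀ m n, c m n ∈ S := fun m n => inv_mem (hD1 m n) (hDm m n)
  have hcle : ∀ {m n m' n'}, m' ≤ m → n ≤ n' → c m' n' ≤ c m n := fun {m n m' n'} h1 h2 =>
    CStarAlgebra.ringInverse_le_ringInverse (hDle h1 h2)
      (IsStrictlyPositive.of_le (a := 1) (by simp) (hD1 _ _))
  have hex := fun m => lim_antitone hω hU (c := c m) (fun n => hSM (hcm m n)) (fun n n' h => hcle le_rfl h)
    (fun n => (inv_facts (hD1 m n)).2.2.1) (fun n => (inv_facts (hD1 m n)).2.2.2.1)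
  choose e he hel het using hex
  have heS : ∀ m, e m ∈ S := fun m => strong_mem S (he m) (hcm m)
  have he0 : ∀ m, 0 ≤ e m := fun m => le_strong (he m) fun n => (inv_facts (hD1 m n)).2.2.1
  have he1 : ∀ m, e m ≤ 1 := fun m => strong_le (he m) fun n => (inv_facts (hD1 m n)).2.2.2.1
  have hemono : ∀ m m', m ≤ m' → e m ≤ e m' := by
    intro m m' hmm
    rw [op_le]
    intro ξ
    exact le_of_tendsto_of_tendsto' ((he m ξ).inner tendsto_const_nhds)
      ((he m' ξ).inner tendsto_const_nhds) fun n => (op_le _ _).1 (hcle hmm le_rfl) ξ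
  have htr : ∀ m, (τ (1 - e m)).re ≤ 2 * (1 / 4) ^ m := by
    intro m
    have h1 : Tendsto (fun n => (τ (1 - c m n)).re) (ω : Filter ℕ) (nhds (τ (1 - e m)).re) := by
      simp only [map_sub, Complex.sub_re]
      exact tendsto_const_nhds.sub ((Complex.continuous_re.tendsto _).comp (het m))
    refine le_of_tendsto' h1 fun n => ?_
    have h2 := tau_mono hU (sub_mem (one_mem _) (sMω (hcm m n))) (sub_mem (sMω (hDm m n)) (one_mem _))
      (inv_facts (hD1 m n)).2.2.2.2
    refine h2.trans ?_
    have h3 : D m n - 1 = ∑ k ∈ Finset.Ico m n, h k := by simp only [D]; abel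
    rw [h3, map_sum, Complex.re_sum]
    calc ∑ k ∈ Finset.Ico m n, (τ (h k)).re ≤ ∑ k ∈ Finset.Ico m n, (1 / 4 : ℝ) ^ k := by
          refine Finset.sum_le_sum fun k _ => ?_
          simp only [h]
          rw [map_smul, smul_eq_mul, Complex.re_ofReal_mul]
          calc (4:ℝ) ^ k * (τ (star (d k) * d k)).re ≤ 4 ^ k * (1 / 16) ^ k := by
                gcongr; exact hc k (k + 1) (Nat.le_succ k)
            _ = _ := by rw [← mul_pow]; norm_num
      _ ≤ (1 / 4 : ℝ) ^ m / (1 - 1 / 4) := geom_sum_Ico_le_of_lt_one (by norm_num) (by norm_num)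
      _ ≤ 2 * (1 / 4) ^ m := by
        rw [div_le_iff₀ (by norm_num)]
        have : (0 : ℝ) ≤ (1 / 4) ^ m := by positivity
        linarith
  -- strong limit of `e` is one
  have hone : ∀ ξ, Tendsto (fun m => (1 - e m) ξ) atTop (nhds 0) := by
    obtain ⟨f, hf, -, -⟩ := lim_antitone hω hU (c := fun m => 1 - e m)
      (fun m => sub_mem (one_mem _) (hSM (heS m)))
      (fun m m' hmm => sub_le_sub_left (hemono _ _ hmm) _) (fun m => sub_nonneg.2 (he1 m))
      (fun m => sub_le_self _ (he0 m))
    have hfS : f ∈ S := strong_mem S hf fun m => sub_mem (one_mem _) (heS m)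
    have hf0 : 0 ≤ f := le_strong hf fun m => sub_nonneg.2 (he1 m)
    have hfle : ∀ m, f ≤ 1 - e m := fun m => by
      rw [op_le]; intro ξ
      refine le_of_tendsto ((hf ξ).inner tendsto_const_nhds) ?_
      filter_upwards [eventually_ge_atTop m] with m' hm
      exact (op_le _ _).1 (sub_le_sub_left (hemono _ _ hm) _) ξ
    have : f = 0 := by
      refine tau_zero hU (sMω hfS) hf0 ?_
      have h4 : Tendsto (fun m : ℕ => 2 * (1 / 4 : ℝ) ^ m) atTop (nhds (2 * 0)) :=
        (tendsto_pow_atTop_nhds_zero_of_lt_one (by norm_num) (by norm_num)).const_mul 2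
      rw [mul_zero] at h4
      exact ge_of_tendsto' h4 fun m => (tau_mono hU (sMω hfS)
        (sub_mem (one_mem _) (sMω (heS m))) (hfle m)).trans (htr m)
    intro ξ
    simpa [this] using hf ξ
  -- norm estimate
  have hde : ∀ m k, m ≤ k → ‖d k * e m‖ ≤ (1 / 2) ^ k := by
    intro m k hmk
    refine ContinuousLinearMap.opNorm_le_bound _ (by positivity) fun ξ => ?_
    have h1 : Tendsto (fun n => ‖d k (c m n ξ)‖) atTop (nhds ‖d k (e m ξ)‖) :=
      (((d k).continuous.tendsto _).comp (he m ξ)).norm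
    refine le_of_tendsto h1 ?_
    filter_upwards [eventually_gt_atTop k] with n hn
    have h2 := inv_bound (hD1 m n) (d := d k) (r := 4 ^ k) (by positivity) (by
      have : h k ≤ ∑ k ∈ Finset.Ico m n, h k :=
        Finset.single_le_sum (fun k _ => hh0 k) (Finset.mem_Ico.2 ⟨hmk, hn⟩)
      exact this.trans (le_add_of_nonneg_left zero_le_one)) ξ
    refine le_of_sq_le_sq ?_ (by positivity)
    have h3 : ((1 / 2 : ℝ) ^ k * ‖ξ‖) ^ 2 = (1 / 4) ^ k * ‖ξ‖ ^ 2 := by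
      rw [mul_pow, ← pow_mul, mul_comm k 2, pow_mul]; norm_num
    have h4 : (1 / 4 : ℝ) ^ k * 4 ^ k = 1 := by rw [← mul_pow]; norm_num
    rw [h3]
    calc ‖d k (c m n ξ)‖ ^ 2 = (1 / 4 : ℝ) ^ k * (4 ^ k * ‖d k (c m n ξ)‖ ^ 2) := by
          rw [← mul_assoc, h4, one_mul]
      _ ≤ _ := by gcongr
  have hxe : ∀ m k n, m ≤ k → k ≤ n → ‖x n * e m - x k * e m‖ ≤ 2 * (1 / 2) ^ k - 2 * (1 / 2) ^ n := by
    intro m k n hmk hkn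
    induction n, hkn using Nat.le_induction with
    | base => rw [sub_self, norm_zero, sub_self]
    | succ n hkn ih =>
      have e1 : x (n + 1) * e m - x k * e m = d n * e m + (x n * e m - x k * e m) := by
        simp only [d]; rw [sub_mul]; abel
      rw [e1]
      have h8 := hde m n (hmk.trans hkn)
      refine (norm_add_le _ _).trans ?_
      rw [pow_succ]
      linarith
  have hye : ∀ m, limω x * e m ∈ S := by
    intro m
    have h1 : ∀ k, m ≤ k → ‖limω x * e m - x k * e m‖ ≤ 2 * (1 / 2) ^ k := by
      intro k hk
      have h2 := lim_norm hU (x := fun n => x (max n k) * e m - x k * e m) (C := 2 * (1 / 2) ^ k)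
        (fun n => hSM (sub_mem (mul_mem (hx _) (heS m)) (mul_mem (hx _) (heS m))))
        (fun n => (hxe m k _ hk (le_max_right _ _)).trans (by
          have : (0 : ℝ) ≤ (1 / 2) ^ (max n k) := by positivity
          linarith))
      have bm : Bdd (fun n => x (max n k)) := ⟨C, fun n => hC _⟩
      have mm : SeqIn (M : Set (Op H)) (fun n => x (max n k)) := fun n => hxM _
      rw [lim_sub hU (fun n => mul_mem (mm n) (hSM (heS m))) (bm.mul (Bdd.const _))
        (fun n => hSM (mul_mem (hx _) (heS m))) (Bdd.const _), hU.diag _ (hSM (mul_mem (hx _) (heS m))),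
        hU.map_mul _ _ mm bm (fun _ => hSM (heS m)) (Bdd.const _), hU.diag _ (hSM (heS m)),
        lim_congr hU mm bm hxM bx (by
          filter_upwards [free_atTop hω (eventually_ge_atTop k)] with n hn
          rw [max_eq_left hn])] at h2
      exact h2
    have h3 : Tendsto (fun k => x k * e m) atTop (nhds (limω x * e m)) := by
      rw [tendsto_iff_norm_sub_tendsto_zero]
      have h4 : Tendsto (fun m : ℕ => 2 * (1 / 2 : ℝ) ^ m) atTop (nhds (2 * 0)) :=
        (tendsto_pow_atTop_nhds_zero_of_lt_one (by norm_num) (by norm_num)).const_mul 2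
      rw [mul_zero] at h4
      refine squeeze_zero' (Eventually.of_forall fun _ => norm_nonneg _) ?_ h4
      filter_upwards [eventually_ge_atTop m] with k hk
      rw [norm_sub_rev]
      exact h1 k hk
    exact (vn_closed S).mem_of_tendsto h3 (Eventually.of_forall fun k => mul_mem (hx k) (heS m))
  refine vn_mem S _ fun T hT => ?_
  have hz : ∀ m, (T * limω x - limω x * T) * e m = 0 := fun m => by
    rw [sub_mul, mul_assoc, mul_assoc, vn_comm hT (hye m), vn_comm hT (heS m), mul_assoc, sub_self]
  rw [← sub_eq_zero]
  ext ξ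
  have h5 : ∀ m, (T * limω x - limω x * T) ((1 - e m) ξ) = (T * limω x - limω x * T) ξ := fun m => by
    have := congrArg (fun f : Op H => f ξ) (hz m)
    rw [ContinuousLinearMap.mul_apply] at this
    rw [ContinuousLinearMap.sub_apply 1, map_sub, this]; simp
  have h6 := ((T * limω x - limω x * T).continuous.tendsto _).comp (hone ξ)
  rw [map_zero] at h6
  have h7 : ((T * limω x - limω x * T : Op H) ∘ fun m => (1 - e m) ξ) = fun m => (T * limω x - limω x * T) ξ :=
    funext h5
  rw [h7] at h6
  exact tendsto_nhds_unique tendsto_const_nhds h6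

end co

section gns
universe a
variable {A : Type a} [CStarAlgebra A] [PartialOrder A] [StarOrderedRing A]

theorem pre_norm_star (f : A →ₚ[ℂ] ℂ) (ht : ∀ a b, f (a * b) = f (b * a)) (x : A) :
    ‖f.toPreGNS (star x)‖ = ‖f.toPreGNS x‖ := by
  rw [f.preGNS_norm_def, f.preGNS_norm_def, f.ofPreGNS_toPreGNS, f.ofPreGNS_toPreGNS, star_star, ht]

theorem pre_norm_mul (f : A →ₚ[ℂ] ℂ) (x y : A) :
    ‖f.toPreGNS (x * y)‖ ≤ ‖x‖ * ‖f.toPreGNS y‖ := by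
  have h := (f.leftMulMapPreGNS x).le_opNorm (f.toPreGNS y)
  have h2 : ‖f.leftMulMapPreGNS x‖ ≤ ‖x‖ := LinearMap.mkContinuous_norm_le _ (norm_nonneg _) _
  rw [f.leftMulMapPreGNS_apply, f.ofPreGNS_toPreGNS] at h
  exact h.trans (by gcongr)

noncomputable def rightMul (f : A →ₚ[ℂ] ℂ) (ht : ∀ a b, f (a * b) = f (b * a)) (y : A) :
    f.PreGNS →L[ℂ] f.PreGNS :=
  (f.toPreGNS.toLinearMap ∘ₗ (LinearMap.mulRight ℂ y) ∘ₗ f.ofPreGNS.toLinearMap).mkContinuous ‖y‖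
    fun x => by
      obtain ⟨x, rfl⟩ := f.toPreGNS.surjective x
      change ‖f.toPreGNS (x * y)‖ ≤ _
      rw [← pre_norm_star f ht, star_mul, ← pre_norm_star f ht x, ← norm_star y]
      exact pre_norm_mul f _ _

theorem norm_completion_le {E F : Type*} [SeminormedAddCommGroup E] [NormedSpace ℂ E]
    [SeminormedAddCommGroup F] [NormedSpace ℂ F] (T : E →L[ℂ] F) : ‖T.completion‖ ≤ ‖T‖ := by
  refine ContinuousLinearMap.opNorm_le_bound _ (norm_nonneg _) fun x => ?_
  induction x using UniformSpace.Completion.induction_on with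
  | hp => exact isClosed_le (by fun_prop) (by fun_prop)
  | ih x =>
    rw [ContinuousLinearMap.completion_apply_coe, UniformSpace.Completion.norm_coe,
      UniformSpace.Completion.norm_coe]
    exact T.le_opNorm x

noncomputable def gnsStd (f : A →ₚ[ℂ] ℂ) (ht : ∀ a b, f (a * b) = f (b * a)) (h1 : f 1 = 1)
    (hf : ∀ a, f (star a * a) = 0 → a = 0) : StdForm A f.GNS where
  hat :=
    { toFun := fun a => (f.toPreGNS a : f.GNS)
      map_add' := fun a b => by rw [map_add, UniformSpace.Completion.coe_add]
      map_smul' := fun c b => by rw [map_smul, UniformSpace.Completion.coe_smul]; rfl }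
  L := fun a => (f.leftMulMapPreGNS a).completion
  R := fun a => (rightMul f ht a).completion
  dense := by
    exact UniformSpace.Completion.denseRange_coe.comp f.toPreGNS.surjective.denseRange
      (UniformSpace.Completion.continuous_coe _)
  L_hat := fun a b => by
    change (f.leftMulMapPreGNS a).completion (f.toPreGNS b : f.GNS) = (f.toPreGNS (a * b) : f.GNS)
    rw [ContinuousLinearMap.completion_apply_coe]; rfl
  R_hat := fun a b => by
    change (rightMul f ht b).completion (f.toPreGNS a : f.GNS) = (f.toPreGNS (a * b) : f.GNS)
    rw [ContinuousLinearMap.completion_apply_coe]; rfl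
  inner_hat := fun a b => by
    change inner ℂ (f.toPreGNS a : f.GNS) (f.toPreGNS b : f.GNS) =
      inner ℂ (f.toPreGNS 1 : f.GNS) (f.toPreGNS (star a * b) : f.GNS)
    rw [UniformSpace.Completion.inner_coe, UniformSpace.Completion.inner_coe, f.preGNS_inner_def,
      f.preGNS_inner_def]
    simp
  tracial := fun a b => by
    change inner ℂ (f.toPreGNS a : f.GNS) (f.toPreGNS b : f.GNS) =
      inner ℂ (f.toPreGNS (star b) : f.GNS) (f.toPreGNS (star a) : f.GNS)
    rw [UniformSpace.Completion.inner_coe, UniformSpace.Completion.inner_coe, f.preGNS_inner_def,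
      f.preGNS_inner_def, f.ofPreGNS_toPreGNS, f.ofPreGNS_toPreGNS, f.ofPreGNS_toPreGNS,
      f.ofPreGNS_toPreGNS, star_star, ht]
  norm_one := by
    change ‖(f.toPreGNS 1 : f.GNS)‖ = 1
    rw [UniformSpace.Completion.norm_coe, f.preGNS_norm_def, f.ofPreGNS_toPreGNS, star_one, one_mul, h1]
    simp
  L_norm := fun a => (norm_completion_le _).trans (LinearMap.mkContinuous_norm_le _ (norm_nonneg _) _)
  R_norm := fun a => (norm_completion_le _).trans (LinearMap.mkContinuous_norm_le _ (norm_nonneg _) _)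
  inj := fun a ha => by
    change (f.toPreGNS a : f.GNS) = 0 at ha
    refine hf a ?_
    have h2 : inner ℂ (f.toPreGNS a : f.GNS) (f.toPreGNS a : f.GNS) = 0 := by
      rw [ha]; simp
    rwa [UniformSpace.Completion.inner_coe, f.preGNS_inner_def, f.ofPreGNS_toPreGNS] at h2

theorem gnsStd_tr (f : A →ₚ[ℂ] ℂ) (ht : ∀ a b, f (a * b) = f (b * a)) (h1 : f 1 = 1)
    (hf : ∀ a, f (star a * a) = 0 → a = 0) (x : A) : (gnsStd f ht h1 hf).tr x = f x := by
  change inner ℂ (f.toPreGNS 1 : f.GNS) (f.toPreGNS x : f.GNS) = _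
  rw [UniformSpace.Completion.inner_coe, f.preGNS_inner_def, f.ofPreGNS_toPreGNS, f.ofPreGNS_toPreGNS,
    star_one, one_mul]

end gns

section tf
universe a k
variable {A : Type a} [CStarAlgebra A] [PartialOrder A] [StarOrderedRing A]
variable {H : Type k} [NormedAddCommGroup H] [InnerProductSpace ℂ H] [CompleteSpace H]
variable {ω : Ultrafilter ℕ} {M Mω N : VonNeumannAlgebra H} {τ : Op H →ₗ[ℂ] ℂ}
  {limω : (ℕ → Op H) → Op H}

theorem corner_tf (j : A →⋆ₐ[ℂ] Op H) (hj : Function.Injective j)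
    (hr : ∀ x, x ∈ M ↔ ∃ a, j a = x) (P Q : StarSubalgebra ℂ (Op H)) (hPM : ∀ x ∈ P, x ∈ M)
    (h : ACorner (P.comap j) (Q.comap j)) :
    CornerEmbeds (P : Set (Op H)) (Q : Set (Op H)) (M : Set (Op H)) := by
  classical
  obtain ⟨p, q, v, θ, hp, hps, hpp, hp0, hq, hqs, hqq, hq0, hθ, hθ1, hθ2, hv0, hvs, hvv, hqvp, hi⟩ := h
  have inj0 : ∀ {a}, a ≠ 0 → j a ≠ 0 := fun ha h => ha (hj (by rw [h, map_zero]))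
  let Θ : Op H → Op H := fun x => if h : ∃ a, j a = x then j (θ h.choose) else 0
  have hΘ : ∀ a, Θ (j a) = j (θ a) := fun a => by
    have h : ∃ b, j b = j a := ⟨a, rfl⟩
    simp only [Θ]
    rw [dif_pos h, hj h.choose_spec]
  have hc : ∀ x ∈ corner (j p) (P : Set (Op H)), ∃ a, a ∈ P.comap j ∧ p * a * p = a ∧ j a = x := by
    rintro x ⟨hx, hpx⟩
    obtain ⟨a, rfl⟩ := (hr x).1 (hPM x hx)
    exact ⟨a, hx, hj (by rw [map_mul, map_mul, hpx]), rfl⟩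
  refine ⟨j p, j q, j v, Θ, hp, ⟨?_, ?_⟩, inj0 hp0, hq, ⟨?_, ?_⟩, inj0 hq0, ⟨?_, ?_, ?_, ?_, ?_⟩,
    (hr _).2 ⟨v, rfl⟩, inj0 hv0, ⟨?_, ?_⟩, ?_, ?_⟩
  · change star (j p) = j p; rw [← map_star, hps]
  · change j p * j p = j p; rw [← map_mul, hpp]
  · change star (j q) = j q; rw [← map_star, hqs]
  · change j q * j q = j q; rw [← map_mul, hqq]
  · intro x hx
    obtain ⟨a, ha, hpa, rfl⟩ := hc x hx
    rw [hΘ]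
    refine ⟨(hθ a ha hpa).1, ?_⟩
    rw [← map_mul, ← map_mul, (hθ a ha hpa).2]
  · intro x hx y hy
    obtain ⟨a, ha, hpa, rfl⟩ := hc x hx
    obtain ⟨b, hb, hpb, rfl⟩ := hc y hy
    rw [← map_add, hΘ, hΘ, hΘ, (hθ1 a ha hpa b hb hpb).1, map_add]
  · intro x hx y hy
    obtain ⟨a, ha, hpa, rfl⟩ := hc x hx
    obtain ⟨b, hb, hpb, rfl⟩ := hc y hy
    rw [← map_mul, hΘ, hΘ, hΘ, (hθ1 a ha hpa b hb hpb).2, map_mul]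
  · intro c x hx
    obtain ⟨a, ha, hpa, rfl⟩ := hc x hx
    rw [← map_smul, hΘ, hΘ, (hθ2 a ha hpa).1, map_smul]
  · intro x hx
    obtain ⟨a, ha, hpa, rfl⟩ := hc x hx
    rw [← map_star, hΘ, hΘ, (hθ2 a ha hpa).2, map_star]
  · change star (star (j v) * j v) = star (j v) * j v
    rw [← map_star, ← map_mul, ← map_star, hvs]
  · change star (j v) * j v * (star (j v) * j v) = star (j v) * j v
    rw [← map_star, ← map_mul, ← map_mul, hvv]
  · rw [← map_mul, ← map_mul, hqvp]
  · intro x hx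
    obtain ⟨a, ha, hpa, rfl⟩ := hc x hx
    rw [hΘ, ← map_mul, ← map_mul, hi a ha hpa]

theorem good_tf {K : Type*} [NormedAddCommGroup K] [InnerProductSpace ℂ K] [CompleteSpace K]
    (hω : IsFreeUltrafilter ω) (hU : IsTracialUltrapower ω M Mω τ limω)
    (j : A →⋆ₐ[ℂ] Op H) (hj : ∀ a, ‖j a‖ = ‖a‖) (hr : ∀ x, x ∈ M ↔ ∃ a, j a = x)
    (S : StdForm A K) (hS : ∀ a, S.tr a = τ (j a)) {Q : VonNeumannAlgebra H}
    (hQ : (Q : Set (Op H)) ⊆ (M : Set (Op H))) (Q' : StarSubalgebra ℂ A)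
    (hQ' : ∀ a, a ∈ Q' ↔ j a ∈ Q) : S.Good Q' := by
  have hiso : Isometry j := AddMonoidHomClass.isometry_of_norm j hj
  constructor
  · have e : (Q' : Set A) = j ⁻¹' (Q : Set (Op H)) := Set.ext hQ'
    rw [e]
    exact (vn_closed Q).preimage hiso.continuous
  · intro x C hx hC hcau
    obtain ⟨φ, hφ, hφ2⟩ := Filter.extraction_forall_of_eventually'
      (P := fun n k => ∀ m ≥ k, ‖S.hat (x m) - S.hat (x k)‖ ≤ (1 / 4) ^ n) (fun n => by
        obtain ⟨N0, hN⟩ := Metric.cauchySeq_iff.1 hcau ((1 / 4) ^ n) (by positivity)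
        refine ⟨N0, fun k hk m hm => ?_⟩
        rw [← dist_eq_norm]
        exact (hN m (hk.trans hm) k hk).le)
    have e16 : ∀ k : ℕ, ((1 / 4 : ℝ) ^ k) ^ 2 = (1 / 16) ^ k := fun k => by
      rw [← pow_mul, mul_comm, pow_mul]; norm_num
    have key : ∀ a b : A, (τ (star (j a - j b) * (j a - j b))).re = ‖S.hat a - S.hat b‖ ^ 2 := by
      intro a b
      rw [← map_sub, ← map_sub, ← map_star, ← map_mul, ← hS, ← S.norm_sq_re]
    obtain ⟨y, hy, hyC, hyk⟩ := core hω hU hQ (x := fun k => j (x (φ k))) (fun k => (hQ' _).1 (hx _))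
      (C := C) (fun k => by rw [hj]; exact hC _) (fun k l hkl => by
        rw [key, ← e16]
        have := hφ2 k (φ l) (hφ.monotone hkl)
        gcongr)
    obtain ⟨b, rfl⟩ := (hr y).1 (hQ hy)
    refine ⟨b, (hQ' _).2 hy, by rwa [← hj], ?_⟩
    refine tendsto_nhds_of_cauchySeq_of_subseq hcau hφ.tendsto_atTop ?_
    rw [tendsto_iff_norm_sub_tendsto_zero]
    refine squeeze_zero (fun _ => norm_nonneg _) (fun k => ?_)
      (tendsto_pow_atTop_nhds_zero_of_lt_one (r := (1 / 4 : ℝ)) (by norm_num) (by norm_num))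
    have := hyk k
    rw [key, ← e16] at this
    rw [norm_sub_rev]
    exact le_of_sq_le_sq this (by positivity)

theorem dich_H (hω : IsFreeUltrafilter ω) (hU : IsTracialUltrapower ω M Mω τ limω)
    (j : A →⋆ₐ[ℂ] Op H) (hj : ∀ a, ‖j a‖ = ‖a‖) (hr : ∀ x, x ∈ M ↔ ∃ a, j a = x)
    (hN : (N : Set (Op H)) ⊆ (M : Set (Op H))) (P : StarSubalgebra ℂ (Op H)) (hPM : ∀ x ∈ P, x ∈ M)
    (hPc : IsClosed (P : Set (Op H))) (hmu : ManyUnits P)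
    (hno : ¬ CornerEmbeds (P : Set (Op H)) (N : Set (Op H)) (M : Set (Op H)))
    (F : Finset (Op H)) (hF : ∀ x ∈ F, x ∈ M) {ε : ℝ} (hε : 0 < ε) :
    ∃ u ∈ P, star u * u = 1 ∧ u * star u = 1 ∧ ∀ x ∈ F, ∀ y ∈ F, ∀ b ∈ N, ∀ C : ℝ, 0 ≤ C →
      (τ (star b * b)).re ≤ C ^ 2 → ‖τ (star b * (x * u * y))‖ ≤ ε * C := by
  classical
  have hiso : Isometry j := AddMonoidHomClass.isometry_of_norm j hj
  have jM : ∀ a, j a ∈ M := fun a => (hr _).2 ⟨a, rfl⟩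
  have jMω : ∀ a, j a ∈ Mω := fun a => hU.subset (jM a)
  let f : A →ₚ[ℂ] ℂ := PositiveLinearMap.mk₀ (τ ∘ₗ j.toAlgHom.toLinearMap) (fun x hx => by
    obtain ⟨b, rfl⟩ := CStarAlgebra.nonneg_iff_eq_star_mul_self.1 hx
    change 0 ≤ τ (j (star b * b))
    rw [map_mul, map_star]
    exact hU.traceState.pos _ (jMω b))
  have hf : ∀ a, f a = τ (j a) := fun a => rfl
  let S := gnsStd f (fun a b => by
      rw [hf, hf, map_mul j, map_mul j, hU.traceState.tracial _ (jMω a) _ (jMω b)])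
    (by rw [hf, map_one, hU.traceState.map_one])
    (fun a h => by
      rw [hf, map_mul, map_star] at h
      exact hiso.injective (by rw [hU.traceState.faithful _ (jMω a) h, map_zero]))
  have hS : ∀ a, S.tr a = τ (j a) := fun a => gnsStd_tr f _ _ _ a
  have gN : S.Good (N.toStarSubalgebra.comap j) := good_tf hω hU j hj hr S hS hN _ fun a => Iff.rfl
  have gT : S.Good ⊤ := good_tf hω hU j hj hr S hS (Q := M) subset_rfl _ fun a => by simp [jM a]
  have cP : IsClosed ((P.comap j : StarSubalgebra ℂ A) : Set A) := hPc.preimage hiso.continuous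
  have mP : ManyUnits (P.comap j) := by
    intro n
    obtain ⟨m, hm, w, p, hw, hp, h1, h2, h3, h4, h5, h6⟩ := hmu n
    choose w' hw' using fun i => (hr _).1 (hPM _ (hw i))
    obtain ⟨p', hp'⟩ := (hr _).1 (hPM _ hp)
    obtain rfl : w = fun i => j (w' i) := funext fun i => (hw' i).symm
    subst hp'
    refine ⟨m, hm, w', p', hw, hp, ?_, ?_, ?_, ?_, ?_, ?_⟩
    · exact hiso.injective (by rw [map_star, h1])
    · exact hiso.injective (by rw [map_mul, h2])
    · intro i; exact hiso.injective (by rw [map_mul, map_star, h3])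
    · intro i k hik; exact hiso.injective (by rw [map_mul, map_star, h4 _ _ hik, map_zero])
    · intro i; exact hiso.injective (by rw [map_mul, h5])
    · exact hiso.injective (by rw [map_sum, map_one, ← h6]; simp only [map_mul, map_star])
  obtain ⟨u, hu, hu1, hu2, h⟩ := StdForm.dichotomy gN gT cP mP
    (fun hA => hno (corner_tf j hiso.injective hr P N.toStarSubalgebra hPM hA))
    (F.preimage j hiso.injective.injOn) hε
  refine ⟨j u, hu, by rw [← map_star, ← map_mul, hu1, map_one],
    by rw [← map_star, ← map_mul, hu2, map_one], ?_⟩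
  intro x hx y hy b hb C hC0 hC
  obtain ⟨x, rfl⟩ := (hr x).1 (hF x hx)
  obtain ⟨y, rfl⟩ := (hr y).1 (hF y hy)
  obtain ⟨b, rfl⟩ := (hr b).1 (hN hb)
  have h7 := h x (by simpa using hx) y (by simpa using hy) b hb
  rw [hS] at h7
  simp only [map_mul, map_star] at h7
  refine h7.trans ?_
  gcongr
  refine le_of_sq_le_sq ?_ hC0
  rwa [S.norm_sq_re, hS, map_mul, map_star]

/-- version without the auxiliary algebra -/
theorem dich_M (hω : IsFreeUltrafilter ω) (hU : IsTracialUltrapower ω M Mω τ limω)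
    (hN : (N : Set (Op H)) ⊆ (M : Set (Op H))) (P : StarSubalgebra ℂ (Op H)) (hPM : ∀ x ∈ P, x ∈ M)
    (hPc : IsClosed (P : Set (Op H))) (hmu : ManyUnits P)
    (hno : ¬ CornerEmbeds (P : Set (Op H)) (N : Set (Op H)) (M : Set (Op H)))
    (F : Finset (Op H)) (hF : ∀ x ∈ F, x ∈ M) {ε : ℝ} (hε : 0 < ε) :
    ∃ u ∈ P, star u * u = 1 ∧ u * star u = 1 ∧ ∀ x ∈ F, ∀ y ∈ F, ∀ b ∈ N, ∀ C : ℝ, 0 ≤ C →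
      (τ (star b * b)).re ≤ C ^ 2 → ‖τ (star b * (x * u * y))‖ ≤ ε * C := by
  haveI : IsClosed (M.toStarSubalgebra : Set (Op H)) := vn_closed M
  letI : PartialOrder M.toStarSubalgebra := CStarAlgebra.spectralOrder _
  haveI : StarOrderedRing M.toStarSubalgebra := CStarAlgebra.spectralOrderedRing _
  exact dich_H (A := M.toStarSubalgebra) hω hU M.toStarSubalgebra.subtype (fun _ => rfl)
    (fun x => ⟨fun h => ⟨⟨x, h⟩, rfl⟩, by rintro ⟨a, rfl⟩; exact a.2⟩) hN P hPM hPc hmu hno F hF hε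

end tf

section mu
universe a k

theorem units_alg {C : Type a} [Ring C] [StarRing C] {ι : Type*} [Fintype ι] [DecidableEq ι]
    {κ : Type*} [Fintype κ] (f : ι → ι → C)
    (hf : ∀ i j k l, f i j * f k l = if j = k then f i l else 0)
    (hfs : ∀ i j, star (f i j) = f j i) (hf1 : ∑ i, f i i = 1) (o : ι) (e : κ → C) (e0 : C)
    (h1 : star e0 = e0) (h2 : e0 * e0 = e0) (h3 : ∀ i, star (e i) * e i = e0)
    (h4 : ∀ i k, i ≠ k → star (e i) * e k = 0) (h5 : ∀ i, f o o * e i = e i)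
    (h6 : f o o * e0 = e0) (h7 : ∀ i, e i * e0 = e i) (h8 : ∑ i, e i * star (e i) = f o o) :
    ∃ (w : κ → C) (p : C), (∀ i j k, f i j * w k = w k * f i j) ∧ (∀ i j, f i j * p = p * f i j) ∧
      star p = p ∧
      p * p = p ∧ (∀ i, star (w i) * w i = p) ∧ (∀ i j, i ≠ j → star (w i) * w j = 0) ∧
      (∀ i, w i * p = w i) ∧ ∑ i, w i * star (w i) = 1 := by
  let W : C →+ C :=
    { toFun := fun x => ∑ a, f a o * x * f o a
      map_zero' := by simp
      map_add' := fun x y => by simp only [mul_add, add_mul, Finset.sum_add_distrib] }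
  have hW : ∀ x, W x = ∑ a, f a o * x * f o a := fun x => rfl
  have hl : ∀ i j x, f i j * W x = f i o * x * f o j := fun i j x => by
    rw [hW, Finset.mul_sum, Finset.sum_eq_single j]
    · rw [← mul_assoc, ← mul_assoc, hf, if_pos rfl]
    · intro b _ hb
      rw [← mul_assoc, ← mul_assoc, hf, if_neg (Ne.symm hb), zero_mul, zero_mul]
    · simp
  have hr : ∀ i j x, W x * f i j = f i o * x * f o j := fun i j x => by
    rw [hW, Finset.sum_mul, Finset.sum_eq_single i]
    · rw [mul_assoc, hf, if_pos rfl]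
    · intro b _ hb
      rw [mul_assoc, hf, if_neg hb, mul_zero]
    · simp
  have hm : ∀ x y, W x * W y = W (x * f o o * y) := fun x y => by
    rw [hW x, Finset.sum_mul, hW (_ * _ * _)]
    refine Finset.sum_congr rfl fun b _ => ?_
    rw [mul_assoc, hl]
    simp only [mul_assoc]
  have hs : ∀ x, star (W x) = W (star x) := fun x => by
    simp only [hW, star_sum, star_mul, hfs, mul_assoc]
  have hW1 : W (f o o) = 1 := by
    rw [hW, ← hf1]
    refine Finset.sum_congr rfl fun b _ => ?_
    rw [hf, if_pos rfl, hf, if_pos rfl]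
  have h9 : ∀ i, star (e i) * f o o = star (e i) := fun i => by
    have := congrArg star (h5 i)
    rwa [star_mul, hfs] at this
  have h10 : e0 * f o o = e0 := by
    have := congrArg star h6
    rwa [star_mul, hfs, h1] at this
  refine ⟨fun i => W (e i), W e0, fun i j k => by rw [hl, hr], fun i j => by rw [hl, hr],
    by rw [hs, h1], by rw [hm, h10, h2], fun i => by rw [hs, hm, h9, h3],
    fun i j hij => by rw [hs, hm, h9, h4 _ _ hij, map_zero], fun i => by
      rw [hm, mul_assoc, h6, h7], ?_⟩
  have : ∀ i, e i * f o o * star (e i) = e i * star (e i) := fun i => by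
    have h11 : e i * f o o = e i := by rw [← h7 i, mul_assoc, h10]
    rw [h11]
  simp only [hs, hm, this]
  rw [← map_sum, h8, hW1]

theorem units_E {E : Type*} [NormedAddCommGroup E] [InnerProductSpace ℂ E] [FiniteDimensional ℂ E]
    [CompleteSpace E]
    (q : E →L[ℂ] E) (hq : star q = q) (hqq : q * q = q) (hq0 : q ≠ 0) :
    ∃ (r : ℕ) (e : Fin r → (E →L[ℂ] E)) (e0 : E →L[ℂ] E),
      LinearMap.trace ℂ E (q : E →ₗ[ℂ] E) = r ∧
      star e0 = e0 ∧ e0 * e0 = e0 ∧ (∀ i, star (e i) * e i = e0) ∧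
      (∀ i k, i ≠ k → star (e i) * e k = 0) ∧ (∀ i, q * e i = e i) ∧
      q * e0 = e0 ∧ (∀ i, e i * e0 = e i) ∧ ∑ i, e i * star (e i) = q := by
  classical
  obtain ⟨hp, hpe⟩ := isStarProjection_iff_eq_starProjection_range.1
    (show IsStarProjection q from ⟨hqq, hq⟩)
  let b := stdOrthonormalBasis ℂ q.range
  have hsum := b.starProjection_eq_sum_rankOne
  rw [← hpe] at hsum
  have hpos : 0 < Module.finrank ℂ q.range := by
    by_contra h
    have h0 : Module.finrank ℂ q.range = 0 := by omega
    apply hq0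
    rw [hsum]
    refine Finset.sum_eq_zero fun i _ => ?_
    exact absurd i.2 (by omega)
  let o : Fin (Module.finrank ℂ q.range) := ⟨0, hpos⟩
  have ob : ∀ i j, inner ℂ (b i : E) (b j : E) = if i = j then (1 : ℂ) else 0 := fun i j => by
    have := orthonormal_iff_ite.1 b.orthonormal i j
    simpa using this
  have hqb : ∀ i, q (b i : E) = b i := fun i => by
    obtain ⟨x, hx⟩ := (b i).2
    have hx' : q x = b i := hx
    rw [← hx', ← ContinuousLinearMap.mul_apply, hqq]
  let R := fun i j => InnerProductSpace.rankOne ℂ (b i : E) (b j : E)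
  have Rs : ∀ i j, star (R i j) = R j i := fun i j => by
    rw [ContinuousLinearMap.star_eq_adjoint, InnerProductSpace.adjoint_rankOne]
  have Rm : ∀ i j k l, R i j * R k l = if j = k then R i l else 0 := fun i j k l => by
    have : R i j * R k l = (R i j).comp (R k l) := rfl
    rw [this, InnerProductSpace.rankOne_comp_rankOne, ob]
    split_ifs <;> simp [R]
  have Rq : ∀ i j, q * R i j = R i j := fun i j => by
    have : q * R i j = q.comp (R i j) := rfl
    rw [this]
    ext z
    simp [R, hqb]
  refine ⟨_, fun i => R i o, R o o, ?_, ?_, ?_, ?_, ?_, ?_, ?_, ?_, ?_⟩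
  · conv_lhs => rw [hsum]
    rw [ContinuousLinearMap.coe_sum, map_sum]
    simp only [InnerProductSpace.trace_rankOne, ob, if_true]
    simp
  · rw [Rs]
  · rw [Rm, if_pos rfl]
  · intro i; rw [Rs, Rm, if_pos rfl]
  · intro i k h; rw [Rs, Rm, if_neg h]
  · intro i; rw [Rq]
  · rw [Rq]
  · intro i; rw [Rm, if_pos rfl]
  · simp only [Rs, Rm, if_true]
    exact hsum.symm

theorem units_fd {E : Type*} [NormedAddCommGroup E] [InnerProductSpace ℂ E] [FiniteDimensional ℂ E]
    [CompleteSpace E] [Nontrivial E] {ι : Type*} [Fintype ι] [DecidableEq ι] (f : ι → ι → (E →L[ℂ] E))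
    (hf : ∀ i j k l, f i j * f k l = if j = k then f i l else 0)
    (hfs : ∀ i j, star (f i j) = f j i) (hf1 : ∑ i, f i i = 1) :
    ∃ (r : ℕ) (w : Fin r → (E →L[ℂ] E)) (p : (E →L[ℂ] E)),
      Module.finrank ℂ E = Fintype.card ι * r ∧
      (∀ i j k, f i j * w k = w k * f i j) ∧ (∀ i j, f i j * p = p * f i j) ∧
      star p = p ∧
      p * p = p ∧ (∀ i, star (w i) * w i = p) ∧ (∀ i j, i ≠ j → star (w i) * w j = 0) ∧
      (∀ i, w i * p = w i) ∧ ∑ i, w i * star (w i) = 1 := by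
  have hne : Nonempty ι := by
    by_contra h
    rw [not_nonempty_iff] at h
    simp at hf1
  obtain ⟨o⟩ := hne
  have h0 : f o o ≠ 0 := by
    intro h
    have : ∑ i, f i i = 0 := Finset.sum_eq_zero fun i _ => by
      have h1 := hf i o o i
      have h2 := hf i o o o
      rw [if_pos rfl] at h1 h2
      rw [h, mul_zero] at h2
      rw [← h1, ← h2, zero_mul]
    rw [hf1] at this
    exact one_ne_zero this
  obtain ⟨r, e, e0, htr, h1, h2, h3, h4, h5, h6, h7, h8⟩ := units_E (f o o) (hfs o o)
    (by rw [hf, if_pos rfl]) h0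
  refine ⟨r, ?_⟩
  obtain ⟨w, p, h⟩ := units_alg f hf hfs hf1 o e e0 h1 h2 h3 h4 h5 h6 h7 h8
  refine ⟨w, p, ?_, h⟩
  have ht : ∀ i, LinearMap.trace ℂ E (f i i : E →ₗ[ℂ] E) = r := fun i => by
    rw [← htr]
    have e1 : f i i = f i o * f o i := by rw [hf, if_pos rfl]
    have e2 : f o o = f o i * f i o := by rw [hf, if_pos rfl]
    rw [e1, e2]
    exact LinearMap.trace_mul_comm ℂ (f i o : E →ₗ[ℂ] E) (f o i : E →ₗ[ℂ] E)
  have h9 := congrArg (fun T : E →L[ℂ] E => LinearMap.trace ℂ E (T : E →ₗ[ℂ] E)) hf1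
  simp only [ContinuousLinearMap.coe_sum, map_sum, ht] at h9
  have h10 : LinearMap.trace ℂ E ((1 : E →L[ℂ] E) : E →ₗ[ℂ] E) = Module.finrank ℂ E :=
    LinearMap.trace_one ℂ E
  rw [h10] at h9
  simp only [Finset.sum_const, Finset.card_univ, nsmul_eq_mul] at h9
  exact_mod_cast h9.symm

variable {H : Type k} [NormedAddCommGroup H] [InnerProductSpace ℂ H] [CompleteSpace H]

/-- relative commutant as a star subalgebra -/
noncomputable def relC (B : StarSubalgebra ℂ (Op H)) (M : VonNeumannAlgebra H) : StarSubalgebra ℂ (Op H) :=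
  M.toStarSubalgebra ⊓ StarSubalgebra.centralizer ℂ (B : Set (Op H))

theorem mem_relC (B : StarSubalgebra ℂ (Op H)) (M : VonNeumannAlgebra H) (x : Op H) :
    x ∈ relC B M ↔ x ∈ M ∧ ∀ y ∈ B, y * x = x * y := by
  rw [relC, StarSubalgebra.mem_inf, StarSubalgebra.mem_centralizer_iff]
  constructor
  · rintro ⟨h, h'⟩
    exact ⟨h, fun y hy => (h' y hy).1⟩
  · rintro ⟨h, h'⟩
    exact ⟨h, fun y hy => ⟨h' y hy, h' _ (star_mem hy)⟩⟩

theorem relC_coe (B : StarSubalgebra ℂ (Op H)) (M : VonNeumannAlgebra H) :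
    (relC B M : Set (Op H)) = relComm (B : Set (Op H)) (M : Set (Op H)) := by
  ext x
  exact mem_relC B M x

theorem relC_closed (B : StarSubalgebra ℂ (Op H)) (M : VonNeumannAlgebra H) :
    IsClosed (relC B M : Set (Op H)) := by
  have : (relC B M : Set (Op H)) = (M : Set (Op H)) ∩ Set.centralizer (B : Set (Op H)) := by
    ext x
    exact mem_relC B M x
  rw [this]
  exact (vn_closed M).inter (Set.isClosed_centralizer _)

theorem relC_units (A : ℕ → StarSubalgebra ℂ (Op H)) (M : VonNeumannAlgebra H)
    (hmono : Monotone A)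
    (hAM : ∀ n, (A n : Set (Op H)) ⊆ (M : Set (Op H)))
    (hmatrix : ∀ n, Nonempty ((A n) ≃⋆ₐ[ℂ] Matrix (Fin (2 ^ n)) (Fin (2 ^ n)) ℂ)) (s : ℕ) :
    ManyUnits (relC (A s) M) := by
  classical
  intro n
  have hst : A s ≤ A (s + n) := hmono (by omega)
  obtain ⟨φ⟩ := hmatrix s
  obtain ⟨ψ⟩ := hmatrix (s + n)
  let Ψ := ψ.trans (Matrix.toEuclideanCLM (n := Fin (2 ^ (s + n))) (𝕜 := ℂ))
  let F : Fin (2 ^ s) → Fin (2 ^ s) → A s := fun i j => φ.symm (Matrix.single i j 1)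
  have hF : ∀ i j k l, F i j * F k l = if j = k then F i l else 0 := fun i j k l => by
    simp only [F]
    rw [← map_mul]
    split_ifs with h
    · subst h; simp
    · rw [Matrix.single_mul_single_of_ne _ _ _ _ h, map_zero]
  have hFs : ∀ i j, star (F i j) = F j i := fun i j => by
    simp only [F]
    rw [← map_star, Matrix.star_eq_conjTranspose, Matrix.conjTranspose_single, star_one]
  have hF1 : ∑ i, F i i = 1 := by
    simp only [F]
    rw [← map_sum, Matrix.sum_single_one, map_one]
  have hFx : ∀ x : A s, ∃ c : Fin (2 ^ s) → Fin (2 ^ s) → ℂ, x = ∑ i, ∑ j, c i j • F i j := fun x => by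
    refine ⟨φ x, ?_⟩
    have h1 : x = φ.symm (φ x) := (φ.symm_apply_apply x).symm
    conv_lhs => rw [h1, Matrix.matrix_eq_sum_single (φ x)]
    rw [map_sum]
    refine Finset.sum_congr rfl fun i _ => ?_
    rw [map_sum]
    refine Finset.sum_congr rfl fun j _ => ?_
    simp only [F]
    rw [← map_smul, Matrix.smul_single, smul_eq_mul, mul_one]
  let J : A s →⋆ₐ[ℂ] A (s + n) := StarSubalgebra.inclusion hst
  let f := fun i j => Ψ (J (F i j))
  have hf : ∀ i j k l, f i j * f k l = if j = k then f i l else 0 := fun i j k l => by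
    simp only [f]
    rw [← map_mul, ← map_mul, hF]
    split_ifs <;> simp
  have hfs : ∀ i j, star (f i j) = f j i := fun i j => by
    simp only [f]
    rw [← hFs i j, map_star J]
    exact (Ψ.map_star' _).symm
  have hf1 : ∑ i, f i i = 1 := by
    simp only [f]
    rw [← map_sum, ← map_sum, hF1, map_one, map_one]
  obtain ⟨r, w, p, hr, h1, h2, h3, h4, h5, h6, h7, h8⟩ := units_fd f hf hfs hf1
  have hr' : r = 2 ^ n := by
    simp only [finrank_euclideanSpace, Fintype.card_fin] at hr
    rw [pow_add] at hr
    exact (Nat.eq_of_mul_eq_mul_left (by positivity) hr).symm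
  let I : (EuclideanSpace ℂ (Fin (2 ^ (s + n))) →L[ℂ] EuclideanSpace ℂ (Fin (2 ^ (s + n)))) → Op H :=
    fun x => (Ψ.symm x : Op H)
  have Im : ∀ x y, I (x * y) = I x * I y := fun x y => by simp [I]
  have Is : ∀ x, I (star x) = star (I x) := fun x =>
    congrArg Subtype.val (Ψ.symm.map_star' x)
  have I0 : I 0 = 0 := by simp [I]
  have I1 : I 1 = 1 := by simp [I]
  have IS : ∀ g : Fin r → _, I (∑ i, g i) = ∑ i, I (g i) := fun g => by simp [I]
  have If : ∀ i j, I (f i j) = (F i j : Op H) := fun i j => by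
    simp [I, f, J]
  have hmem : ∀ x, (∀ i j, f i j * x = x * f i j) → I x ∈ relC (A s) M := fun x hx => by
    rw [mem_relC]
    refine ⟨hAM (s + n) (Ψ.symm x).2, fun y hy => ?_⟩
    obtain ⟨c, hc⟩ := hFx ⟨y, hy⟩
    have hc' : y = ∑ i, ∑ j, c i j • (F i j : Op H) := by
      have := congrArg (Subtype.val) hc
      simpa using this
    rw [hc']
    simp only [Finset.sum_mul, Finset.mul_sum, smul_mul_assoc, mul_smul_comm]
    refine Finset.sum_congr rfl fun i _ => Finset.sum_congr rfl fun j _ => ?_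
    rw [← If, ← Im, hx, Im]
  refine ⟨r, ?_, fun i => I (w i), I p, fun k => hmem _ fun i j => h1 i j k, hmem _ h2, ?_, ?_, ?_,
    ?_, ?_, ?_⟩
  · rw [hr']; exact Nat.lt_two_pow_self.le
  · rw [← Is, h3]
  · rw [← Im, h4]
  · intro i; rw [← Is, ← Im, h5]
  · intro i j hij; rw [← Is, ← Im, h6 _ _ hij, I0]
  · intro i; rw [← Im, h7]
  · simp only [← Is, ← Im]
    rw [← IS, h8, I1]

end mu

/-- the claim in the proof of Lemma 2.2. With `M` hyperfinite with
ascending matrix subalgebras `A n ≅ M_{2^n}(ℂ)` weakly dense in `M`, and `N ⊆ M` with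
`A n' ∩ M ⊀_M N` for all `n`: for every sequence `s_n → ∞` and every finite
`F ⊆ M^ω` there is a unitary `v^ω ∈ ∏_{n→ω} (A (s n)' ∩ M) ⊆ M' ∩ M^ω` with
`E_{N^ω}(x v^ω y) = 0` for all `x, y ∈ F`. -/
theorem exists_unitary_killing_expectation
    {H : Type u} [NormedAddCommGroup H] [InnerProductSpace ℂ H] [CompleteSpace H]
    (ω : Ultrafilter ℕ) (hω : IsFreeUltrafilter ω)
    (M N Mω : VonNeumannAlgebra H) (τ : Op H →ₗ[ℂ] ℂ) (limω : (ℕ → Op H) → Op H)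
    (A : ℕ → StarSubalgebra ℂ (Op H)) (Eω : Op H → Op H)
    (hM : IsII1Factor M τ)
    (hmono : Monotone A)
    (hAM : ∀ n, (A n : Set (Op H)) ⊆ (M : Set (Op H)))
    (hmatrix : ∀ n, Nonempty ((A n) ≃⋆ₐ[ℂ] Matrix (Fin (2 ^ n)) (Fin (2 ^ n)) ℂ))
    (hdense : Set.centralizer (Set.centralizer (⋃ n, (A n : Set (Op H)))) =
      (M : Set (Op H)))
    (hNM : (N : Set (Op H)) ⊆ (M : Set (Op H)))
    (hno : ∀ n, ¬ CornerEmbeds (relComm (A n : Set (Op H)) (M : Set (Op H)))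
      (N : Set (Op H)) (M : Set (Op H)))
    (hU : IsTracialUltrapower ω M Mω τ limω)
    (hEω : IsCondExp τ (Mω : Set (Op H)) (ultrapowerSet limω (N : Set (Op H))) Eω) :
    ∀ s : ℕ → ℕ, Tendsto s atTop atTop →
      ∀ F : Finset (Op H), (F : Set (Op H)) ⊆ (Mω : Set (Op H)) →
        ∃ v : ℕ → Op H,
          (∀ n, v n ∈ relComm (A (s n) : Set (Op H)) (M : Set (Op H))) ∧
          (∀ n, star (v n) * v n = 1 ∧ v n * star (v n) = 1) ∧
          limω v ∈ relComm (M : Set (Op H)) (Mω : Set (Op H)) ∧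
          ∀ x ∈ F, ∀ y ∈ F, Eω (x * limω v * y) = 0 := by
  classical
  intro s hs F hF
  have hX : ∀ x : Op H, ∃ X : ℕ → Op H, SeqIn (M : Set (Op H)) X ∧ Bdd X ∧ (x ∈ Mω → limω X = x) := by
    intro x
    by_cases hx : x ∈ Mω
    · obtain ⟨X, h1, h2, h3⟩ := hU.surj x hx
      exact ⟨X, h1, h2, fun _ => h3⟩
    · exact ⟨fun _ => 0, fun _ => zero_mem M, Bdd.const 0, fun h => absurd h hx⟩
  choose X hXM hXb hXl using hX
  have hv : ∀ n : ℕ, ∃ u ∈ relC (A (s n)) M, star u * u = 1 ∧ u * star u = 1 ∧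
      ∀ x ∈ F.image (fun x => X x n), ∀ y ∈ F.image (fun x => X x n), ∀ b ∈ N, ∀ C : ℝ, 0 ≤ C →
      (τ (star b * b)).re ≤ C ^ 2 → ‖τ (star b * (x * u * y))‖ ≤ (1 / ((n : ℝ) + 1)) * C := fun n =>
    dich_M hω hU hNM (relC (A (s n)) M) (fun x hx => ((mem_relC _ _ _).1 hx).1) (relC_closed _ _)
      (relC_units A M hmono hAM hmatrix (s n)) (by rw [relC_coe]; exact hno (s n)) _
      (by
        intro x hx
        obtain ⟨y, _, rfl⟩ := Finset.mem_image.1 hx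
        exact hXM y n) (by positivity)
  choose v hvP hv1 hv2 hvF using hv
  have hvM : SeqIn (M : Set (Op H)) v := fun n => ((mem_relC _ _ _).1 (hvP n)).1
  have hvb : Bdd v := ⟨1, fun n => by
    have h1 := CStarRing.norm_star_mul_self (x := v n)
    rw [hv1] at h1
    have h2 : ‖(1 : Op H)‖ ≤ 1 := ContinuousLinearMap.norm_id_le
    nlinarith [norm_nonneg (v n)]⟩
  have hlv : limω v ∈ Mω := hU.mem v hvM hvb
  have hcA : limω v ∈ Set.centralizer (⋃ n, (A n : Set (Op H))) := by
    intro a ha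
    obtain ⟨k, hk⟩ := Set.mem_iUnion.1 ha
    have haM : a ∈ M := hAM k hk
    have h1 := hU.map_mul (fun _ => a) v (fun _ => haM) (Bdd.const a) hvM hvb
    have h2 := hU.map_mul v (fun _ => a) hvM hvb (fun _ => haM) (Bdd.const a)
    rw [hU.diag a haM] at h1 h2
    rw [← h1, ← h2]
    refine lim_congr hU (fun n => mul_mem haM (hvM n)) ((Bdd.const a).mul hvb)
      (fun n => mul_mem (hvM n) haM) (hvb.mul (Bdd.const a)) ?_
    filter_upwards [free_atTop hω (hs.eventually_ge_atTop k)] with n hn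
    exact ((mem_relC _ _ _).1 (hvP n)).2 a (hmono hn hk)
  refine ⟨v, fun n => (mem_relC _ _ _).1 (hvP n), fun n => ⟨hv1 n, hv2 n⟩, ⟨hlv, ?_⟩, ?_⟩
  · intro m hm
    rw [← hdense] at hm
    exact (hm _ hcA).symm
  intro x hx y hy
  have hz : x * limω v * y ∈ Mω := mul_mem (mul_mem (hF hx) hlv) (hF hy)
  obtain ⟨w, hw, hwb, hwl⟩ := hEω.mem _ hz
  have hwM : SeqIn (M : Set (Op H)) w := fun n => hNM (hw n)
  have hEM : Eω (x * limω v * y) ∈ Mω := by rw [← hwl]; exact hU.mem w hwM hwb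
  refine hU.traceState.faithful _ hEM ?_
  have hsQ : star (Eω (x * limω v * y)) ∈ ultrapowerSet limω (N : Set (Op H)) :=
    ⟨fun n => star (w n), fun n => star_mem (hw n), hwb.star, by rw [hU.map_star w hwM hwb, hwl]⟩
  have h1Q : (1 : Op H) ∈ ultrapowerSet limω (N : Set (Op H)) :=
    ⟨fun _ => 1, fun _ => one_mem N, Bdd.const 1, hU.diag 1 (one_mem M)⟩
  have e1 := hEω.bimod _ hsQ _ hz _ h1Q
  rw [mul_one, mul_one] at e1
  rw [← e1, hEω.tr _ (mul_mem (star_mem hEM) hz)]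
  have hT : SeqIn (M : Set (Op H)) (fun n => star (w n) * (X x n * v n * X y n)) := fun n =>
    mul_mem (star_mem (hwM n)) (mul_mem (mul_mem (hXM x n) (hvM n)) (hXM y n))
  have hTb : Bdd (fun n => star (w n) * (X x n * v n * X y n)) :=
    hwb.star.mul (((hXb x).mul hvb).mul (hXb y))
  have e2 : limω (fun n => star (w n) * (X x n * v n * X y n))
      = star (Eω (x * limω v * y)) * (x * limω v * y) := by
    rw [hU.map_mul (fun n => star (w n)) (fun n => X x n * v n * X y n)
      (fun n => star_mem (hwM n)) hwb.star
      (fun n => mul_mem (mul_mem (hXM x n) (hvM n)) (hXM y n)) (((hXb x).mul hvb).mul (hXb y)),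
      hU.map_star w hwM hwb, hwl,
      hU.map_mul (fun n => X x n * v n) (X y) (fun n => mul_mem (hXM x n) (hvM n))
        ((hXb x).mul hvb) (hXM y) (hXb y),
      hU.map_mul (X x) v (hXM x) (hXb x) hvM hvb, hXl x (hF hx), hXl y (hF hy)]
  rw [← e2]
  obtain ⟨C, hC⟩ := hwb
  have hC0 : 0 ≤ C := (norm_nonneg _).trans (hC 0)
  refine tendsto_nhds_unique (hU.tr _ hT hTb) ?_
  have hτ : ∀ n, (τ (star (w n) * w n)).re ≤ C ^ 2 := fun n => by
    have e3 : (algebraMap ℝ (Op H) (C ^ 2)) = ((C ^ 2 : ℝ) : ℂ) • (1 : Op H) := by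
      rw [Algebra.algebraMap_eq_smul_one, Complex.coe_smul]
    have h3 : star (w n) * w n ≤ algebraMap ℝ (Op H) (C ^ 2) := by
      rw [← CStarAlgebra.norm_le_iff_le_algebraMap _ (by positivity) (star_mul_self_nonneg _),
        CStarRing.norm_star_mul_self, ← pow_two]
      have := hC n
      gcongr
    have h4 := tau_mono hU (hU.subset (mul_mem (star_mem (hwM n)) (hwM n)))
      (by rw [e3]; exact vn_smul _ (one_mem _)) h3
    rw [e3, map_smul, hU.traceState.map_one, smul_eq_mul, mul_one, Complex.ofReal_re] at h4
    exact h4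
  have hlim : Tendsto (fun n : ℕ => (1 / ((n : ℝ) + 1)) * C) (ω : Filter ℕ) (nhds 0) := by
    have := (tendsto_one_div_add_atTop_nhds_zero_nat (𝕜 := ℝ)).mul_const C
    rw [zero_mul] at this
    exact this.mono_left (free_atTop hω)
  refine squeeze_zero_norm (fun n => ?_) hlim
  exact hvF n _ (Finset.mem_image_of_mem _ hx) _ (Finset.mem_image_of_mem _ hy) (w n) (hw n) C hC0 (hτ n)

end PopaQ
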